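/- There exists a homeomorphism H of the Sierpiński carpet S onto itself which is topologically mixing, has a dense set of periodic points, and does not have Bowen's specification property. -/

import Mathlib

/-- The Sierpiński carpet: points of `[0,1]²` admitting ternary expansions with no index at
which both digits equal `1`. -/
def sierpinskiCarpet : Set (ℝ × ℝ) :=
  {p | ∃ a b : ℕ → Fin 3, (∀ i, ¬(a i = 1 ∧ b i = 1)) ∧
    p.1 = ∑' i : ℕ, (a i : ℝ) / 3 ^ (i + 1) ∧ p.2 = ∑' i : ℕ, (b i : ℝ) / 3 ^ (i + 1)}

/-- A map is topologically mixing if for all nonempty open `U, V` there is `N` with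
`T^n(U) ∩ V ≠ ∅` for all `n ≥ N`. -/
def TopologicallyMixing {X : Type*} [TopologicalSpace X] (T : X → X) : Prop :=
  ∀ U V : Set X, IsOpen U → IsOpen V → U.Nonempty → V.Nonempty →
    ∃ N : ℕ, ∀ n : ℕ, N ≤ n → (T^[n] '' U ∩ V).Nonempty

/-- Bowen's specification property. -/
def BowenSpecification {X : Type*} [MetricSpace X] (T : X → X) : Prop :=
  ∀ ε : ℝ, 0 < ε → ∃ N : ℕ, 0 < N ∧
    ∀ s : ℕ, 2 ≤ s → ∀ y : ℕ → X, ∀ j k : ℕ → ℕ,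
      j 0 = 0 → (∀ m, m < s → j m ≤ k m) →
      (∀ m, m + 1 < s → k m < j (m + 1) ∧ N ≤ j (m + 1) - k m) →
      ∃ x : X, ∀ m, m < s → ∀ i, j m ≤ i → i ≤ k m →
        dist (T^[i] x) (T^[i] (y m)) < ε

namespace CarpetDynamics

open Set Filter Topology Metric Asymptotics

/-- The plane with the sup norm. -/
abbrev Plane := ℝ × ℝ

/-- The direction of a vector, normalised to the unit sphere; `dir 0 = 0`. -/
noncomputable def dir (v : Plane) : Plane := ‖v‖⁻¹ • v

lemma norm_dir {v : Plane} (hv : v ≠ 0) : ‖dir v‖ = 1 := by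
  rw [dir, norm_smul, norm_inv, norm_norm, inv_mul_cancel₀ (norm_ne_zero_iff.2 hv)]

lemma norm_smul_dir (v : Plane) : ‖v‖ • dir v = v := by
  by_cases hv : v = 0
  · simp [hv]
  · rw [dir, smul_smul, mul_inv_cancel₀ (norm_ne_zero_iff.2 hv), one_smul]

lemma dir_zero : dir 0 = 0 := by simp [dir]

lemma dir_smul {t : ℝ} (ht : 0 < t) (v : Plane) : dir (t • v) = dir v := by
  rw [dir, dir, norm_smul, Real.norm_of_nonneg ht.le, smul_smul, mul_inv]
  congr 1
  field_simp

lemma dir_of_norm_eq_one {v : Plane} (hv : ‖v‖ = 1) : dir v = v := by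
  simp [dir, hv]

lemma continuousAt_dir {v : Plane} (hv : v ≠ 0) : ContinuousAt dir v :=
  (continuousAt_id.norm.inv₀ (norm_ne_zero_iff.2 hv)).smul continuousAt_id

lemma eq_dir_of_eq_smul {v θ : Plane} (h : v = ‖v‖ • θ) (hv : v ≠ 0) : θ = dir v := by
  have hn := norm_ne_zero_iff.2 hv
  rw [dir]
  conv_rhs => rw [h]
  rw [norm_smul, norm_norm]
  have hθ : ‖θ‖ = 1 := by
    have := congrArg norm h
    rw [norm_smul, norm_norm] at this
    exact mul_left_cancel₀ hn (by rw [← this, mul_one])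
  rw [hθ, mul_one, smul_smul, inv_mul_cancel₀ hn, one_smul]

/-- `h` acts on the directions at `a` by `ω`: if `z → a` with `dir (z - a) → θ`, then
`dir (h z - h a) → ω θ`. -/
structure DirAt (h : Plane → Plane) (a : Plane) (ω : Plane → Plane) : Prop where
  continuousAt : ContinuousAt h a
  continuousOn : ContinuousOn ω (sphere 0 1)
  injOn : InjOn ω (sphere 0 1)
  mapsTo : MapsTo ω (sphere 0 1) (sphere 0 1)
  tendsto : ∀ θ ∈ sphere (0 : Plane) 1, Tendsto (fun z => dir (h z - h a))
    (𝓝[≠] a ⊓ comap (fun z => dir (z - a)) (𝓝 θ)) (𝓝 (ω θ))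

lemma DirAt.comp {g h : Plane → Plane} {a : Plane} {ω η : Plane → Plane}
    (hg : DirAt g (h a) η) (hh : DirAt h a ω) : DirAt (g ∘ h) a (η ∘ ω) where
  continuousAt := hg.continuousAt.comp hh.continuousAt
  continuousOn := hg.continuousOn.comp hh.continuousOn hh.mapsTo
  injOn := hg.injOn.comp hh.injOn hh.mapsTo
  mapsTo := hg.mapsTo.comp hh.mapsTo
  tendsto θ hθ := by
    have h1 := hh.tendsto θ hθ
    refine (hg.tendsto (ω θ) (hh.mapsTo hθ)).comp ?_
    refine tendsto_inf.2 ⟨tendsto_nhdsWithin_iff.2 ⟨?_, ?_⟩, tendsto_comap_iff.2 h1⟩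
    · exact hh.continuousAt.tendsto.mono_left (inf_le_left.trans nhdsWithin_le_nhds)
    · have hne : ω θ ≠ 0 := by
        have := hh.mapsTo hθ
        rw [mem_sphere_zero_iff_norm] at this
        exact norm_ne_zero_iff.1 (by rw [this]; exact one_ne_zero)
      filter_upwards [h1.eventually_ne hne] with z hz
      intro hz'
      rw [mem_singleton_iff] at hz'
      exact hz (by rw [hz', sub_self, dir_zero])

/-- A first order expansion with an injective, positively homogeneous main part induces an
action on directions. -/
lemma DirAt.of_expansion {h L : Plane → Plane} {a : Plane} (hL : Continuous L)
    (hom : ∀ t : ℝ, 0 ≤ t → ∀ v, L (t • v) = t • L v) (inj : Function.Injective L)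
    (hexp : (fun z => h z - h a - L (z - a)) =o[𝓝 a] fun z => z - a) :
    DirAt h a (fun θ => dir (L θ)) := by
  have hL0 : L 0 = 0 := by simpa using hom 0 le_rfl 0
  have hLne : ∀ θ ∈ sphere (0 : Plane) 1, L θ ≠ 0 := by
    intro θ hθ h0
    rw [← hL0] at h0
    rw [inj h0] at hθ
    simp at hθ
  have hcont : ContinuousAt h a := by
    have h1 : Tendsto (fun z => h z - h a - L (z - a)) (𝓝 a) (𝓝 0) := by
      refine hexp.isBigO.trans_tendsto ?_
      have : Continuous fun z : Plane => z - a := by fun_prop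
      simpa using this.tendsto a
    have h2 : Tendsto (fun z => L (z - a)) (𝓝 a) (𝓝 0) := by
      have : Continuous fun z : Plane => L (z - a) := by fun_prop
      simpa [hL0] using this.tendsto a
    have h3 := (h1.add h2).add_const (h a)
    simpa [ContinuousAt] using h3
  refine ⟨hcont, ?_, ?_, ?_, ?_⟩
  · intro θ hθ
    exact ((continuousAt_dir (hLne θ hθ)).comp hL.continuousAt).continuousWithinAt
  · intro θ hθ θ' hθ' hEq
    rw [mem_sphere_zero_iff_norm] at hθ hθ'
    have h1 : L θ = L ((‖L θ‖ * ‖L θ'‖⁻¹) • θ') := by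
      rw [hom _ (by positivity), ← norm_smul_dir (L θ)]
      simp only at hEq
      rw [hEq, norm_smul, norm_norm, norm_dir (hLne θ' (by simpa using hθ')), mul_one]
      conv_rhs => rw [← norm_smul_dir (L θ')]
      have : ‖L θ'‖ ≠ 0 := norm_ne_zero_iff.2 (hLne θ' (by simpa using hθ'))
      rw [smul_smul]
      congr 1
      rw [norm_smul, norm_norm, norm_dir (hLne θ' (by simpa using hθ'))]
      field_simp
    have h2 := inj h1
    have h3 := congrArg norm h2
    rw [norm_smul, hθ, hθ', Real.norm_of_nonneg (by positivity), mul_one] at h3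
    rw [h2, ← h3, one_smul]
  · intro θ hθ
    rw [mem_sphere_zero_iff_norm]
    exact norm_dir (hLne θ hθ)
  · intro θ hθ
    set F := 𝓝[≠] a ⊓ comap (fun z : Plane => dir (z - a)) (𝓝 θ) with hF
    have hFa : F ≤ 𝓝 a := inf_le_left.trans nhdsWithin_le_nhds
    have hne : ∀ᶠ z in F, z - a ≠ 0 := by
      have : ∀ᶠ z in 𝓝[≠] a, z ∈ ({a}ᶜ : Set Plane) := self_mem_nhdsWithin
      exact (this.filter_mono inf_le_left).mono fun z hz => sub_ne_zero.2 hz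
    have hd : Tendsto (fun z : Plane => dir (z - a)) F (𝓝 θ) :=
      tendsto_comap.mono_left inf_le_right
    have h1 : Tendsto (fun z => ‖z - a‖⁻¹ • (h z - h a - L (z - a))) F (𝓝 0) := by
      have := (hexp.mono hFa)
      rw [tendsto_zero_iff_norm_tendsto_zero]
      have h2 := this.norm_norm.tendsto_div_nhds_zero
      refine h2.congr fun z => ?_
      rw [norm_smul, norm_inv, norm_norm, div_eq_inv_mul]
    have h2 : Tendsto (fun z => ‖z - a‖⁻¹ • (h z - h a)) F (𝓝 (L θ)) := by
      have h3 := h1.add ((hL.tendsto θ).comp hd)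
      rw [zero_add] at h3
      refine h3.congr fun z => ?_
      simp only [Function.comp_apply]
      rw [dir, hom _ (by positivity), ← smul_add, sub_add_cancel]
    refine ((continuousAt_dir (hLne θ hθ)).tendsto.comp h2).congr' ?_
    filter_upwards [hne] with z hz
    exact dir_smul (by positivity) _

lemma DirAt.of_hasFDerivAt {h : Plane → Plane} {a : Plane} {L : Plane →L[ℝ] Plane}
    (hd : HasFDerivAt h L a) (inj : Function.Injective L) :
    DirAt h a (fun θ => dir (L θ)) :=
  DirAt.of_expansion L.continuous (fun t _ v => L.map_smul t v) inj hd.isLittleO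

/-- Directions seen from `a`, transported by a map acting on directions. -/
lemma continuous_transport {Y : Type*} [TopologicalSpace Y] {p ϑ : Y → Plane} {a : Plane}
    {h ω : Plane → Plane} (hp : Continuous p) (hϑ : Continuous ϑ) (hn : ∀ y, ‖ϑ y‖ = 1)
    (hdir : ∀ y, p y - a = ‖p y - a‖ • ϑ y) (hc : Continuous fun y => h (p y))
    (hne : ∀ y, p y ≠ a → h (p y) ≠ h a) (hd : DirAt h a ω) [DecidableEq Plane] :
    Continuous fun y => if p y = a then ω (ϑ y) else dir (h (p y) - h a) := by
  rw [continuous_iff_continuousAt]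
  intro y₀
  by_cases hy : p y₀ = a
  · rw [ContinuousAt, if_pos hy]
    refine Tendsto.if ?_ ?_
    · have h1 : ContinuousOn ω (sphere 0 1) := hd.continuousOn
      have h2 : Tendsto ϑ (𝓝 y₀) (𝓝[sphere 0 1] (ϑ y₀)) :=
        tendsto_nhdsWithin_iff.2 ⟨hϑ.tendsto y₀, .of_forall fun y => by simpa using hn y⟩
      exact ((h1 (ϑ y₀) (by simpa using hn y₀)).tendsto.comp h2).mono_left inf_le_left
    · refine (hd.tendsto (ϑ y₀) (by simpa using hn y₀)).comp ?_
      have hev : ∀ᶠ y in 𝓝 y₀ ⊓ 𝓟 {y | ¬ p y = a}, p y ≠ a :=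
        eventually_inf_principal.2 (.of_forall fun y hy => hy)
      refine tendsto_inf.2 ⟨tendsto_nhdsWithin_iff.2 ⟨?_, hev⟩, tendsto_comap_iff.2 ?_⟩
      · have := (hp.tendsto y₀)
        rw [hy] at this
        exact this.mono_left inf_le_left
      · refine ((hϑ.tendsto y₀).mono_left inf_le_left).congr' ?_
        filter_upwards [hev] with y hy
        exact eq_dir_of_eq_smul (hdir y) (sub_ne_zero.2 hy)
  · have h1 : ContinuousAt (fun y => dir (h (p y) - h a)) y₀ := by
      have h2 : ContinuousAt (fun y => h (p y) - h a) y₀ := (hc.sub continuous_const).continuousAt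
      exact ContinuousAt.comp (f := fun y => h (p y) - h a)
        (continuousAt_dir (sub_ne_zero.2 (hne y₀ hy))) h2
    refine h1.congr ?_
    filter_upwards [hp.continuousAt.eventually_ne hy] with y hy
    rw [if_neg hy]

/-- The blow-up of `M` at the points of `D`: every `d ∈ D` is replaced by its circle of
directions. -/
def BlowUp (M D : Set Plane) : Set (Plane × (D → Plane)) :=
  {q | q.1 ∈ M ∧ ∀ d : D, ‖q.2 d‖ = 1 ∧ q.1 - d = ‖q.1 - d‖ • q.2 d}

lemma isCompact_blowUp {M : Set Plane} (hM : IsCompact M) (D : Set Plane) :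
    IsCompact (BlowUp M D) := by
  have hK : IsCompact (M ×ˢ (univ.pi fun _ : D => closedBall (0 : Plane) 1)) :=
    hM.prod (isCompact_univ_pi fun _ => isCompact_closedBall _ _)
  refine hK.of_isClosed_subset ?_ ?_
  · refine IsClosed.inter (hM.isClosed.preimage continuous_fst) ?_
    have : {q : Plane × (D → Plane) | ∀ d : D, ‖q.2 d‖ = 1 ∧ q.1 - d = ‖q.1 - d‖ • q.2 d} =
      ⋂ d : D, ({q : Plane × (D → Plane) | ‖q.2 d‖ = 1} ∩
        {q : Plane × (D → Plane) | q.1 - (d : Plane) = ‖q.1 - (d : Plane)‖ • q.2 d}) := by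
      ext q
      simp only [mem_ofPred_eq, mem_iInter, mem_inter_iff]
    change IsClosed {q : Plane × (D → Plane) |
      ∀ d : D, ‖q.2 d‖ = 1 ∧ q.1 - d = ‖q.1 - d‖ • q.2 d}
    rw [this]
    refine isClosed_iInter fun d => IsClosed.inter ?_ ?_
    · exact isClosed_eq (by fun_prop) continuous_const
    · exact isClosed_eq (by fun_prop) (by fun_prop)
  · rintro q ⟨h1, h2⟩
    exact ⟨h1, fun d _ => by simpa using (h2 d).1.le⟩

/-- Points of the blow-up away from the exceptional circles are determined by their image. -/
lemma BlowUp.eq_of_fst_eq {M D : Set Plane} {q q' : BlowUp M D} (h : q.1.1 = q'.1.1)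
    (hD : ∀ d : D, q.1.1 = d → q.1.2 d = q'.1.2 d) : q = q' := by
  refine Subtype.ext (Prod.ext h (funext fun d => ?_))
  by_cases hd : q.1.1 = d
  · exact hD d hd
  · rw [eq_dir_of_eq_smul (q.2.2 d).2 (sub_ne_zero.2 hd),
      eq_dir_of_eq_smul (q'.2.2 d).2 (sub_ne_zero.2 (h ▸ hd)), h]

lemma BlowUp.eq_of_fst_eq_of_notMem {M D : Set Plane} {q q' : BlowUp M D} (h : q.1.1 = q'.1.1)
    (hD : q.1.1 ∉ D) : q = q' :=
  BlowUp.eq_of_fst_eq h fun d hd => absurd (hd ▸ d.2) hD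

lemma exists_blowUp {M D : Set Plane} {z : Plane} (hz : z ∈ M) (hD : z ∉ D) :
    ∃ q : BlowUp M D, q.1.1 = z := by
  refine ⟨⟨(z, fun d => dir (z - d)), hz, fun d => ⟨norm_dir ?_, (norm_smul_dir _).symm⟩⟩, rfl⟩
  exact sub_ne_zero.2 fun h => hD (h ▸ d.2)

lemma dense_regular {M D : Set Plane} (hD : D.Countable) (hDM : D ⊆ interior M) :
    Dense {q : BlowUp M D | q.1.1 ∉ D} := by
  intro q
  by_cases hq : q.1.1 ∈ D
  swap
  · exact subset_closure hq
  set d : D := ⟨q.1.1, hq⟩ with hd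
  set γ : ℝ → Plane := fun t => (d : Plane) + t • q.1.2 d with hγ
  have hθ : ‖q.1.2 d‖ = 1 := (q.2.2 d).1
  have hθ0 : q.1.2 d ≠ 0 := norm_ne_zero_iff.1 (by rw [hθ]; exact one_ne_zero)
  have hγc : Continuous γ := by fun_prop
  have hγ0 : γ 0 = q.1.1 := by simp [hγ, hd]
  have hγinj : Function.Injective γ := by
    intro s t hst
    exact smul_left_injective ℝ hθ0 (add_left_cancel hst)
  have hpre : (γ ⁻¹' D).Countable := hD.preimage hγinj
  have hdense : Dense (γ ⁻¹' D)ᶜ := hpre.dense_compl ℝ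
  have hfreq : (𝓝[>] (0 : ℝ) ⊓ 𝓟 (γ ⁻¹' D)ᶜ).NeBot := by
    rw [inf_principal_neBot_iff]
    intro s hs
    obtain ⟨ε, hε, hsub⟩ := mem_nhdsGT_iff_exists_Ioo_subset.1 hs
    obtain ⟨t, ht1, ht2⟩ := hdense.exists_mem_open isOpen_Ioo (nonempty_Ioo.2 hε)
    exact ⟨t, hsub ht2, ht1⟩
  set F := 𝓝[>] (0 : ℝ) ⊓ 𝓟 (γ ⁻¹' D)ᶜ with hF
  have hF0 : F ≤ 𝓝 0 := inf_le_left.trans nhdsWithin_le_nhds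
  have hFpos : ∀ᶠ t in F, 0 < t := by
    have h : ∀ᶠ t in 𝓝[>] (0 : ℝ), t ∈ Ioi (0 : ℝ) := self_mem_nhdsWithin
    exact h.filter_mono inf_le_left
  have hFD : ∀ᶠ t in F, γ t ∉ D := (mem_inf_of_right (mem_principal_self _) : _)
  have hFM : ∀ᶠ t in F, γ t ∈ M := by
    have h1 : ∀ᶠ t in 𝓝 (0 : ℝ), γ t ∈ interior M :=
      hγc.continuousAt.eventually_mem (by
        rw [hγ0]; exact isOpen_interior.mem_nhds (hDM hq))
    exact (h1.filter_mono hF0).mono fun t ht => interior_subset ht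
  rw [mem_closure_iff_frequently]
  have hgood : ∀ᶠ t in F, ∃ q' : BlowUp M D, q'.1.1 = γ t := by
    filter_upwards [hFD, hFM] with t h1 h2
    exact exists_blowUp h2 h1
  classical
  set Γ : ℝ → BlowUp M D := fun t => if h : ∃ q' : BlowUp M D, q'.1.1 = γ t then h.choose else q
    with hΓ
  have hΓ1 : ∀ᶠ t in F, (Γ t).1.1 = γ t := by
    filter_upwards [hgood] with t ht
    simp only [hΓ, dif_pos ht]
    exact ht.choose_spec
  have hlim : Tendsto Γ F (𝓝 q) := by
    rw [tendsto_subtype_rng, nhds_prod_eq]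
    have hfst : Tendsto (fun t => (Γ t).1.1) F (𝓝 q.1.1) := by
      have := (hγc.tendsto 0).mono_left hF0
      rw [hγ0] at this
      exact this.congr' (hΓ1.mono fun t ht => ht.symm)
    refine Tendsto.prodMk hfst ?_
    rw [tendsto_pi_nhds]
    intro d'
    by_cases hdd : d' = d
    · subst hdd
      refine tendsto_const_nhds.congr' ?_
      filter_upwards [hΓ1, hFpos] with t ht hpos
      have h1 : (Γ t).1.1 - d = t • q.1.2 d := by rw [ht]; simp [hγ]
      have h2 := eq_dir_of_eq_smul ((Γ t).2.2 d).2 (by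
        rw [h1]; exact smul_ne_zero hpos.ne' hθ0)
      rw [h2, h1, dir_smul hpos, dir_of_norm_eq_one hθ]
    · have hne : q.1.1 - d' ≠ 0 := by
        rw [sub_ne_zero]
        intro h
        exact hdd (Subtype.ext h.symm)
      rw [eq_dir_of_eq_smul (q.2.2 d').2 hne]
      have h1 := (continuousAt_dir hne).tendsto.comp (hfst.sub_const (d' : Plane))
      refine h1.congr' ?_
      filter_upwards [hΓ1, hFD] with t ht htD
      refine (eq_dir_of_eq_smul ((Γ t).2.2 d').2 ?_).symm
      rw [sub_ne_zero, ht]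
      exact fun h => htD (h ▸ d'.2)
  refine hlim.frequently (Eventually.frequently ?_)
  filter_upwards [hΓ1, hFD] with t ht htD
  simpa [ht] using htD

/-- A homeomorphism of `M` carrying `D` to `D'` and acting on the directions at `D` lifts to the
blow-ups. -/
lemma exists_homeomorph_blowUp {M D D' : Set Plane} (hM : IsCompact M) (hD' : D'.Countable)
    (hDM : D ⊆ M) (hDM' : D' ⊆ interior M) {h : Plane → Plane} (hc : ContinuousOn h M)
    (hb : BijOn h M M) (hDD : h '' D = D') (hdir : ∀ d ∈ D, ∃ ω, DirAt h d ω) :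
    ∃ Hh : BlowUp M D ≃ₜ BlowUp M D', ∀ q, (Hh q).1.1 = h q.1.1 := by
  classical
  have hpre : ∀ d' : D', ∃ d : D, h d = d' := by
    intro d'
    have hmem : (d' : Plane) ∈ h '' D := by rw [hDD]; exact d'.2
    obtain ⟨d, hd, hd'⟩ := hmem
    exact ⟨⟨d, hd⟩, hd'⟩
  choose s hs using hpre
  choose ω hω using fun d : D => hdir d d.2
  have hinj : ∀ (q : BlowUp M D) (d : D), q.1.1 ≠ d → h q.1.1 ≠ h d := fun q d hne hEq =>
    hne (hb.injOn q.2.1 (hDM d.2) hEq)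
  let comp : BlowUp M D → D' → Plane := fun q d' =>
    if q.1.1 = s d' then ω (s d') (q.1.2 (s d')) else dir (h q.1.1 - h (s d'))
  have hmem : ∀ q : BlowUp M D, (h q.1.1, comp q) ∈ BlowUp M D' := by
    intro q
    refine ⟨hb.mapsTo q.2.1, fun d' => ?_⟩
    simp only [comp]
    split_ifs with h1
    · refine ⟨?_, ?_⟩
      · simpa using (hω (s d')).mapsTo (by simpa using (q.2.2 (s d')).1)
      · rw [h1, hs, sub_self, norm_zero, zero_smul]
    · have h2 := hinj q (s d') h1
      rw [hs] at h2 ⊢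
      exact ⟨norm_dir (sub_ne_zero.2 h2), (norm_smul_dir _).symm⟩
  let F : BlowUp M D → BlowUp M D' := fun q => ⟨(h q.1.1, comp q), hmem q⟩
  have hch : Continuous fun q : BlowUp M D => h q.1.1 :=
    hc.comp_continuous (by fun_prop) fun q => q.2.1
  have hF : Continuous F := by
    refine Continuous.subtype_mk (hch.prodMk (continuous_pi fun d' => ?_)) _
    refine continuous_transport (p := fun q : BlowUp M D => q.1.1)
      (ϑ := fun q : BlowUp M D => q.1.2 (s d')) (by fun_prop) ?_ (fun q => (q.2.2 _).1)
      (fun q => (q.2.2 _).2) hch (fun q => hinj q _) (hω (s d'))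
    exact (continuous_apply (s d')).comp (continuous_snd.comp continuous_subtype_val)
  have hFinj : Function.Injective F := by
    intro q q' hEq
    have h1 : h q.1.1 = h q'.1.1 := congrArg (fun x => x.1.1) hEq
    have h2 : q.1.1 = q'.1.1 := hb.injOn q.2.1 q'.2.1 h1
    refine BlowUp.eq_of_fst_eq h2 fun d hd => ?_
    have hd' : h d ∈ D' := hDD ▸ mem_image_of_mem h d.2
    have hsd : s ⟨h d, hd'⟩ = d :=
      Subtype.ext (hb.injOn (hDM (s _).2) (hDM d.2) (hs ⟨h d, hd'⟩))
    have h3 : comp q ⟨h d, hd'⟩ = comp q' ⟨h d, hd'⟩ :=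
      congrFun (congrArg (fun x => x.1.2) hEq) _
    simp only [comp, hsd, if_pos hd, if_pos (h2 ▸ hd)] at h3
    exact (hω d).injOn (by simpa using (q.2.2 d).1) (by simpa using (q'.2.2 d).1) h3
  have : CompactSpace (BlowUp M D) := isCompact_iff_compactSpace.1 (isCompact_blowUp hM D)
  have hFsurj : Function.Surjective F := by
    rw [← range_eq_univ, ← (isCompact_range hF).isClosed.closure_eq, eq_univ_iff_forall]
    intro q'
    refine closure_mono ?_ (dense_regular hD' hDM' q')
    intro r hr
    obtain ⟨z, hz, hzr⟩ := hb.surjOn r.2.1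
    obtain ⟨q, hq⟩ := exists_blowUp (M := M) (D := D) hz fun hzD =>
      hr (hzr ▸ hDD ▸ mem_image_of_mem h hzD)
    refine ⟨q, BlowUp.eq_of_fst_eq_of_notMem ?_ ?_⟩
    · change h q.1.1 = r.1.1
      rw [hq, hzr]
    · change h q.1.1 ∉ D'
      rwa [hq, hzr]
  exact ⟨hF.homeoOfEquivCompactToT2 (f := Equiv.ofBijective F ⟨hFinj, hFsurj⟩), fun q => rfl⟩

/-- A `C¹` perturbation of size at most `ε`, supported in the open unit ball and vanishing
on `F`. -/
structure SmallPerturbation (ε : ℝ) (F : Set Plane) (δ : Plane → Plane) : Prop where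
  contDiff : ContDiff ℝ 1 δ
  eq_zero_of_notMem : ∀ x ∉ ball (0 : Plane) 1, δ x = 0
  eq_zero_of_mem : ∀ x ∈ F, δ x = 0
  norm_le : ∀ x, ‖δ x‖ ≤ ε
  norm_fderiv_le : ∀ x, ‖fderiv ℝ δ x‖ ≤ ε

lemma SmallPerturbation.differentiable {ε : ℝ} {F : Set Plane} {δ : Plane → Plane}
    (h : SmallPerturbation ε F δ) : Differentiable ℝ δ :=
  h.contDiff.differentiable one_ne_zero

lemma SmallPerturbation.zero {ε : ℝ} (hε : 0 ≤ ε) (F : Set Plane) :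
    SmallPerturbation ε F (fun _ => 0) where
  contDiff := contDiff_const
  eq_zero_of_notMem _ _ := rfl
  eq_zero_of_mem _ _ := rfl
  norm_le x := by simpa using hε
  norm_fderiv_le x := by simpa using hε

lemma SmallPerturbation.add {ε ε' : ℝ} {F : Set Plane} {δ δ' : Plane → Plane}
    (h : SmallPerturbation ε F δ) (h' : SmallPerturbation ε' F δ') :
    SmallPerturbation (ε + ε') F (fun x => δ x + δ' x) where
  contDiff := h.contDiff.add h'.contDiff
  eq_zero_of_notMem x hx := by rw [h.eq_zero_of_notMem x hx, h'.eq_zero_of_notMem x hx, add_zero]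
  eq_zero_of_mem x hx := by rw [h.eq_zero_of_mem x hx, h'.eq_zero_of_mem x hx, add_zero]
  norm_le x := (norm_add_le _ _).trans (add_le_add (h.norm_le x) (h'.norm_le x))
  norm_fderiv_le x := by
    rw [fderiv_fun_add (h.differentiable x) (h'.differentiable x)]
    exact (norm_add_le _ _).trans (add_le_add (h.norm_fderiv_le x) (h'.norm_fderiv_le x))

lemma SmallPerturbation.mono {ε : ℝ} {F F' : Set Plane} {δ : Plane → Plane}
    (h : SmallPerturbation ε F δ) (hF : F' ⊆ F) : SmallPerturbation ε F' δ :=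
  { h with eq_zero_of_mem := fun x hx => h.eq_zero_of_mem x (hF hx) }

lemma exists_smallPerturbation {F : Set Plane} (hF : F.Finite) {y : Plane}
    (hy : y ∈ ball (0 : Plane) 1) (hyF : y ∉ F) {ε : ℝ} (hε : 0 < ε) :
    ∃ ρ > 0, ∀ a ∈ ball y ρ, ∀ v : Plane, ‖v‖ < ρ →
      ∃ δ, SmallPerturbation ε F δ ∧ δ a = v := by
  have hopen : IsOpen (ball (0 : Plane) 1 \ F) := isOpen_ball.sdiff hF.isClosed
  obtain ⟨s, hs, hsub⟩ := Metric.isOpen_iff.1 hopen y ⟨hy, hyF⟩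
  let f : ContDiffBump y := ⟨s / 2, s, by positivity, by linarith⟩
  have hfd : Continuous (fderiv ℝ f) := (f.contDiff (n := 1)).continuous_fderiv one_ne_zero
  obtain ⟨C, hC⟩ := hfd.bounded_above_of_compact_support (f.hasCompactSupport.fderiv ℝ)
  have hC0 : 0 ≤ C := (norm_nonneg _).trans (hC 0)
  refine ⟨min (s / 2) (ε / (C + 1)), by positivity, fun a ha v hv => ?_⟩
  have hv1 : (C + 1) * ‖v‖ ≤ ε := by
    have := hv.le.trans (min_le_right _ _)
    rwa [le_div_iff₀ (by positivity), mul_comm] at this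
  have hzero : ∀ x, x ∉ ball (0 : Plane) 1 \ F → f x = 0 := fun x hx =>
    f.zero_of_le_dist (by
      by_contra h
      exact hx (hsub (by simpa using h)))
  refine ⟨fun x => f x • v, ⟨f.contDiff.smul contDiff_const, ?_, ?_, ?_, ?_⟩, ?_⟩
  · intro x hx
    simp only [hzero x fun h => hx h.1, zero_smul]
  · intro x hx
    simp only [hzero x fun h => h.2 hx, zero_smul]
  · intro x
    rw [norm_smul, Real.norm_of_nonneg f.nonneg]
    nlinarith [f.le_one (x := x), norm_nonneg v]
  · intro x
    have hd : DifferentiableAt ℝ f x := (f.contDiff (n := 1)).differentiable one_ne_zero x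
    rw [fderiv_smul_const hd, ContinuousLinearMap.norm_smulRight_apply]
    nlinarith [hC x, norm_nonneg v]
  · have : f a = 1 := f.one_of_mem_closedBall
      (ball_subset_closedBall (ball_subset_ball (min_le_left _ _) ha))
    simp only [this, one_smul]

lemma bijective_id_add {g : Plane → Plane} (hg : LipschitzWith (1 / 2) g) :
    Function.Bijective fun x => x + g x := by
  constructor
  · intro x y hxy
    have h1 : x - y = g y - g x := by
      simp only at hxy
      rw [sub_eq_sub_iff_add_eq_add, hxy, add_comm]
    have h2 := hg.dist_le_mul y x
    rw [dist_eq_norm, ← h1, dist_comm, dist_eq_norm] at h2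
    have h3 : ‖x - y‖ = 0 := by
      push_cast at h2
      nlinarith [norm_nonneg (x - y)]
    exact sub_eq_zero.1 (norm_eq_zero.1 h3)
  · intro y
    have hc : ContractingWith (1 / 2) fun x => y - g x := by
      refine ⟨by rw [← NNReal.coe_lt_coe]; norm_num, LipschitzWith.of_dist_le_mul fun a b => ?_⟩
      rw [dist_sub_left]
      exact hg.dist_le_mul a b
    refine ⟨hc.fixedPoint, ?_⟩
    have h : y - g hc.fixedPoint = hc.fixedPoint := hc.fixedPoint_isFixedPt
    exact sub_eq_iff_eq_add.1 h |>.symm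

/-- Stage of the back-and-forth construction: a perturbation `g` of the identity with derivative
bounded by `c` such that `id + g` maps the finite set `F ⊆ D` into `D'`. -/
structure Stage (D D' : Set Plane) (c : ℝ) (p : (Plane → Plane) × Set Plane) : Prop where
  small : SmallPerturbation c ∅ p.1
  finite : p.2.Finite
  subset : p.2 ⊆ D
  map_mem : ∀ x ∈ p.2, x + p.1 x ∈ D'

lemma SmallPerturbation.lipschitz {g : Plane → Plane} {c : ℝ} {F : Set Plane}
    (h : SmallPerturbation c F g) (hc : c ≤ 1 / 2) : LipschitzWith (1 / 2) g :=
  lipschitzWith_of_nnnorm_fderiv_le h.differentiable fun x => by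
    rw [← NNReal.coe_le_coe]
    simpa using (h.norm_fderiv_le x).trans hc

lemma id_add_mem_ball_iff {g : Plane → Plane} (hg : LipschitzWith (1 / 2) g)
    (h0 : ∀ x ∉ ball (0 : Plane) 1, g x = 0) (x : Plane) :
    x + g x ∈ ball (0 : Plane) 1 ↔ x ∈ ball (0 : Plane) 1 := by
  constructor
  · intro h
    by_contra hx
    rw [h0 x hx, add_zero] at h
    exact hx h
  · intro hx
    by_contra h
    have h1 : (fun x => x + g x) (x + g x) = (fun x => x + g x) x := by
      simp only [h0 _ h, add_zero]
    rw [(bijective_id_add hg).1 h1] at h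
    exact h hx

lemma Stage.extend {D D' : Set Plane} {c ε : ℝ} {p : (Plane → Plane) × Set Plane}
    (hp : Stage D D' c p) {δ : Plane → Plane} (hδ : SmallPerturbation ε p.2 δ) {a : Plane}
    (ha : a ∈ D) (ha' : a + (p.1 a + δ a) ∈ D') :
    Stage D D' (c + ε) (fun x => p.1 x + δ x, insert a p.2) where
  small := hp.small.add (hδ.mono (empty_subset _))
  finite := hp.finite.insert a
  subset := insert_subset ha hp.subset
  map_mem := by
    rintro x (rfl | hx)
    · exact ha'
    · simpa [hδ.eq_zero_of_mem x hx] using hp.map_mem x hx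

section
variable {D D' : Set Plane}

lemma Stage.forward (hDU : D ⊆ ball 0 1) (hdense' : ball 0 1 ⊆ closure D') {c ε : ℝ} (hε : 0 < ε)
    (hc : c ≤ 1 / 2) {p : (Plane → Plane) × Set Plane} (hp : Stage D D' c p) {d : Plane}
    (hd : d ∈ D) : ∃ δ, SmallPerturbation ε p.2 δ ∧
      Stage D D' (c + ε) (fun x => p.1 x + δ x, insert d p.2) := by
  by_cases hdF : d ∈ p.2
  · refine ⟨_, .zero hε.le _, hp.extend (.zero hε.le _) hd ?_⟩
    simpa using hp.map_mem d hdF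
  · obtain ⟨ρ, hρ, h⟩ := exists_smallPerturbation hp.finite (hDU hd) hdF hε
    have hmem := (id_add_mem_ball_iff (hp.small.lipschitz hc) hp.small.eq_zero_of_notMem d).2
      (hDU hd)
    obtain ⟨d', hd', hdist⟩ := Metric.mem_closure_iff.1 (hdense' hmem) ρ hρ
    obtain ⟨δ, hδ, hδd⟩ := h d (mem_ball_self hρ) (d' - (d + p.1 d)) (by
      rwa [← dist_eq_norm, dist_comm])
    refine ⟨δ, hδ, hp.extend hδ hd ?_⟩
    rw [hδd]
    convert hd' using 1
    abel

lemma Stage.backward (hDU' : D' ⊆ ball 0 1) (hdense : ball 0 1 ⊆ closure D) {c ε : ℝ} (hε : 0 < ε)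
    (hc : c ≤ 1 / 2) {p : (Plane → Plane) × Set Plane} (hp : Stage D D' c p) {d' : Plane}
    (hd' : d' ∈ D') : ∃ δ a, SmallPerturbation ε p.2 δ ∧
      Stage D D' (c + ε) (fun x => p.1 x + δ x, insert a p.2) ∧ a + (p.1 a + δ a) = d' := by
  have hlip := hp.small.lipschitz hc
  obtain ⟨y, hy⟩ := (bijective_id_add hlip).2 d'
  simp only at hy
  by_cases hyF : y ∈ p.2
  · refine ⟨_, y, .zero hε.le _, hp.extend (.zero hε.le _) (hp.subset hyF) ?_, ?_⟩
    · simpa [hy] using hd'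
    · simpa using hy
  · have hyU := (id_add_mem_ball_iff hlip hp.small.eq_zero_of_notMem y).1 (hy ▸ hDU' hd')
    obtain ⟨ρ, hρ, h⟩ := exists_smallPerturbation hp.finite hyU hyF hε
    obtain ⟨a, ha, hdist⟩ := Metric.mem_closure_iff.1 (hdense hyU) (ρ / 2) (by positivity)
    have hlt : ‖d' - (a + p.1 a)‖ < ρ := by
      have h1 := hlip.dist_le_mul y a
      push_cast at h1
      rw [← hy, ← dist_eq_norm]
      have h2 := dist_add_add_le y (p.1 y) a (p.1 a)
      nlinarith [dist_nonneg (x := y) (y := a)]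
    obtain ⟨δ, hδ, hδa⟩ := h a (by rw [mem_ball, dist_comm]; linarith) _ hlt
    have hEq : a + (p.1 a + δ a) = d' := by rw [hδa]; abel
    exact ⟨δ, a, hδ, hp.extend hδ ha (hEq ▸ hd'), hEq⟩

lemma Stage.step (hDU : D ⊆ ball 0 1) (hDU' : D' ⊆ ball 0 1) (hdense : ball 0 1 ⊆ closure D)
    (hdense' : ball 0 1 ⊆ closure D') {c ε : ℝ} (hε : 0 < ε) (hc : c + ε ≤ 1 / 2)
    {p : (Plane → Plane) × Set Plane} (hp : Stage D D' c p) {d d' : Plane} (hd : d ∈ D)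
    (hd' : d' ∈ D') : ∃ q, Stage D D' (c + ε) q ∧ p.2 ⊆ q.2 ∧
      SmallPerturbation ε p.2 (fun x => q.1 x - p.1 x) ∧ d ∈ q.2 ∧ ∃ a ∈ q.2, a + q.1 a = d' := by
  obtain ⟨δ, hδ, h1⟩ := hp.forward hDU hdense' (half_pos hε) (by linarith) hd
  obtain ⟨δ', a, hδ', h2, h3⟩ := h1.backward hDU' hdense (half_pos hε) (by linarith) hd'
  rw [add_assoc, add_halves] at h2
  refine ⟨_, h2, ?_, ?_, ?_, a, mem_insert _ _, h3⟩
  · exact (subset_insert _ _).trans (subset_insert _ _)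
  · have := hδ.add (hδ'.mono (subset_insert _ _))
    rw [add_halves] at this
    convert this using 2
    simp only
    abel
  · exact mem_insert_of_mem _ (mem_insert _ _)

/-- Any two countable dense subsets of the open square are matched by a diffeomorphism which is
the identity off the square. -/
theorem exists_diffeo_image_eq (hDc : D.Countable) (hDc' : D'.Countable) (hDU : D ⊆ ball 0 1)
    (hDU' : D' ⊆ ball 0 1) (hdense : ball 0 1 ⊆ closure D) (hdense' : ball 0 1 ⊆ closure D') :
    ∃ Φ : Plane → Plane, Continuous Φ ∧ BijOn Φ (closedBall 0 1) (closedBall 0 1) ∧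
      Φ '' D = D' ∧ ∀ x, ∃ L : Plane →L[ℝ] Plane, HasFDerivAt Φ L x ∧ Function.Injective L := by
  have hne : ∀ {E : Set Plane}, ball 0 1 ⊆ closure E → E.Nonempty := fun h =>
    closure_nonempty_iff.1 ⟨0, h (mem_ball_self one_pos)⟩
  obtain ⟨e, he⟩ := hDc.exists_eq_range (hne hdense)
  obtain ⟨e', he'⟩ := hDc'.exists_eq_range (hne hdense')
  have hstep : ∀ (n : ℕ) (p : (Plane → Plane) × Set Plane),
      ∃ q, Stage D D' (1 / 2 - (1 / 2) ^ (n + 1)) p →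
        Stage D D' (1 / 2 - (1 / 2) ^ (n + 1 + 1)) q ∧ p.2 ⊆ q.2 ∧
        SmallPerturbation ((1 / 2) ^ (n + 2)) p.2 (fun x => q.1 x - p.1 x) ∧ e n ∈ q.2 ∧
        ∃ a ∈ q.2, a + q.1 a = e' n := by
    intro n p
    by_cases hp : Stage D D' (1 / 2 - (1 / 2) ^ (n + 1)) p
    · have hadd : (1 / 2 - (1 / 2) ^ (n + 1) : ℝ) + (1 / 2) ^ (n + 2) =
          1 / 2 - (1 / 2) ^ (n + 1 + 1) := by ring
      have hpos : (0 : ℝ) < (1 / 2) ^ (n + 1 + 1) := by positivity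
      obtain ⟨q, hq⟩ := hp.step hDU hDU' hdense hdense' (ε := (1 / 2) ^ (n + 2))
        (by positivity) (by rw [hadd]; linarith) (he ▸ mem_range_self n)
        (he' ▸ mem_range_self n)
      rw [hadd] at hq
      exact ⟨q, fun _ => hq⟩
    · exact ⟨p, fun h => absurd h hp⟩
  choose nxt hnxt using hstep
  let S : ℕ → (Plane → Plane) × Set Plane := fun n => Nat.rec (fun _ => 0, ∅) nxt n
  have hS : ∀ n, Stage D D' (1 / 2 - (1 / 2) ^ (n + 1)) (S n) := by
    intro n
    induction n with
    | zero => exact ⟨by simpa [S] using SmallPerturbation.zero le_rfl _, finite_empty,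
        empty_subset _, by simp [S]⟩
    | succ n ih => exact (hnxt n _ ih).1
  have hS' := fun n => (hnxt n (S n) (hS n)).2
  have hmono : Monotone fun n => (S n).2 := monotone_nat_of_le_succ fun n => (hS' n).1
  let δ : ℕ → Plane → Plane := fun n x => (S (n + 1)).1 x - (S n).1 x
  have hδ : ∀ n, SmallPerturbation ((1 / 2) ^ (n + 2)) (S n).2 (δ n) := fun n => (hS' n).2.1
  have hu : HasSum (fun n : ℕ => ((1 : ℝ) / 2) ^ (n + 2)) (1 / 2) := by
    have := hasSum_geometric_two.mul_right (((1 : ℝ) / 2) ^ 2)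
    simp only [← pow_add] at this
    have h2 : (2 : ℝ) * (1 / 2) ^ 2 = 1 / 2 := by norm_num
    rwa [h2] at this
  have hsummable : ∀ x, Summable fun n => δ n x := fun x =>
    .of_norm_bounded hu.summable fun n => (hδ n).norm_le x
  let g : Plane → Plane := fun x => ∑' n, δ n x
  have hgF : ∀ n, ∀ x ∈ (S n).2, g x = (S n).1 x := by
    intro n x hx
    have h1 := (hsummable x).hasSum.tendsto_sum_nat
    refine tendsto_nhds_unique h1 (tendsto_const_nhds.congr' ?_)
    filter_upwards [eventually_ge_atTop n] with m hm
    have h2 : ∀ m, ∑ i ∈ Finset.range m, δ i x = (S m).1 x := by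
      intro m
      rw [Finset.sum_range_sub fun i => (S i).1 x]
      simp [S]
    rw [h2]
    induction m, hm using Nat.le_induction with
    | base => rfl
    | succ m hm ih =>
      rw [ih]
      exact (sub_eq_zero.1 ((hδ m).eq_zero_of_mem x (hmono hm hx))).symm
  have hg : ∀ x, HasFDerivAt g (∑' n, fderiv ℝ (δ n) x) x := fun x =>
    hasFDerivAt_tsum hu.summable (fun n x => ((hδ n).differentiable x).hasFDerivAt)
      (fun n x => (hδ n).norm_fderiv_le x) (hsummable 0) x
  have hgn : ∀ x, ‖∑' n, fderiv ℝ (δ n) x‖ ≤ 1 / 2 := fun x =>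
    tsum_of_norm_bounded hu fun n => (hδ n).norm_fderiv_le x
  have hlip : LipschitzWith (1 / 2) g :=
    lipschitzWith_of_nnnorm_fderiv_le (fun x => (hg x).differentiableAt) fun x => by
      rw [(hg x).fderiv, ← NNReal.coe_le_coe]
      simpa using hgn x
  have hg0 : ∀ x ∉ ball (0 : Plane) 1, g x = 0 := fun x hx => by
    simp only [g, (hδ _).eq_zero_of_notMem x hx, tsum_zero]
  have hbij := bijective_id_add hlip
  have hball := id_add_mem_ball_iff hlip hg0
  have hcl : ∀ x, x + g x ∈ closedBall (0 : Plane) 1 ↔ x ∈ closedBall (0 : Plane) 1 := by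
    intro x
    by_cases hx : x ∈ ball (0 : Plane) 1
    · exact iff_of_true (ball_subset_closedBall ((hball x).2 hx)) (ball_subset_closedBall hx)
    · rw [hg0 x hx, add_zero]
  have hmaps : ∀ n, ∀ x ∈ (S n).2, x + g x ∈ D' := fun n x hx => by
    rw [hgF n x hx]
    exact (hS n).map_mem x hx
  refine ⟨fun x => x + g x, continuous_id.add hlip.continuous, ⟨fun x hx => (hcl x).2 hx,
    hbij.1.injOn, fun y hy => ?_⟩, Subset.antisymm ?_ ?_, fun x => ?_⟩
  · obtain ⟨x, rfl⟩ := hbij.2 y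
    exact ⟨x, (hcl x).1 hy, rfl⟩
  · rintro _ ⟨x, hx, rfl⟩
    rw [he] at hx
    obtain ⟨n, rfl⟩ := hx
    exact hmaps (n + 1) _ (hS' n).2.2.1
  · intro y hy
    rw [he'] at hy
    obtain ⟨n, rfl⟩ := hy
    obtain ⟨a, ha, hEq⟩ := (hS' n).2.2.2
    refine ⟨a, (hS (n + 1)).subset ha, ?_⟩
    simp only
    rw [hgF (n + 1) a ha]
    exact hEq
  · refine ⟨_, (hasFDerivAt_id x).add (hg x), ?_⟩
    rw [injective_iff_map_eq_zero]
    intro v hv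
    have h1 : v = -(∑' n, fderiv ℝ (δ n) x) v := eq_neg_of_add_eq_zero_left hv
    have h2 : ‖v‖ ≤ 1 / 2 * ‖v‖ := by
      conv_lhs => rw [h1, norm_neg]
      exact (ContinuousLinearMap.le_opNorm _ _).trans
        (mul_le_mul_of_nonneg_right (hgn x) (norm_nonneg v))
    exact norm_eq_zero.1 (by linarith [norm_nonneg v])

end

/-- One-sided first order expansion of the sup norm. -/
lemma exists_norm_expansion {b : Plane} (hb : b ≠ 0) :
    ∃ ℓ : Plane → ℝ, Continuous ℓ ∧ (∀ t : ℝ, 0 ≤ t → ∀ v, ℓ (t • v) = t * ℓ v) ∧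
      (∀ (τ : ℝ) (v), ℓ (v + τ • b) = ℓ v + τ * ‖b‖) ∧
      ∀ᶠ v in 𝓝 (0 : Plane), ‖b + v‖ = ‖b‖ + ℓ v := by
  have habs : ∀ x : ℝ, x ≠ 0 → ∀ᶠ s in 𝓝 (0 : ℝ), |x + s| = |x| + SignType.sign x * s := by
    intro x hx
    rcases lt_or_gt_of_ne hx with h | h
    · filter_upwards [gt_mem_nhds (show (0 : ℝ) < -x by linarith)] with s hs
      rw [abs_of_neg h, abs_of_neg (by linarith), sign_neg h]
      simp
      ring
    · filter_upwards [lt_mem_nhds (show -x < (0 : ℝ) by linarith)] with s hs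
      rw [abs_of_pos h, abs_of_pos (by linarith), sign_pos h]
      simp
  have hfst : Tendsto (fun v : Plane => v.1) (𝓝 0) (𝓝 0) := continuous_fst.tendsto 0
  have hsnd : Tendsto (fun v : Plane => v.2) (𝓝 0) (𝓝 0) := continuous_snd.tendsto 0
  have hadd : ∀ x : ℝ, Tendsto (fun s : ℝ => |x + s|) (𝓝 0) (𝓝 |x|) := fun x => by
    have : Continuous fun s : ℝ => |x + s| := by fun_prop
    simpa using this.tendsto 0
  have hsgn : ∀ x : ℝ, (SignType.sign x : ℝ) * x = |x| := sign_mul_self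
  rcases lt_trichotomy |b.1| |b.2| with h | h | h
  · have hb2 : b.2 ≠ 0 := abs_pos.1 ((abs_nonneg _).trans_lt h)
    have hn : ‖b‖ = |b.2| := by rw [Prod.norm_def]; exact max_eq_right h.le
    refine ⟨fun v => SignType.sign b.2 * v.2, by fun_prop, ?_, ?_, ?_⟩
    · intro t _ v; simp; ring
    · intro τ v
      simp only [Prod.snd_add, Prod.smul_snd, smul_eq_mul, hn, ← hsgn b.2]; ring
    · filter_upwards [hsnd.eventually (habs b.2 hb2),
        ((hadd b.1).comp hfst).eventually_lt ((hadd b.2).comp hsnd) h] with v h1 h2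
      rw [hn, ← h1, Prod.norm_def]
      exact max_eq_right h2.le
  · have hb2 : b.2 ≠ 0 := by
      intro h0
      rw [h0, abs_zero, abs_eq_zero] at h
      exact hb (Prod.ext h h0)
    have hb1 : b.1 ≠ 0 := by
      rw [← abs_pos, h]; exact abs_pos.2 hb2
    have hn : ‖b‖ = |b.2| := by rw [Prod.norm_def]; exact max_eq_right h.le
    refine ⟨fun v => max (SignType.sign b.1 * v.1) (SignType.sign b.2 * v.2), by fun_prop,
      ?_, ?_, ?_⟩
    · intro t ht v
      rw [mul_max_of_nonneg _ _ ht]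
      simp only [Prod.smul_snd, Prod.smul_fst, smul_eq_mul]
      congr 1 <;> ring
    · intro τ v
      rw [max_add]
      simp only [Prod.snd_add, Prod.fst_add, Prod.smul_snd, Prod.smul_fst, smul_eq_mul, mul_add]
      congr 1
      · rw [hn, ← h, ← hsgn b.1]; ring
      · rw [hn, ← hsgn b.2]; ring
    · filter_upwards [hsnd.eventually (habs b.2 hb2), hfst.eventually (habs b.1 hb1)]
        with v h1 h2
      rw [add_max, Prod.norm_def]
      refine congr_arg₂ max ?_ ?_
      · rw [hn, ← h]; exact h2
      · rw [hn]; exact h1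
  · have hb1 : b.1 ≠ 0 := abs_pos.1 ((abs_nonneg _).trans_lt h)
    have hn : ‖b‖ = |b.1| := by rw [Prod.norm_def]; exact max_eq_left h.le
    refine ⟨fun v => SignType.sign b.1 * v.1, by fun_prop, ?_, ?_, ?_⟩
    · intro t _ v; simp; ring
    · intro τ v
      simp only [Prod.fst_add, Prod.smul_fst, smul_eq_mul, hn, ← hsgn b.1]; ring
    · filter_upwards [hfst.eventually (habs b.1 hb1),
        ((hadd b.2).comp hsnd).eventually_lt ((hadd b.1).comp hfst) h] with v h1 h2
      rw [hn, ← h1, Prod.norm_def]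
      exact max_eq_left h2.le

/-- Radial map collapsing the square of radius `1/3` to the origin and fixing the unit circle. -/
noncomputable def collapse (z : Plane) : Plane := (3 / 2 - (2 * ‖z‖)⁻¹) • z

lemma norm_collapse {z : Plane} (hz : 1 / 3 ≤ ‖z‖) : ‖collapse z‖ = 3 / 2 * ‖z‖ - 1 / 2 := by
  have h0 : 0 < ‖z‖ := by linarith
  have h1 : (2 * ‖z‖)⁻¹ ≤ 3 / 2 := by
    rw [inv_le_comm₀ (by positivity) (by norm_num)]; linarith
  rw [collapse, norm_smul, Real.norm_of_nonneg (by linarith)]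
  field_simp

lemma collapse_eq_self {z : Plane} (hz : ‖z‖ = 1) : collapse z = z := by
  rw [collapse, hz]; norm_num

lemma dist_collapse_le {z z' : Plane} (hz : 1 / 3 ≤ ‖z‖) (hz' : 1 / 3 ≤ ‖z'‖) :
    ‖collapse z - collapse z'‖ ≤ 3 / 2 * ‖z - z'‖ := by
  have h0 : 0 < ‖z‖ := by linarith
  have h0' : 0 < ‖z'‖ := by linarith
  have h1 : (2 * ‖z‖)⁻¹ ≤ 3 / 2 := by
    rw [inv_le_comm₀ (by positivity) (by norm_num)]; linarith
  have h2 : collapse z - collapse z' = (3 / 2 - (2 * ‖z‖)⁻¹) • (z - z') +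
      ((2 * ‖z'‖)⁻¹ - (2 * ‖z‖)⁻¹) • z' := by
    rw [collapse, collapse]; module
  have h3 : ((2 * ‖z'‖)⁻¹ - (2 * ‖z‖)⁻¹) = (‖z‖ - ‖z'‖) * (2 * ‖z‖ * ‖z'‖)⁻¹ := by
    field_simp
  have h4 : ‖((2 * ‖z'‖)⁻¹ - (2 * ‖z‖)⁻¹) • z'‖ = |‖z‖ - ‖z'‖| * (2 * ‖z‖)⁻¹ := by
    rw [h3, norm_smul, norm_mul, Real.norm_eq_abs, Real.norm_of_nonneg (by positivity)]
    field_simp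
  rw [h2]
  refine (norm_add_le _ _).trans ?_
  rw [h4, norm_smul, Real.norm_of_nonneg (by linarith)]
  have h5 := abs_norm_sub_norm_le z z'
  have h6 : 0 < (2 * ‖z‖)⁻¹ := by positivity
  nlinarith

lemma collapse_injective_of_ne_zero {z z' : Plane} (hz : 1 / 3 ≤ ‖z‖) (hz' : 1 / 3 ≤ ‖z'‖)
    (h : collapse z = collapse z') (h0 : collapse z ≠ 0) : z = z' := by
  have h1 : ‖z‖ = ‖z'‖ := by
    have := congrArg norm h
    rw [norm_collapse hz, norm_collapse hz'] at this
    linarith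
  rw [collapse, collapse, h1] at h
  refine smul_right_injective _ ?_ h
  intro h2
  rw [collapse, h1, h2, zero_smul] at h0
  exact h0 rfl

lemma exists_collapse_eq {z : Plane} (hz : ‖z‖ ≤ 1) :
    ∃ y, 1 / 3 ≤ ‖y‖ ∧ ‖y‖ ≤ 1 ∧ collapse y = z := by
  by_cases h0 : z = 0
  · refine ⟨(1 / 3, 0), ?_, ?_, ?_⟩
    · simp [Prod.norm_def]
    · simp [Prod.norm_def]; norm_num
    · subst h0; simp [collapse, Prod.norm_def]; norm_num
  · have hn : 0 < ‖z‖ := norm_pos_iff.2 h0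
    have hy : ‖((2 * ‖z‖ + 1) / (3 * ‖z‖)) • z‖ = (2 * ‖z‖ + 1) / 3 := by
      rw [norm_smul, Real.norm_of_nonneg (by positivity)]; field_simp
    refine ⟨((2 * ‖z‖ + 1) / (3 * ‖z‖)) • z, ?_, ?_, ?_⟩
    · rw [hy]; linarith
    · rw [hy]; linarith
    · rw [collapse, hy, smul_smul]
      convert one_smul ℝ z using 2
      field_simp
      ring

lemma dirAt_collapse {b : Plane} (hb : 1 / 3 < ‖b‖) : ∃ ω, DirAt collapse b ω := by
  have hr : 0 < ‖b‖ := by linarith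
  have hb0 : b ≠ 0 := norm_pos_iff.1 hr
  obtain ⟨ℓ, hℓc, hℓhom, hℓadd, hℓ⟩ := exists_norm_expansion hb0
  set r := ‖b‖ with hrdef
  set φ : ℝ → ℝ := fun s => 3 / 2 - (2 * s)⁻¹ with hφ
  set φ' : ℝ := (2 * r ^ 2)⁻¹ with hφ'
  have hφr : 0 < φ r := by
    have : (2 * r)⁻¹ < 3 / 2 := by
      rw [inv_lt_comm₀ (by positivity) (by norm_num)]; linarith
    simp only [hφ]; linarith
  have hφd : HasDerivAt φ φ' r := by
    have h1 : HasDerivAt (fun s : ℝ => 2 * s) 2 r := by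
      simpa using (hasDerivAt_id r).const_mul 2
    have h2 := (h1.inv (by positivity)).const_sub (3 / 2)
    have h3 : -(-2 / (2 * r) ^ 2) = φ' := by
      rw [hφ']
      field_simp
    rwa [h3] at h2
  refine ⟨_, DirAt.of_expansion (L := fun v => φ r • v + (φ' * ℓ v) • b) (by fun_prop) ?_ ?_ ?_⟩
  · intro t ht v
    simp only [hℓhom t ht]
    module
  · intro v v' h
    simp only at h
    have h1 : v = v' + ((φ r)⁻¹ * (φ' * ℓ v' - φ' * ℓ v)) • b := by
      have h2 : φ r • v = φ r • v' + (φ' * ℓ v' - φ' * ℓ v) • b := by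
        rw [sub_smul (φ' * ℓ v'), ← add_sub_assoc, ← h]; abel
      have h3 := congrArg ((φ r)⁻¹ • ·) h2
      simp only [smul_add, inv_smul_smul₀ hφr.ne'] at h3
      rw [mul_smul]
      exact h3
    set τ := (φ r)⁻¹ * (φ' * ℓ v' - φ' * ℓ v) with hτ
    have h3 : ℓ v = ℓ v' + τ * r := by rw [h1, hℓadd]
    have h4 : φ r * τ = φ' * ℓ v' - φ' * ℓ v := by
      rw [hτ, ← mul_assoc, mul_inv_cancel₀ hφr.ne', one_mul]
    have h5 : τ = 0 := by
      rw [h3] at h4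
      have h6 : τ * (φ r + φ' * r) = 0 := by linarith
      have h7 : 0 < φ r + φ' * r := by positivity
      exact (mul_eq_zero.1 h6).resolve_right h7.ne'
    rw [h1, h5, zero_smul, add_zero]
  · -- the expansion
    have hℓ0 : ℓ 0 = 0 := by simpa using hℓhom 0 le_rfl 0
    have hsub : Tendsto (fun z : Plane => z - b) (𝓝 b) (𝓝 0) := by
      have : Continuous fun z : Plane => z - b := by fun_prop
      simpa using this.tendsto b
    have hev : ∀ᶠ z in 𝓝 b, ‖z‖ = r + ℓ (z - b) := by
      filter_upwards [hsub.eventually hℓ] with z hz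
      rw [← hz, add_sub_cancel]
    have hO : (fun z => ℓ (z - b)) =O[𝓝 b] fun z => z - b := by
      refine IsBigO.of_bound 1 ?_
      filter_upwards [hev] with z hz
      have h1 := abs_norm_sub_norm_le z b
      rw [hz, ← hrdef, add_sub_cancel_left] at h1
      rw [one_mul, Real.norm_eq_abs]
      exact h1
    have hnorm : Tendsto (fun z : Plane => ‖z‖) (𝓝 b) (𝓝 r) := continuous_norm.tendsto b
    have h1 : (fun z : Plane => φ ‖z‖ - φ r - φ' * ℓ (z - b)) =o[𝓝 b] fun z => z - b := by
      have h2 := (hφd.hasFDerivAt.isLittleO.comp_tendsto hnorm)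
      have h3 : (fun z : Plane => ‖z‖ - r) =O[𝓝 b] fun z => z - b :=
        hO.congr' (hev.mono fun z hz => by simp only; rw [hz, add_sub_cancel_left]) .rfl
      refine (h2.trans_isBigO h3).congr' (hev.mono fun z hz => ?_) .rfl
      simp [hz]
      ring
    have h2 : (fun z : Plane => (φ ‖z‖ - φ r)) =o[𝓝 b] fun _ => (1 : ℝ) := by
      rw [isLittleO_one_iff]
      have := (hφd.continuousAt.tendsto.comp hnorm).sub_const (φ r)
      simpa using this
    have h3 : (fun z : Plane => (φ ‖z‖ - φ r - φ' * ℓ (z - b)) • b) =o[𝓝 b] fun z => z - b := by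
      have := h1.norm_right.smul_isBigO (isBigO_refl (fun _ : Plane => b) (𝓝 b))
      refine this.trans_isBigO (IsBigO.of_bound ‖b‖ (.of_forall fun z => ?_))
      rw [norm_smul, norm_norm, mul_comm]
    have h4 : (fun z : Plane => (φ ‖z‖ - φ r) • (z - b)) =o[𝓝 b] fun z => z - b := by
      simpa using h2.smul_isBigO (isBigO_refl (fun z : Plane => z - b) (𝓝 b))
    refine (h3.add h4).congr_left fun z => ?_
    simp only [collapse, hφ, ← hrdef]
    module

/-- The eight digits of the carpet. -/
abbrev Digit := {e : Fin 3 × Fin 3 // ¬(e.1 = 1 ∧ e.2 = 1)}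

/-- The centre of the cell of a digit, scaled to the unit sphere. -/
noncomputable def Digit.vec (e : Digit) : Plane := ((e.1.1 : ℝ) - 1, (e.1.2 : ℝ) - 1)

/-- The similarity of the square `[-1, 1]²` onto the cell of `e`. -/
noncomputable def cell (e : Digit) (z : Plane) : Plane := (1 / 3 : ℝ) • (z + (2 : ℝ) • e.vec)

/-- The cell map followed by the collapse of the central hole. -/
noncomputable def ccell (e : Digit) (z : Plane) : Plane := collapse (cell e z)

lemma norm_digit (e : Digit) : ‖e.vec‖ = 1 := by
  obtain ⟨⟨i, j⟩, h⟩ := e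
  fin_cases i <;> fin_cases j <;>
    first | exact absurd ⟨rfl, rfl⟩ h | (simp [Digit.vec, Prod.norm_def]; try norm_num)

lemma cell_sub (e : Digit) (z z' : Plane) : cell e z - cell e z' = (1 / 3 : ℝ) • (z - z') := by
  rw [cell, cell]; module

lemma norm_cell_sub (e : Digit) (z z' : Plane) :
    ‖cell e z - cell e z'‖ = 1 / 3 * ‖z - z'‖ := by
  rw [cell_sub, norm_smul]; norm_num

lemma cell_injective (e : Digit) : Function.Injective (cell e) := by
  intro z z' h
  have := norm_cell_sub e z z'
  rw [h, sub_self, norm_zero] at this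
  exact sub_eq_zero.1 (norm_eq_zero.1 (by linarith))

lemma norm_cell_le (e : Digit) (z : Plane) : ‖cell e z‖ ≤ (‖z‖ + 2) / 3 := by
  rw [cell, norm_smul]
  have := norm_add_le z ((2 : ℝ) • e.vec)
  rw [norm_smul, norm_digit] at this
  norm_num at this ⊢
  linarith

lemma le_norm_cell (e : Digit) (z : Plane) : (2 - ‖z‖) / 3 ≤ ‖cell e z‖ := by
  rw [cell, norm_smul]
  have := norm_sub_le (z + (2 : ℝ) • e.vec) z
  rw [add_sub_cancel_left, norm_smul, norm_digit] at this
  norm_num at this ⊢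
  linarith

lemma third_le_norm_cell (e : Digit) {z : Plane} (hz : ‖z‖ ≤ 1) : 1 / 3 ≤ ‖cell e z‖ := by
  linarith [le_norm_cell e z]

lemma norm_ccell (e : Digit) {z : Plane} (hz : ‖z‖ ≤ 1) :
    ‖ccell e z‖ = 3 / 2 * ‖cell e z‖ - 1 / 2 :=
  norm_collapse (third_le_norm_cell e hz)

lemma norm_ccell_le (e : Digit) {z : Plane} (hz : ‖z‖ ≤ 1) : ‖ccell e z‖ ≤ 1 := by
  linarith [norm_ccell e hz, norm_cell_le e z]

lemma norm_ccell_sub_le (e : Digit) {z z' : Plane} (hz : ‖z‖ ≤ 1) (hz' : ‖z'‖ ≤ 1) :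
    ‖ccell e z - ccell e z'‖ ≤ 1 / 2 * ‖z - z'‖ := by
  have := dist_collapse_le (third_le_norm_cell e hz) (third_le_norm_cell e hz')
  rw [norm_cell_sub] at this
  rw [ccell, ccell]
  linarith

lemma dirAt_ccell (e : Digit) {z : Plane} (hz : ‖z‖ < 1) : ∃ ω, DirAt (ccell e) z ω := by
  have h1 : 1 / 3 < ‖cell e z‖ := by linarith [le_norm_cell e z]
  obtain ⟨ω, hω⟩ := dirAt_collapse h1
  have h2 : HasFDerivAt (cell e) ((1 / 3 : ℝ) • ContinuousLinearMap.id ℝ Plane) z :=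
    ((hasFDerivAt_id z).add_const _).const_smul (1 / 3 : ℝ)
  refine ⟨_, hω.comp (DirAt.of_hasFDerivAt h2 ?_)⟩
  intro v v' h
  simpa using h

/-- Two distinct cells meet only along the images of the boundary. -/
lemma eq_of_cell_eq_cell {e e' : Digit} {z z' : Plane} (hz : ‖z‖ ≤ 1) (hz' : ‖z'‖ < 1)
    (h : cell e z = cell e' z') : e = e' ∧ z = z' := by
  have h1 : z - z' = (2 : ℝ) • (e'.vec - e.vec) := by
    have h2 := smul_right_injective Plane (show (1 / 3 : ℝ) ≠ 0 by norm_num) h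
    rw [smul_sub, sub_eq_sub_iff_add_eq_add, h2, add_comm]
  have h3 : ‖z - z'‖ < 2 := by linarith [norm_sub_le z z']
  have hinter : ∀ i j : Fin 3, ‖(2 : ℝ) * (((j : ℕ) : ℝ) - ((i : ℕ) : ℝ))‖ < 2 → i = j := by
    intro i j hij
    rw [norm_mul, Real.norm_of_nonneg (by norm_num : (0 : ℝ) ≤ 2), Real.norm_eq_abs] at hij
    have h4 : |((j : ℕ) : ℝ) - ((i : ℕ) : ℝ)| < 1 := by linarith
    have h5 : |((j : ℕ) : ℤ) - ((i : ℕ) : ℤ)| < 1 := by exact_mod_cast h4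
    rw [Int.abs_lt_one_iff] at h5
    exact Fin.ext (by omega)
  have h5 : e = e' := by
    refine Subtype.ext (Prod.ext ?_ ?_)
    · refine hinter _ _ (lt_of_le_of_lt (le_trans (le_of_eq ?_) (norm_fst_le (z - z'))) h3)
      rw [h1]
      simp [Digit.vec]
    · refine hinter _ _ (lt_of_le_of_lt (le_trans (le_of_eq ?_) (norm_snd_le (z - z'))) h3)
      rw [h1]
      simp [Digit.vec]
  subst h5
  exact ⟨rfl, cell_injective e h⟩

lemma norm_eq_one_of_cell_eq_cell {e e' : Digit} (he : e ≠ e') {z z' : Plane} (hz : ‖z‖ ≤ 1)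
    (hz' : ‖z'‖ ≤ 1) (h : cell e z = cell e' z') : ‖z‖ = 1 ∧ ‖z'‖ = 1 := by
  constructor
  · by_contra h1
    exact he (eq_of_cell_eq_cell hz' (lt_of_le_of_ne hz h1) h.symm).1.symm
  · by_contra h1
    exact he (eq_of_cell_eq_cell hz (lt_of_le_of_ne hz' h1) h).1

lemma exists_cell_eq {y : Plane} (h1 : 1 / 3 ≤ ‖y‖) (h2 : ‖y‖ ≤ 1) :
    ∃ e z, ‖z‖ ≤ 1 ∧ cell e z = y := by
  have hk : ∀ t : ℝ, |t| ≤ 1 → ∃ k : Fin 3, |3 * t - 2 * ((k : ℝ) - 1)| ≤ 1 ∧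
      (1 / 3 ≤ |t| → k ≠ 1) := by
    intro t ht
    rw [abs_le] at ht
    rcases le_or_gt (1 / 3) t with h | h
    · refine ⟨2, ?_, fun _ => by decide⟩
      rw [abs_le]; constructor <;> norm_num <;> linarith
    · rcases le_or_gt t (-1 / 3) with h' | h'
      · refine ⟨0, ?_, fun _ => by decide⟩
        rw [abs_le]; constructor <;> norm_num <;> linarith
      · refine ⟨1, ?_, fun h3 => absurd h3 (not_le.2 (abs_lt.2 ⟨by linarith, h⟩))⟩
        rw [abs_le]; constructor <;> norm_num <;> linarith
  obtain ⟨i, hi, hi'⟩ := hk y.1 ((norm_fst_le y).trans h2)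
  obtain ⟨j, hj, hj'⟩ := hk y.2 ((norm_snd_le y).trans h2)
  have hij : ¬(i = 1 ∧ j = 1) := by
    rintro ⟨h3, h4⟩
    rw [Prod.norm_def, le_max_iff] at h1
    exact h1.elim (fun h => hi' h h3) fun h => hj' h h4
  refine ⟨⟨(i, j), hij⟩, (3 * y.1 - 2 * ((i : ℝ) - 1), 3 * y.2 - 2 * ((j : ℝ) - 1)), ?_, ?_⟩
  · rw [Prod.norm_def]
    exact max_le hi hj
  · refine Prod.ext ?_ ?_ <;> simp [cell, Digit.vec]

lemma exists_ccell_eq {z : Plane} (hz : ‖z‖ ≤ 1) : ∃ e z', ‖z'‖ ≤ 1 ∧ ccell e z' = z := by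
  obtain ⟨y, h1, h2, rfl⟩ := exists_collapse_eq hz
  obtain ⟨e, z', h3, rfl⟩ := exists_cell_eq h1 h2
  exact ⟨e, z', h3, rfl⟩

/-- A nonempty set invariant under all collapsed cell maps is dense in the square. -/
lemma closedBall_subset_closure_of_invariant {T : Set Plane} (hT : T.Nonempty)
    (hT1 : ∀ z ∈ T, ‖z‖ ≤ 1) (hinv : ∀ e, ∀ z ∈ T, ccell e z ∈ T) :
    closedBall 0 1 ⊆ closure T := by
  have key : ∀ n : ℕ, ∀ z : Plane, ‖z‖ ≤ 1 → ∃ y ∈ T, ‖z - y‖ ≤ 2 * (1 / 2) ^ n := by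
    intro n
    induction n with
    | zero =>
      intro z hz
      obtain ⟨y, hy⟩ := hT
      exact ⟨y, hy, by linarith [norm_sub_le z y, hT1 y hy]⟩
    | succ n ih =>
      intro z hz
      obtain ⟨e, z', hz', rfl⟩ := exists_ccell_eq hz
      obtain ⟨y, hy, hzy⟩ := ih z' hz'
      refine ⟨ccell e y, hinv e y hy, ?_⟩
      have := norm_ccell_sub_le e hz' (hT1 y hy)
      rw [pow_succ]
      linarith
  intro z hz
  rw [Metric.mem_closure_iff]
  intro ε hε
  obtain ⟨n, hn⟩ := exists_pow_lt_of_lt_one (half_pos hε) (show (1 / 2 : ℝ) < 1 by norm_num)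
  obtain ⟨y, hy, hzy⟩ := key n z (by simpa using hz)
  exact ⟨y, hy, by rw [dist_eq_norm]; linarith⟩

/-- The centres of the collapsed holes. -/
noncomputable def center : List Digit → Plane
  | [] => 0
  | e :: u => ccell e (center u)

lemma norm_center_lt (u : List Digit) : ‖center u‖ < 1 := by
  induction u with
  | nil => simp [center]
  | cons e u ih =>
    rw [center, norm_ccell e ih.le]
    linarith [norm_cell_le e (center u)]

/-- Sequences of digits. -/
abbrev Code := ℕ → Digit

/-- The shift on sequences of digits. -/
def shift (w : Code) : Code := fun n => w (n + 1)

/-- Prefixing a digit. -/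
def Code.cons (e : Digit) (w : Code) : Code := fun n => Nat.casesOn n e w

lemma continuous_shift : Continuous shift := continuous_pi fun n => continuous_apply (n + 1)

lemma continuous_cons (e : Digit) : Continuous (Code.cons e) := by
  refine continuous_pi fun n => ?_
  cases n with
  | zero => exact continuous_const
  | succ n => exact continuous_apply n

/-- The coding map of an iterated function system. -/
lemma exists_coding_of_lipschitz {B : Type*} [MetricSpace B] [CompleteSpace B] [Nonempty B]
    (G : Digit → B → B) (hG : ∀ e, LipschitzWith (1 / 2) (G e)) :
    ∃ π : C(Code, B), ∀ w, π w = G (w 0) (π (shift w)) := by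
  have hGc : Continuous fun q : Digit × B => G q.1 q.2 :=
    continuous_prod_of_discrete_left.2 fun e => (hG e).continuous
  let Θ : C(Code, B) → C(Code, B) := fun π =>
    ⟨fun w => G (w 0) (π (shift w)),
      hGc.comp ((continuous_apply 0).prodMk (π.continuous.comp continuous_shift))⟩
  have hΘ : ContractingWith (1 / 2) Θ := by
    refine ⟨by rw [← NNReal.coe_lt_coe]; norm_num, LipschitzWith.of_dist_le_mul fun π π' => ?_⟩
    rw [ContinuousMap.dist_le (by positivity)]
    intro w
    exact ((hG (w 0)).dist_le_mul _ _).trans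
      (mul_le_mul_of_nonneg_left (ContinuousMap.dist_apply_le_dist _) (by positivity))
  have : Nonempty C(Code, B) := ⟨ContinuousMap.const _ (Classical.arbitrary B)⟩
  obtain ⟨π, hπ, -⟩ := hΘ.exists_fixedPoint (Classical.arbitrary _) (edist_ne_top _ _)
  exact ⟨π, fun w => (DFunLike.congr_fun hπ w).symm⟩

lemma exists_coding (G : Digit → Plane → Plane) (hG : ∀ e z, ‖z‖ ≤ 1 → ‖G e z‖ ≤ 1)
    (hL : ∀ e z z', ‖z‖ ≤ 1 → ‖z'‖ ≤ 1 → ‖G e z - G e z'‖ ≤ 1 / 2 * ‖z - z'‖) :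
    ∃ π : Code → Plane, Continuous π ∧ (∀ w, ‖π w‖ ≤ 1) ∧
      ∀ w, π w = G (w 0) (π (shift w)) := by
  have : CompleteSpace (closedBall (0 : Plane) 1) := isClosed_closedBall.completeSpace_coe
  have : Nonempty (closedBall (0 : Plane) 1) := ⟨0, by simp⟩
  obtain ⟨π, hπ⟩ := exists_coding_of_lipschitz (B := closedBall (0 : Plane) 1)
    (fun e z => ⟨G e z.1, mem_closedBall_zero_iff.2 (hG e z.1 (mem_closedBall_zero_iff.1 z.2))⟩)
    fun e => LipschitzWith.of_dist_le_mul fun z z' => by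
      rw [Subtype.dist_eq, dist_eq_norm, Subtype.dist_eq, dist_eq_norm]
      simpa using hL e z.1 z'.1 (mem_closedBall_zero_iff.1 z.2) (mem_closedBall_zero_iff.1 z'.2)
  exact ⟨fun w => (π w).1, by fun_prop, fun w => mem_closedBall_zero_iff.1 (π w).2,
    fun w => congrArg Subtype.val (hπ w)⟩

/-- The codings of the (rescaled) carpet and of the square with collapsed holes. -/
structure CodingPair (κ π : Code → Plane) : Prop where
  continuous_left : Continuous κ
  norm_left : ∀ w, ‖κ w‖ ≤ 1
  left_eq : ∀ w, κ w = cell (w 0) (κ (shift w))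
  continuous_right : Continuous π
  norm_right : ∀ w, ‖π w‖ ≤ 1
  right_eq : ∀ w, π w = ccell (w 0) (π (shift w))

lemma exists_codingPair : ∃ κ π, CodingPair κ π := by
  obtain ⟨κ, h1, h2, h3⟩ := exists_coding cell
    (fun e z hz => (norm_cell_le e z).trans (by linarith)) fun e z z' _ _ => by
      rw [norm_cell_sub]
      linarith [norm_nonneg (z - z')]
  obtain ⟨π, h4, h5, h6⟩ := exists_coding ccell (fun e z hz => norm_ccell_le e hz)
    fun e z z' hz hz' => norm_ccell_sub_le e hz hz'
  exact ⟨κ, π, h1, h2, h3, h4, h5, h6⟩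

lemma eq_of_forall_norm_sub_le {x y : Plane} (h : ∀ n : ℕ, ‖x - y‖ ≤ 2 * (1 / 2) ^ n) :
    x = y := by
  rw [← sub_eq_zero, ← norm_le_zero_iff]
  refine ge_of_tendsto' (x := atTop) ?_ h
  have := (tendsto_pow_atTop_nhds_zero_of_lt_one (by norm_num : (0 : ℝ) ≤ 1 / 2)
    (by norm_num)).const_mul 2
  simpa using this

namespace CodingPair

variable {κ π : Code → Plane}

lemma right_eq_left_of_left (h : CodingPair κ π) {t : Code} (ht : ‖κ t‖ = 1) : π t = κ t := by
  refine eq_of_forall_norm_sub_le fun n => ?_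
  induction n generalizing t with
  | zero => linarith [norm_sub_le (π t) (κ t), h.norm_left t, h.norm_right t]
  | succ n ih =>
    have h1 : ‖κ (shift t)‖ = 1 := by
      refine le_antisymm (h.norm_left _) ?_
      have := norm_cell_le (t 0) (κ (shift t))
      rw [← h.left_eq, ht] at this
      linarith
    have h2 : κ t = ccell (t 0) (κ (shift t)) := by
      rw [ccell, ← h.left_eq, collapse_eq_self ht]
    rw [h.right_eq, h2, pow_succ]
    linarith [ih h1, norm_ccell_sub_le (t 0) (h.norm_right (shift t)) (h.norm_left (shift t))]

lemma left_eq_right_of_right (h : CodingPair κ π) {t : Code} (ht : ‖π t‖ = 1) : κ t = π t := by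
  refine eq_of_forall_norm_sub_le fun n => ?_
  induction n generalizing t with
  | zero => linarith [norm_sub_le (κ t) (π t), h.norm_left t, h.norm_right t]
  | succ n ih =>
    have h0 : ‖cell (t 0) (π (shift t))‖ = 1 := by
      have := norm_ccell (t 0) (h.norm_right (shift t))
      rw [← h.right_eq, ht] at this
      linarith
    have h1 : ‖π (shift t)‖ = 1 := by
      refine le_antisymm (h.norm_right _) ?_
      linarith [norm_cell_le (t 0) (π (shift t))]
    have h2 : π t = cell (t 0) (π (shift t)) := by
      rw [h.right_eq, ccell, collapse_eq_self h0]
    rw [h.left_eq, h2, pow_succ, norm_cell_sub]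
    linarith [ih h1, norm_nonneg (κ (shift t) - π (shift t))]

lemma right_eq_of_left_eq (h : CodingPair κ π) {w w' : Code} (hw : κ w = κ w') : π w = π w' := by
  refine eq_of_forall_norm_sub_le fun n => ?_
  induction n generalizing w w' with
  | zero => linarith [norm_sub_le (π w) (π w'), h.norm_right w, h.norm_right w']
  | succ n ih =>
    rw [h.left_eq w, h.left_eq w'] at hw
    by_cases h0 : w 0 = w' 0
    · rw [h0] at hw
      rw [h.right_eq w, h.right_eq w', h0, pow_succ]
      linarith [ih (cell_injective _ hw), norm_ccell_sub_le (w' 0) (h.norm_right (shift w))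
        (h.norm_right (shift w'))]
    · obtain ⟨h1, h2⟩ := norm_eq_one_of_cell_eq_cell h0 (h.norm_left _) (h.norm_left _) hw
      rw [h.right_eq w, h.right_eq w', h.right_eq_left_of_left h1, h.right_eq_left_of_left h2,
        ccell, ccell, hw, sub_self, norm_zero]
      positivity

lemma left_eq_of_right_eq (h : CodingPair κ π) {w w' : Code} (hw : π w = π w') (hD : π w ∉ range center) :
    κ w = κ w' := by
  refine eq_of_forall_norm_sub_le fun n => ?_
  induction n generalizing w w' with
  | zero => linarith [norm_sub_le (κ w) (κ w'), h.norm_left w, h.norm_left w']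
  | succ n ih =>
    have hne : π w ≠ 0 := fun h0 => hD ⟨[], h0.symm⟩
    have h1 := h.right_eq w
    have h1' := h.right_eq w'
    have h3 : cell (w 0) (π (shift w)) = cell (w' 0) (π (shift w')) := by
      refine collapse_injective_of_ne_zero (third_le_norm_cell _ (h.norm_right _))
        (third_le_norm_cell _ (h.norm_right _)) ?_ ?_
      · rw [← ccell, ← ccell, ← h1, ← h1', hw]
      · rwa [← ccell, ← h1]
    by_cases h0 : w 0 = w' 0
    · rw [h0] at h3
      have h4 := ih (cell_injective _ h3) (fun ⟨u, hu⟩ => hD ⟨w 0 :: u, by rw [center, hu, ← h1]⟩)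
      rw [h.left_eq w, h.left_eq w', h0, pow_succ, norm_cell_sub]
      linarith [norm_nonneg (κ (shift w) - κ (shift w'))]
    · obtain ⟨h4, h5⟩ := norm_eq_one_of_cell_eq_cell h0 (h.norm_right _) (h.norm_right _) h3
      rw [h.left_eq w, h.left_eq w', h.left_eq_right_of_right h4, h.left_eq_right_of_right h5,
        h3, sub_self, norm_zero]
      positivity

lemma range_right (h : CodingPair κ π) : range π = closedBall 0 1 := by
  refine Subset.antisymm (range_subset_iff.2 fun w => by simpa using h.norm_right w) ?_
  rw [← (isCompact_range h.continuous_right).isClosed.closure_eq]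
  refine closedBall_subset_closure_of_invariant ⟨_, fun _ => ⟨(0, 0), by decide⟩, rfl⟩ ?_ ?_
  · rintro _ ⟨w, rfl⟩
    exact h.norm_right w
  · rintro e _ ⟨w, rfl⟩
    exact ⟨Code.cons e w, h.right_eq _⟩

/-- Continuous choice of the direction from the centre of a collapsed hole. -/
lemma exists_direction (h : CodingPair κ π) (u : List Digit) :
    ∃ ϑ : Code → Plane, Continuous ϑ ∧ (∀ w, ‖ϑ w‖ = 1) ∧
    (∀ w, π w - center u = ‖π w - center u‖ • ϑ w) ∧
    ∀ w w', π w = center u → π w' = center u → (ϑ w = ϑ w' ↔ κ w = κ w') := by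
  classical
  induction u with
  | nil =>
    have hne : ∀ w : Code, cell (w 0) (π (shift w)) ≠ 0 := fun w => norm_ne_zero_iff.1 (by
      linarith [third_le_norm_cell (w 0) (h.norm_right (shift w))])
    refine ⟨fun w => dir (cell (w 0) (π (shift w))), ?_, fun w => norm_dir (hne w), ?_, ?_⟩
    · have hc : Continuous fun q : Digit × Plane => cell q.1 q.2 :=
        continuous_prod_of_discrete_left.2 fun e => by
          simp only [cell]
          fun_prop
      rw [continuous_iff_continuousAt]
      intro w
      refine ContinuousAt.comp (f := fun w : Code => cell (w 0) (π (shift w)))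
        (continuousAt_dir (hne w)) ?_
      exact (hc.comp ((continuous_apply 0).prodMk
        (h.continuous_right.comp continuous_shift))).continuousAt
    · intro w
      have h1 := third_le_norm_cell (w 0) (h.norm_right (shift w))
      have h0 : 0 < ‖cell (w 0) (π (shift w))‖ := by linarith
      rw [center, sub_zero]
      rw [h.right_eq w, norm_ccell _ (h.norm_right _), ccell, collapse]
      simp only [dir, smul_smul]
      congr 1
      field_simp
    · intro w w' hw hw'
      have key : ∀ w : Code, π w = center [] → dir (cell (w 0) (π (shift w))) = (3 : ℝ) • κ w := by
        intro w hw
        have h1 := norm_ccell (w 0) (h.norm_right (shift w))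
        rw [← h.right_eq, hw, center, norm_zero] at h1
        have h2 : ‖cell (w 0) (π (shift w))‖ = 1 / 3 := by linarith
        have h3 : ‖π (shift w)‖ = 1 := le_antisymm (h.norm_right _) (by
          linarith [le_norm_cell (w 0) (π (shift w))])
        rw [dir, h2, ← h.left_eq_right_of_right h3, ← h.left_eq]
        norm_num
      simp only
      rw [key w hw, key w' hw']
      exact (smul_right_injective Plane (three_ne_zero' ℝ)).eq_iff
  | cons e u ih =>
    obtain ⟨ϑ, hc, hn, hdir, hiff⟩ := ih
    have hu := norm_center_lt u
    obtain ⟨ω, hω⟩ := dirAt_ccell e hu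
    have hkey : ∀ e' z, ‖z‖ ≤ 1 → ccell e' z = ccell e (center u) → e' = e ∧ z = center u := by
      intro e' z hz hEq
      refine eq_of_cell_eq_cell hz hu (collapse_injective_of_ne_zero (third_le_norm_cell _ hz)
        (third_le_norm_cell _ hu.le) hEq ?_)
      rw [← ccell, hEq, ← norm_pos_iff, norm_ccell e hu.le]
      linarith [le_norm_cell e (center u)]
    have hmem : ∀ w : Code, π w = center (e :: u) → w 0 = e ∧ π (shift w) = center u := fun w hw =>
      hkey _ _ (h.norm_right _) (by rw [← h.right_eq, hw, center])
    let Tr : Code → Plane := fun w => if π (shift w) = center u then ω (ϑ (shift w))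
      else dir (ccell e (π (shift w)) - ccell e (center u))
    have hTr : Continuous Tr := by
      refine continuous_transport (p := fun w => π (shift w)) (ϑ := fun w => ϑ (shift w))
        (h.continuous_right.comp continuous_shift) (hc.comp continuous_shift) (fun w => hn _)
        (fun w => hdir _) ?_ (fun w hw hEq => hw (hkey e _ (h.norm_right _) hEq).2) hω
      have h1 : (fun w => ccell e (π (shift w))) = fun w => π (Code.cons e (shift w)) :=
        funext fun w => (h.right_eq (Code.cons e (shift w))).symm
      rw [h1]
      exact h.continuous_right.comp ((continuous_cons e).comp continuous_shift)
    have hclopen : IsClopen {w : Code | w 0 = e} :=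
      (isClopen_discrete {e}).preimage (continuous_apply 0)
    refine ⟨fun w => if w 0 = e then Tr w else dir (π w - center (e :: u)), ?_, ?_, ?_, ?_⟩
    · refine continuous_if ?_ hTr.continuousOn ?_
      · intro w hw
        rw [hclopen.frontier_eq] at hw
        exact hw.elim
      · intro w hw
        have hw' : w 0 ≠ e := by
          have : IsClosed {w : Code | ¬ w 0 = e} := hclopen.compl.1
          rwa [this.closure_eq] at hw
        refine ContinuousAt.continuousWithinAt
          (ContinuousAt.comp (f := fun w => π w - center (e :: u)) (continuousAt_dir ?_)
          (h.continuous_right.sub continuous_const).continuousAt)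
        exact sub_ne_zero.2 fun hEq => hw' (hmem w hEq).1
    · intro w
      simp only
      split_ifs with h1
      · simp only [Tr]
        split_ifs with h2
        · simpa using hω.mapsTo (by simpa using hn (shift w))
        · exact norm_dir (sub_ne_zero.2 fun hEq => h2 (hkey e _ (h.norm_right _) hEq).2)
      · exact norm_dir (sub_ne_zero.2 fun hEq => h1 (hmem w hEq).1)
    · intro w
      by_cases hw : π w = center (e :: u)
      · rw [hw, sub_self, norm_zero, zero_smul]
      · have h1 : (if w 0 = e then Tr w else dir (π w - center (e :: u))) =
            dir (π w - center (e :: u)) := by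
          split_ifs with h1
          · have h2 : π (shift w) ≠ center u := fun h2 => hw (by
              rw [h.right_eq, h1, h2, center])
            simp only [Tr, if_neg h2]
            rw [← h1, ← h.right_eq, center, h1]
          · rfl
        simp only
        rw [h1, norm_smul_dir]
    · intro w w' hw hw'
      obtain ⟨h1, h2⟩ := hmem w hw
      obtain ⟨h1', hw2⟩ := hmem w' hw'
      simp only [if_pos h1, if_pos h1', Tr, if_pos h2, if_pos hw2]
      rw [h.left_eq w, h.left_eq w', h1, h1', (cell_injective e).eq_iff,
        hω.injOn.eq_iff (by simpa using hn _) (by simpa using hn _)]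
      exact hiff _ _ h2 hw2

/-- The blow-up of the square at the centres is a quotient of the code space by the same
relation as the carpet. -/
lemma exists_blowUp_coding (h : CodingPair κ π) :
    ∃ Ξ : Code → BlowUp (closedBall 0 1) (range center), Continuous Ξ ∧
    Function.Surjective Ξ ∧ ∀ w w', κ w = κ w' ↔ Ξ w = Ξ w' := by
  have hex : ∀ d : range center, ∃ ϑ : Code → Plane, Continuous ϑ ∧ (∀ w, ‖ϑ w‖ = 1) ∧
      (∀ w, π w - d = ‖π w - d‖ • ϑ w) ∧
      ∀ w w', π w = d → π w' = d → (ϑ w = ϑ w' ↔ κ w = κ w') := by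
    rintro ⟨_, u, rfl⟩
    exact h.exists_direction u
  choose ϑ hc hn hdir hiff using hex
  let Ξ : Code → BlowUp (closedBall 0 1) (range center) := fun w =>
    ⟨(π w, fun d => ϑ d w), by simpa using h.norm_right w, fun d => ⟨hn d w, hdir d w⟩⟩
  have hΞ : Continuous Ξ :=
    (h.continuous_right.prodMk (continuous_pi fun d => hc d)).subtype_mk _
  refine ⟨Ξ, hΞ, ?_, ?_⟩
  · rw [← range_eq_univ, ← (isCompact_range hΞ).isClosed.closure_eq, eq_univ_iff_forall]
    intro q
    refine closure_mono ?_ (dense_regular (countable_range center) ?_ q)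
    · intro r hr
      have h1 : r.1.1 ∈ range π := by rw [h.range_right]; exact r.2.1
      obtain ⟨w, hw⟩ := h1
      exact ⟨w, BlowUp.eq_of_fst_eq_of_notMem hw (by
        change π w ∉ range center
        rwa [hw])⟩
    · rintro _ ⟨u, rfl⟩
      exact ball_subset_interior_closedBall (by simpa using norm_center_lt u)
  · intro w w'
    constructor
    · intro hw
      have h1 := h.right_eq_of_left_eq hw
      exact BlowUp.eq_of_fst_eq h1 fun d hd => (hiff d w w' hd (h1 ▸ hd)).2 hw
    · intro hw
      have h1 : π w = π w' := congrArg (fun q => q.1.1) hw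
      by_cases hD : π w ∈ range center
      · exact (hiff ⟨π w, hD⟩ w w' rfl h1.symm).1 (congrFun (congrArg (fun q => q.1.2) hw) _)
      · exact h.left_eq_of_right_eq h1 hD

end CodingPair

lemma closedBall_subset_closure_center : closedBall 0 1 ⊆ closure (range center) := by
  refine closedBall_subset_closure_of_invariant (range_nonempty _) ?_ ?_
  · rintro _ ⟨u, rfl⟩
    exact (norm_center_lt u).le
  · rintro e _ ⟨u, rfl⟩
    exact ⟨e :: u, rfl⟩

/-- Two Hausdorff quotients of a compact space by the same relation are homeomorphic. -/
lemma nonempty_homeomorph_of_same_fibers {X A B : Type*} [TopologicalSpace X] [CompactSpace X]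
    [TopologicalSpace A] [T2Space A] [TopologicalSpace B] [T2Space B] {f : X → A} {g : X → B}
    (hf : Continuous f) (hfs : Function.Surjective f) (hg : Continuous g)
    (hgs : Function.Surjective g) (hfg : ∀ x y, f x = f y ↔ g x = g y) : Nonempty (A ≃ₜ B) := by
  have hfq : IsQuotientMap f := hf.isClosedMap.isQuotientMap hf hfs
  have hgq : IsQuotientMap g := hg.isClosedMap.isQuotientMap hg hgs
  refine ⟨⟨⟨fun a => g (Function.surjInv hfs a), fun b => f (Function.surjInv hgs b),
    fun a => ?_, fun b => ?_⟩, ?_, ?_⟩⟩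
  · simp only
    conv_rhs => rw [← Function.surjInv_eq hfs a]
    exact (hfg _ _).2 (Function.surjInv_eq hgs _)
  · simp only
    conv_rhs => rw [← Function.surjInv_eq hgs b]
    exact (hfg _ _).1 (Function.surjInv_eq hfs _)
  · rw [hfq.continuous_iff]
    convert hg using 1
    exact funext fun x => (hfg _ _).1 (Function.surjInv_eq hfs _)
  · rw [hgq.continuous_iff]
    convert hf using 1
    exact funext fun x => (hfg _ _).2 (Function.surjInv_eq hgs _)

lemma eq_tsum_of_ternary {x : ℕ → ℝ} {a : ℕ → Fin 3} (hx0 : ∀ n, 0 ≤ x n) (hx1 : ∀ n, x n ≤ 1)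
    (hx : ∀ n, x n = ((a n : ℝ) + x (n + 1)) / 3) : x 0 = ∑' i, (a i : ℝ) / 3 ^ (i + 1) := by
  refine (HasSum.tsum_eq ?_).symm
  rw [hasSum_iff_tendsto_nat_of_nonneg fun i => by positivity]
  have h1 : ∀ n, ∑ i ∈ Finset.range n, (a i : ℝ) / 3 ^ (i + 1) = x 0 - x n / 3 ^ n := by
    intro n
    induction n with
    | zero => simp
    | succ n ih =>
      rw [Finset.sum_range_succ, ih, hx n]
      field_simp
      ring
  simp only [h1]
  have h2 : Tendsto (fun n => x n / 3 ^ n) atTop (𝓝 0) := by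
    refine squeeze_zero (fun n => by have := hx0 n; positivity) (fun n => ?_)
      (tendsto_pow_atTop_nhds_zero_of_lt_one (by norm_num : (0 : ℝ) ≤ 1 / 3) (by norm_num))
    rw [one_div, inv_pow, ← one_div]
    exact div_le_div_of_nonneg_right (hx1 n) (by positivity)
  simpa using h2.const_sub (x 0)

lemma CodingPair.rescale_fst {κ π : Code → Plane} (h : CodingPair κ π) (w : Code) :
    ((κ w).1 + 1) / 2 = ∑' i, ((w i).1.1 : ℝ) / 3 ^ (i + 1) := by
  have hk : ∀ w : Code, |(κ w).1| ≤ 1 := fun w => (norm_fst_le (κ w)).trans (h.norm_left w)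
  refine eq_tsum_of_ternary (x := fun n => ((κ (shift^[n] w)).1 + 1) / 2) (fun n => ?_)
    (fun n => ?_) fun n => ?_
  · linarith [(abs_le.1 (hk (shift^[n] w))).1]
  · linarith [(abs_le.1 (hk (shift^[n] w))).2]
  · have h0 : ∀ (n : ℕ) (w : Code), (shift^[n] w) 0 = w n := by
      intro n
      induction n with
      | zero => exact fun w => rfl
      | succ n ih => exact fun w => by rw [Function.iterate_succ_apply, ih]; rfl
    rw [h.left_eq, Function.iterate_succ_apply', h0]
    simp [cell, Digit.vec]
    ring

lemma CodingPair.rescale_snd {κ π : Code → Plane} (h : CodingPair κ π) (w : Code) :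
    ((κ w).2 + 1) / 2 = ∑' i, ((w i).1.2 : ℝ) / 3 ^ (i + 1) := by
  have hk : ∀ w : Code, |(κ w).2| ≤ 1 := fun w => (norm_snd_le (κ w)).trans (h.norm_left w)
  refine eq_tsum_of_ternary (x := fun n => ((κ (shift^[n] w)).2 + 1) / 2) (fun n => ?_)
    (fun n => ?_) fun n => ?_
  · linarith [(abs_le.1 (hk (shift^[n] w))).1]
  · linarith [(abs_le.1 (hk (shift^[n] w))).2]
  · have h0 : ∀ (n : ℕ) (w : Code), (shift^[n] w) 0 = w n := by
      intro n
      induction n with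
      | zero => exact fun w => rfl
      | succ n ih => exact fun w => by rw [Function.iterate_succ_apply, ih]; rfl
    rw [h.left_eq, Function.iterate_succ_apply', h0]
    simp [cell, Digit.vec]
    ring

/-- The carpet is the blow-up of the square at a countable dense set of interior points. -/
theorem nonempty_carpet_homeomorph_blowUp :
    Nonempty (sierpinskiCarpet ≃ₜ BlowUp (closedBall 0 1) (range center)) := by
  obtain ⟨κ, π, h⟩ := exists_codingPair
  obtain ⟨Ξ, h1, h2, h3⟩ := h.exists_blowUp_coding
  have hmem : ∀ w : Code, (((κ w).1 + 1) / 2, ((κ w).2 + 1) / 2) ∈ sierpinskiCarpet := fun w =>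
    ⟨fun i => (w i).1.1, fun i => (w i).1.2, fun i => (w i).2, h.rescale_fst w, h.rescale_snd w⟩
  have hc := h.continuous_left
  refine nonempty_homeomorph_of_same_fibers (X := Code)
    (f := fun w => ⟨(((κ w).1 + 1) / 2, ((κ w).2 + 1) / 2), hmem w⟩) (by fun_prop) ?_ h1 h2 ?_
  · rintro ⟨p, a, b, hab, hp1, hp2⟩
    refine ⟨fun i => ⟨(a i, b i), hab i⟩, Subtype.ext (Prod.ext ?_ ?_)⟩
    · exact (h.rescale_fst _).trans hp1.symm
    · exact (h.rescale_snd _).trans hp2.symm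
  · intro w w'
    rw [← h3, Subtype.mk.injEq, Prod.mk.injEq, Prod.ext_iff]
    simp

/-! ### Coordinates on the doubled square with one corner blown up -/

/-- Folding coordinates: `(M, t)` parametrises half of the square `|X| + |Y| ≤ 1` and the sign `σ`
selects the half. -/
noncomputable def pillow (M t : ℝ) (σ : SignType) : Plane :=
  (t * (1 - M / 2) + σ * ((1 - |t|) * (1 - M)), t * (1 - M / 2) - σ * ((1 - |t|) * (1 - M)))

/-- Admissible folding coordinates. -/
structure Folding (M t : ℝ) (σ : SignType) : Prop where
  nonneg : 0 ≤ M
  le_one : M ≤ 1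
  abs_le_one : |t| ≤ 1
  eq_zero_iff : σ = 0 ↔ (1 - |t|) * (1 - M) = 0

lemma max_abs_add_abs_sub (x y : ℝ) : max |x + y| |x - y| = |x| + |y| := by
  rcases abs_cases x with ⟨h1, h1'⟩ | ⟨h1, h1'⟩ <;> rcases abs_cases y with ⟨h2, h2'⟩ | ⟨h2, h2'⟩ <;>
    rcases abs_cases (x + y) with ⟨h3, h3'⟩ | ⟨h3, h3'⟩ <;>
    rcases abs_cases (x - y) with ⟨h4, h4'⟩ | ⟨h4, h4'⟩ <;> rw [h1, h2, h3, h4] <;>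
    rcases max_cases (x + y) (x - y) with ⟨h5, h5'⟩ | ⟨h5, h5'⟩ <;> grind

lemma Folding.norm_pillow {M t : ℝ} {σ : SignType} (h : Folding M t σ) :
    ‖pillow M t σ‖ = 1 - M * (1 - |t| / 2) := by
  have h1 := h.nonneg
  have h2 := h.le_one
  have h3 := h.abs_le_one
  have h4 : 0 ≤ (1 - |t|) * (1 - M) := mul_nonneg (by linarith) (by linarith)
  have h5 : |(σ : ℝ) * ((1 - |t|) * (1 - M))| = (1 - |t|) * (1 - M) := by
    rcases σ.trichotomy with hσ | hσ | hσ
    · rw [hσ, SignType.coe_neg, SignType.coe_one, neg_one_mul, abs_neg, abs_of_nonneg h4]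
    · rw [hσ, h.eq_zero_iff.1 hσ]; simp
    · rw [hσ, SignType.coe_one, one_mul, abs_of_nonneg h4]
  rw [pillow, Prod.norm_def, Real.norm_eq_abs, Real.norm_eq_abs, max_abs_add_abs_sub, h5, abs_mul,
    abs_of_nonneg (show 0 ≤ 1 - M / 2 by linarith)]
  ring

lemma Folding.norm_pillow_le {M t : ℝ} {σ : SignType} (h : Folding M t σ) :
    ‖pillow M t σ‖ ≤ 1 := by
  rw [h.norm_pillow]
  nlinarith [h.nonneg, h.abs_le_one]

lemma Folding.norm_pillow_eq_one_iff {M t : ℝ} {σ : SignType} (h : Folding M t σ) :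
    ‖pillow M t σ‖ = 1 ↔ M = 0 := by
  rw [h.norm_pillow]
  constructor
  · intro h1
    have h2 : M * (1 - |t| / 2) = 0 := by linarith
    exact (mul_eq_zero.1 h2).resolve_right (by linarith [h.abs_le_one])
  · rintro rfl
    simp

lemma fold_level_le {M τ M' τ' : ℝ} (hM' : M' ≤ 1) (hτ : 0 ≤ τ)
    (hτ1 : τ ≤ 1) (hτ1' : τ' ≤ 1) (hx : τ * (1 - M / 2) = τ' * (1 - M' / 2))
    (hy : (1 - τ) * (1 - M) = (1 - τ') * (1 - M')) : M' ≤ M := by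
  by_contra! hlt
  have h1 : τ ≤ τ' := by
    by_contra! h
    nlinarith
  rcases hτ1'.lt_or_eq with h | h
  · nlinarith
  · subst h
    have h2 : (1 - τ) * (1 - M) = 0 := by linarith
    rcases mul_eq_zero.1 h2 with h3 | h3
    · have : τ = 1 := by linarith
      subst this
      linarith
    · linarith

lemma Folding.pillow_injective {M t M' t' : ℝ} {σ σ' : SignType} (h : Folding M t σ)
    (h' : Folding M' t' σ') (hEq : pillow M t σ = pillow M' t' σ') :
    M = M' ∧ t = t' ∧ σ = σ' := by
  have e1 := congrArg Prod.fst hEq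
  have e2 := congrArg Prod.snd hEq
  simp only [pillow] at e1 e2
  have hX : t * (1 - M / 2) = t' * (1 - M' / 2) := by linarith
  have hY : (σ : ℝ) * ((1 - |t|) * (1 - M)) = σ' * ((1 - |t'|) * (1 - M')) := by linarith
  have hM := h.le_one
  have hM' := h'.le_one
  have ht := h.abs_le_one
  have ht' := h'.abs_le_one
  have hX' : |t| * (1 - M / 2) = |t'| * (1 - M' / 2) := by
    have := congrArg abs hX
    rwa [abs_mul, abs_mul, abs_of_pos (show 0 < 1 - M / 2 by linarith),
      abs_of_pos (show 0 < 1 - M' / 2 by linarith)] at this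
  have habs : ∀ {M t : ℝ} {σ : SignType}, Folding M t σ →
      |(σ : ℝ) * ((1 - |t|) * (1 - M))| = (1 - |t|) * (1 - M) := by
    intro M t σ h
    have h4 : 0 ≤ (1 - |t|) * (1 - M) :=
      mul_nonneg (by linarith [h.abs_le_one]) (by linarith [h.le_one])
    rcases σ.trichotomy with hσ | hσ | hσ
    · rw [hσ, SignType.coe_neg, SignType.coe_one, neg_one_mul, abs_neg, abs_of_nonneg h4]
    · rw [hσ, h.eq_zero_iff.1 hσ]; simp
    · rw [hσ, SignType.coe_one, one_mul, abs_of_nonneg h4]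
  have hY' : (1 - |t|) * (1 - M) = (1 - |t'|) * (1 - M') := by
    rw [← habs h, ← habs h', hY]
  have hMM : M = M' := le_antisymm
    (fold_level_le hM (abs_nonneg _) ht' ht hX'.symm hY'.symm)
    (fold_level_le hM' (abs_nonneg _) ht ht' hX' hY')
  subst hMM
  have htt : t = t' := mul_right_cancel₀ (show 1 - M / 2 ≠ 0 by linarith) hX
  subst htt
  refine ⟨rfl, rfl, ?_⟩
  by_cases h0 : (1 - |t|) * (1 - M) = 0
  · rw [h.eq_zero_iff.2 h0, h'.eq_zero_iff.2 h0]
  · have h1 : (σ : ℝ) = σ' := mul_right_cancel₀ h0 hY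
    rcases σ.trichotomy with hσ | hσ | hσ <;> rcases σ'.trichotomy with hσ' | hσ' | hσ' <;>
      rw [hσ, hσ'] <;> rw [hσ, hσ'] at h1 <;> norm_num at h1

lemma exists_fold {x y : ℝ} (hx : 0 ≤ x) (hy : 0 ≤ y) (hxy : x + y ≤ 1) :
    ∃ M τ : ℝ, 0 ≤ M ∧ M ≤ 1 ∧ 0 ≤ τ ∧ τ ≤ 1 ∧ τ * (1 - M / 2) = x ∧
      (1 - τ) * (1 - M) = y := by
  set E := min 1 (2 * (1 - x)) with hE
  have hE0 : 0 ≤ E := le_min zero_le_one (by linarith)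
  have hE1 : E ≤ 1 := min_le_left _ _
  let g : ℝ → ℝ := fun M => (1 - x / (1 - M / 2)) * (1 - M)
  have hg : ContinuousOn g (Icc 0 E) := by
    refine ContinuousOn.mul (ContinuousOn.sub continuousOn_const
      (ContinuousOn.div continuousOn_const (by fun_prop) fun M hM => ?_)) (by fun_prop)
    linarith [hM.2]
  have hgE : g E = 0 := by
    rcases min_cases 1 (2 * (1 - x)) with ⟨h1, h2⟩ | ⟨h1, h2⟩
    · simp only [g, hE, h1]; norm_num
    · have hx0 : x ≠ 0 := by linarith
      have : 1 - 2 * (1 - x) / 2 = x := by ring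
      simp only [g, hE, h1, this, div_self hx0]
      ring
  have hg0 : g 0 = 1 - x := by simp [g]
  obtain ⟨M, hM, hgM⟩ := intermediate_value_Icc' hE0 hg
    (show y ∈ Icc (g E) (g 0) from ⟨by rw [hgE]; exact hy, by rw [hg0]; linarith⟩)
  have hpos : 0 < 1 - M / 2 := by linarith [hM.2]
  refine ⟨M, x / (1 - M / 2), hM.1, hM.2.trans hE1, by positivity, ?_,
    div_mul_cancel₀ _ hpos.ne', hgM⟩
  rw [div_le_one hpos]
  linarith [hM.2, min_le_right 1 (2 * (1 - x))]

lemma exists_folding_eq {z : Plane} (hz : ‖z‖ ≤ 1) :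
    ∃ M t σ, Folding M t σ ∧ pillow M t σ = z := by
  set X := (z.1 + z.2) / 2 with hX
  set Y := (z.1 - z.2) / 2 with hY
  have hXY : |X| + |Y| ≤ 1 := by
    rw [← max_abs_add_abs_sub]
    have h1 : X + Y = z.1 := by rw [hX, hY]; ring
    have h2 : X - Y = z.2 := by rw [hX, hY]; ring
    rw [h1, h2]
    exact hz
  obtain ⟨M, τ, h1, h2, h3, h4, h5, h6⟩ := exists_fold (abs_nonneg X) (abs_nonneg Y) hXY
  obtain ⟨t, ht, htX⟩ : ∃ t : ℝ, |t| = τ ∧ t * (1 - M / 2) = X := by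
    rcases abs_cases X with ⟨h, -⟩ | ⟨h, -⟩
    · exact ⟨τ, abs_of_nonneg h3, by rw [h5, h]⟩
    · exact ⟨-τ, by rw [abs_neg, abs_of_nonneg h3], by rw [neg_mul, h5, h, neg_neg]⟩
  refine ⟨M, t, SignType.sign Y, ⟨h1, h2, ht ▸ h4, ?_⟩, ?_⟩
  · rw [ht, h6, abs_eq_zero, sign_eq_zero_iff]
  · rw [pillow, ht, h6, htX, sign_mul_abs]
    refine Prod.ext ?_ ?_ <;> simp only [hX, hY] <;> ring

/-! ### The quotient of the torus by the central symmetry, blown up at the origin -/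

/-- The amplitude `sin (π r x) / r`, extended continuously to `r = 0`. -/
noncomputable def amp (r x : ℝ) : ℝ := Real.pi * x * Real.sinc (Real.pi * r * x)

lemma mul_amp (r x : ℝ) : r * amp r x = Real.sin (Real.pi * r * x) := by
  by_cases h : Real.pi * r * x = 0
  · have : r * x = 0 := by
      rw [mul_assoc] at h
      exact (mul_eq_zero.1 h).resolve_left Real.pi_ne_zero
    rw [h, Real.sin_zero, amp]
    linear_combination (Real.pi * Real.sinc (Real.pi * r * x)) * this
  · rw [amp, Real.sinc_of_ne_zero h]
    have h1 : Real.pi * r * x * (Real.sin (Real.pi * r * x) / (Real.pi * r * x)) = _ :=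
      mul_div_cancel₀ _ h
    exact Eq.trans (by ring) h1

lemma amp_one (x : ℝ) : amp 1 x = Real.sin (Real.pi * x) := by
  have := mul_amp 1 x
  rwa [one_mul, mul_one] at this

lemma amp_zero (x : ℝ) : amp 0 x = Real.pi * x := by simp [amp]

lemma amp_mul (r c x : ℝ) : amp r (c * x) = c * amp (r * c) x := by
  rw [amp, amp]
  ring_nf

lemma amp_neg (r x : ℝ) : amp (-r) x = amp r x := by
  rw [amp, amp, show Real.pi * -r * x = -(Real.pi * r * x) by ring, Real.sinc_neg]

lemma continuous_amp : Continuous fun p : ℝ × ℝ => amp p.1 p.2 := by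
  unfold amp
  exact (by fun_prop : Continuous fun p : ℝ × ℝ => Real.pi * p.2).mul
    (Real.continuous_sinc.comp (by fun_prop))

/-- The larger of the two squared amplitudes. -/
noncomputable def maxSq (r : ℝ) (u : Plane) : ℝ := max (amp r u.1 ^ 2) (amp r u.2 ^ 2)

/-- The normalised difference of the two squared amplitudes. -/
noncomputable def slope (r : ℝ) (u : Plane) : ℝ := (amp r u.1 ^ 2 - amp r u.2 ^ 2) / maxSq r u

/-- A function whose sign tells the two sheets of the folding apart. -/
noncomputable def orient (r : ℝ) (u : Plane) : ℝ :=
  amp r u.1 * amp r u.2 * (Real.cos (Real.pi * r * u.1) * Real.cos (Real.pi * r * u.2))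

/-- The folding of the plane at `r • u`, in blown-up polar coordinates `(r, u)`. -/
noncomputable def wrap (r : ℝ) (u : Plane) : Plane :=
  pillow (r ^ 2 * maxSq r u) (slope r u) (SignType.sign (orient r u))

/-- The folding of the plane modulo the integer lattice and the central symmetry. -/
noncomputable def fold (v : Plane) : Plane := wrap 1 v

lemma maxSq_nonneg (r : ℝ) (u : Plane) : 0 ≤ maxSq r u := le_max_of_le_left (sq_nonneg _)

lemma maxSq_eq_zero_iff {r : ℝ} {u : Plane} :
    maxSq r u = 0 ↔ amp r u.1 = 0 ∧ amp r u.2 = 0 := by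
  constructor
  · intro h
    have h1 : amp r u.1 ^ 2 ≤ 0 := h ▸ le_max_left _ _
    have h2 : amp r u.2 ^ 2 ≤ 0 := h ▸ le_max_right _ _
    exact ⟨pow_eq_zero_iff two_ne_zero |>.1 (le_antisymm h1 (sq_nonneg _)),
      pow_eq_zero_iff two_ne_zero |>.1 (le_antisymm h2 (sq_nonneg _))⟩
  · rintro ⟨h1, h2⟩
    simp [maxSq, h1, h2]

lemma mul_maxSq (r : ℝ) (u : Plane) : r ^ 2 * maxSq r u =
    max (Real.sin (Real.pi * r * u.1) ^ 2) (Real.sin (Real.pi * r * u.2) ^ 2) := by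
  rw [maxSq, mul_max_of_nonneg _ _ (sq_nonneg r), ← mul_pow, ← mul_pow, mul_amp, mul_amp]

lemma abs_sub_eq_max_iff {a b : ℝ} (ha : 0 ≤ a) (hb : 0 ≤ b) :
    |a - b| = max a b ↔ a = 0 ∨ b = 0 := by
  rcases abs_cases (a - b) with ⟨h1, h1'⟩ | ⟨h1, h1'⟩ <;>
    rcases max_cases a b with ⟨h2, h2'⟩ | ⟨h2, h2'⟩ <;> rw [h1, h2] <;> constructor <;> grind

lemma folding_wrap {r : ℝ} {u : Plane} (h : maxSq r u ≠ 0) :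
    Folding (r ^ 2 * maxSq r u) (slope r u) (SignType.sign (orient r u)) := by
  have hpos : 0 < maxSq r u := (maxSq_nonneg r u).lt_of_ne' h
  have hs : |slope r u| = |amp r u.1 ^ 2 - amp r u.2 ^ 2| / maxSq r u := by
    rw [slope, abs_div, abs_of_pos hpos]
  refine ⟨mul_nonneg (sq_nonneg _) hpos.le, ?_, ?_, ?_⟩
  · rw [mul_maxSq]
    exact max_le (Real.sin_sq_le_one _) (Real.sin_sq_le_one _)
  · rw [hs, div_le_one hpos, maxSq, abs_le]
    have h1 := le_max_left (amp r u.1 ^ 2) (amp r u.2 ^ 2)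
    have h2 := le_max_right (amp r u.1 ^ 2) (amp r u.2 ^ 2)
    constructor <;> nlinarith [sq_nonneg (amp r u.1), sq_nonneg (amp r u.2)]
  · have h1 : 1 - |slope r u| = 0 ↔ amp r u.1 = 0 ∨ amp r u.2 = 0 := by
      rw [sub_eq_zero, eq_comm, hs, div_eq_one_iff_eq h, maxSq,
        abs_sub_eq_max_iff (sq_nonneg _) (sq_nonneg _), pow_eq_zero_iff two_ne_zero,
        pow_eq_zero_iff two_ne_zero]
    have hcos : ∀ x : ℝ, Real.sin x ^ 2 = 1 ↔ Real.cos x = 0 := fun x => by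
      rw [Real.sin_sq, sub_eq_self, pow_eq_zero_iff two_ne_zero]
    have h2 : 1 - r ^ 2 * maxSq r u = 0 ↔
        Real.cos (Real.pi * r * u.1) = 0 ∨ Real.cos (Real.pi * r * u.2) = 0 := by
      rw [mul_maxSq, sub_eq_zero, eq_comm, ← hcos, ← hcos]
      have l1 := Real.sin_sq_le_one (Real.pi * r * u.1)
      have l2 := Real.sin_sq_le_one (Real.pi * r * u.2)
      constructor
      · intro h
        rcases max_cases (Real.sin (Real.pi * r * u.1) ^ 2) (Real.sin (Real.pi * r * u.2) ^ 2)
          with ⟨h', -⟩ | ⟨h', -⟩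
        · exact Or.inl (h' ▸ h)
        · exact Or.inr (h' ▸ h)
      · rintro (h | h) <;> rw [h]
        · exact max_eq_left l2
        · exact max_eq_right l1
    rw [sign_eq_zero_iff, orient, mul_eq_zero, mul_eq_zero, mul_eq_zero, mul_eq_zero, h1, h2]

lemma norm_wrap_le {r : ℝ} {u : Plane} (h : maxSq r u ≠ 0) : ‖wrap r u‖ ≤ 1 :=
  (folding_wrap h).norm_pillow_le

lemma norm_wrap_eq_one_iff {r : ℝ} {u : Plane} (h : maxSq r u ≠ 0) :
    ‖wrap r u‖ = 1 ↔ r = 0 := by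
  rw [wrap, (folding_wrap h).norm_pillow_eq_one_iff, mul_eq_zero, pow_eq_zero_iff two_ne_zero]
  exact or_iff_left h

lemma maxSq_smul (r c : ℝ) (u : Plane) : maxSq r (c • u) = c ^ 2 * maxSq (r * c) u := by
  simp only [maxSq, Prod.smul_fst, Prod.smul_snd, smul_eq_mul, amp_mul, mul_pow]
  rw [mul_max_of_nonneg _ _ (sq_nonneg c)]

lemma wrap_smul (r : ℝ) {c : ℝ} (hc : c ≠ 0) (u : Plane) : wrap r (c • u) = wrap (r * c) u := by
  have hm := maxSq_smul r c u
  have ho : orient r (c • u) = c ^ 2 * orient (r * c) u := by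
    simp only [orient, Prod.smul_fst, Prod.smul_snd, smul_eq_mul, amp_mul]
    rw [← mul_assoc (Real.pi * r) c, ← mul_assoc (Real.pi * r) c, mul_assoc Real.pi r c]
    ring
  have hs : slope r (c • u) = slope (r * c) u := by
    rw [slope, hm, slope, ← mul_div_mul_left _ (maxSq (r * c) u) (pow_ne_zero 2 hc)]
    simp only [Prod.smul_fst, Prod.smul_snd, smul_eq_mul, amp_mul]
    ring
  rw [wrap, wrap, hm, hs, ho, sign_mul, sign_pos (by positivity : 0 < c ^ 2), one_mul, mul_pow,
    mul_assoc]

lemma wrap_neg_left (r : ℝ) (u : Plane) : wrap (-r) u = wrap r u := by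
  have hc : ∀ x, Real.cos (Real.pi * -r * x) = Real.cos (Real.pi * r * x) := fun x => by
    rw [← Real.cos_neg]; ring_nf
  simp only [wrap, slope, maxSq, orient, amp_neg, neg_sq, hc]

lemma wrap_eq_fold {r : ℝ} (hr : r ≠ 0) (u : Plane) : wrap r u = fold (r • u) := by
  rw [fold, wrap_smul 1 hr, one_mul]

lemma fold_neg (v : Plane) : fold (-v) = fold v := by
  rw [← neg_one_smul ℝ v, fold, wrap_smul 1 (by norm_num : (-1 : ℝ) ≠ 0), one_mul, wrap_neg_left,
    fold]

lemma maxSq_one (v : Plane) : maxSq 1 v =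
    max (Real.sin (Real.pi * v.1) ^ 2) (Real.sin (Real.pi * v.2) ^ 2) := by
  rw [maxSq, amp_one, amp_one]

lemma orient_one (v : Plane) : orient 1 v =
    (Real.sin (2 * Real.pi * v.1) * Real.sin (2 * Real.pi * v.2)) / 4 := by
  rw [orient, amp_one, amp_one, mul_one, mul_assoc 2, mul_assoc 2, Real.sin_two_mul,
    Real.sin_two_mul]
  ring

lemma sin_sq_pi_mul (x : ℝ) :
    Real.sin (Real.pi * x) ^ 2 = 1 / 2 - Real.cos (2 * Real.pi * x) / 2 := by
  rw [mul_assoc, Real.sin_sq_eq_half_sub]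

lemma fold_eq (v : Plane) : fold v = pillow
    (max (Real.sin (Real.pi * v.1) ^ 2) (Real.sin (Real.pi * v.2) ^ 2))
    ((Real.sin (Real.pi * v.1) ^ 2 - Real.sin (Real.pi * v.2) ^ 2) /
      max (Real.sin (Real.pi * v.1) ^ 2) (Real.sin (Real.pi * v.2) ^ 2))
    (SignType.sign (Real.sin (2 * Real.pi * v.1) * Real.sin (2 * Real.pi * v.2))) := by
  have : ∀ x : ℝ, SignType.sign (x / 4) = SignType.sign x := fun x => by
    rw [div_eq_mul_inv, sign_mul, sign_pos (by norm_num : (0 : ℝ) < 4⁻¹), mul_one]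
  rw [fold, wrap, slope, orient_one, maxSq_one, this, one_pow, one_mul, amp_one, amp_one]

lemma fold_add_int (v : Plane) (k l : ℤ) : fold (v + ((k : ℝ), (l : ℝ))) = fold v := by
  have hs : ∀ (x : ℝ) (k : ℤ), Real.sin (2 * Real.pi * (x + k)) = Real.sin (2 * Real.pi * x) :=
    fun x k => by
      rw [show 2 * Real.pi * (x + k) = 2 * Real.pi * x + k * (2 * Real.pi) by ring,
        Real.sin_add_int_mul_two_pi]
  have hc : ∀ (x : ℝ) (k : ℤ), Real.cos (2 * Real.pi * (x + k)) = Real.cos (2 * Real.pi * x) :=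
    fun x k => by
      rw [show 2 * Real.pi * (x + k) = 2 * Real.pi * x + k * (2 * Real.pi) by ring,
        Real.cos_add_int_mul_two_pi]
  simp only [fold_eq, sin_sq_pi_mul, Prod.fst_add, Prod.snd_add, hs, hc]

lemma maxSq_one_eq_zero_iff {v : Plane} : maxSq 1 v = 0 ↔ ∃ k l : ℤ, v = ((k : ℝ), (l : ℝ)) := by
  rw [maxSq_eq_zero_iff, amp_one, amp_one, Real.sin_eq_zero_iff, Real.sin_eq_zero_iff]
  constructor
  · rintro ⟨⟨k, hk⟩, l, hl⟩
    refine ⟨k, l, Prod.ext ?_ ?_⟩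
    · exact mul_left_cancel₀ Real.pi_ne_zero (by rw [← hk, mul_comm])
    · exact mul_left_cancel₀ Real.pi_ne_zero (by rw [← hl, mul_comm])
  · rintro ⟨k, l, rfl⟩
    exact ⟨⟨k, mul_comm _ _⟩, l, mul_comm _ _⟩

lemma maxSq_zero_eq_zero_iff {u : Plane} : maxSq 0 u = 0 ↔ u = 0 := by
  rw [maxSq_eq_zero_iff, amp_zero, amp_zero, Prod.ext_iff]
  simp [Real.pi_ne_zero]

lemma maxSq_eq_zero_iff_smul {r : ℝ} (hr : r ≠ 0) {u : Plane} :
    maxSq r u = 0 ↔ maxSq 1 (r • u) = 0 := by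
  rw [maxSq_smul, one_mul, mul_eq_zero, or_iff_right (pow_ne_zero 2 hr)]

lemma maxSq_ne_zero_of_le {r : ℝ} {u : Plane} (hr0 : 0 ≤ r) (hr : r ≤ 1 / 2) (hu : ‖u‖ = 1) :
    maxSq r u ≠ 0 := by
  have hu0 : u ≠ 0 := by rintro rfl; simp at hu
  rcases hr0.eq_or_lt with rfl | hr0
  · rwa [Ne, maxSq_zero_eq_zero_iff]
  · rw [Ne, maxSq_eq_zero_iff_smul hr0.ne', maxSq_one_eq_zero_iff]
    rintro ⟨k, l, hkl⟩
    have hn : ‖r • u‖ ≤ 1 / 2 := by rwa [norm_smul, hu, mul_one, Real.norm_of_nonneg hr0.le]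
    have hz : ∀ k : ℤ, |(k : ℝ)| ≤ 1 / 2 → k = 0 := fun k hk => by
      have : |(k : ℝ)| < 1 := by linarith
      exact Int.abs_lt_one_iff.1 (by exact_mod_cast this)
    rw [hkl, Prod.norm_def, sup_le_iff] at hn
    rw [hz k hn.1, hz l hn.2] at hkl
    refine (smul_ne_zero hr0.ne' hu0) (hkl.trans (by simp))

lemma continuousAt_sign_mul {X : Type*} [TopologicalSpace X] {ξ g : X → ℝ} {p : X}
    (hξ : ContinuousAt ξ p) (hg : ContinuousAt g p) (h0 : ξ p = 0 → g p = 0) :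
    ContinuousAt (fun q => (SignType.sign (ξ q) : ℝ) * g q) p := by
  by_cases h : ξ p = 0
  · have hgp := h0 h
    rw [ContinuousAt, hgp, mul_zero]
    rw [ContinuousAt, hgp] at hg
    refine squeeze_zero_norm (fun q => ?_) (tendsto_zero_iff_norm_tendsto_zero.1 hg)
    rw [norm_mul]
    refine mul_le_of_le_one_left (norm_nonneg _) ?_
    rcases (SignType.sign (ξ q)).trichotomy with h | h | h <;> rw [h] <;> simp
  · refine ContinuousAt.mul ?_ hg
    have hc : Continuous fun s : SignType => (s : ℝ) := continuous_of_discreteTopology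
    exact hc.continuousAt.comp ((continuousAt_sign_of_ne_zero h).comp hξ)

lemma continuousAt_wrap {p : ℝ × Plane} (h : maxSq p.1 p.2 ≠ 0) :
    ContinuousAt (fun q : ℝ × Plane => wrap q.1 q.2) p := by
  have c1 : Continuous fun q : ℝ × Plane => amp q.1 q.2.1 :=
    continuous_amp.comp (by fun_prop : Continuous fun q : ℝ × Plane => (q.1, q.2.1))
  have c2 : Continuous fun q : ℝ × Plane => amp q.1 q.2.2 :=
    continuous_amp.comp (by fun_prop : Continuous fun q : ℝ × Plane => (q.1, q.2.2))
  have cm : Continuous fun q : ℝ × Plane => maxSq q.1 q.2 := (c1.pow 2).max (c2.pow 2)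
  have co : Continuous fun q : ℝ × Plane => orient q.1 q.2 :=
    (c1.mul c2).mul (by fun_prop)
  have cs : ContinuousAt (fun q : ℝ × Plane => slope q.1 q.2) p :=
    ((c1.pow 2).sub (c2.pow 2)).continuousAt.div cm.continuousAt h
  have cl : Continuous fun q : ℝ × Plane => q.1 ^ 2 * maxSq q.1 q.2 := by fun_prop
  have ca : ContinuousAt (fun q : ℝ × Plane => slope q.1 q.2 * (1 - q.1 ^ 2 * maxSq q.1 q.2 / 2))
      p := cs.mul (by fun_prop)
  have cb := continuousAt_sign_mul (g := fun q : ℝ × Plane =>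
      (1 - |slope q.1 q.2|) * (1 - q.1 ^ 2 * maxSq q.1 q.2)) co.continuousAt
    ((continuousAt_const.sub cs.abs).mul (by fun_prop))
    (fun h0 => (folding_wrap h).eq_zero_iff.1 (by rw [h0, sign_zero]))
  exact (ca.add cb).prodMk (ca.sub cb)

/-! ### Surjectivity and fibres of the folding map -/

/-- Blown-up polar coordinates of the square of side one centred at the origin. -/
def polar : Set (ℝ × Plane) := Icc 0 (1 / 2) ×ˢ sphere 0 1

lemma isCompact_polar : IsCompact polar := isCompact_Icc.prod (isCompact_sphere _ _)

lemma maxSq_ne_zero_of_mem_polar {p : ℝ × Plane} (hp : p ∈ polar) : maxSq p.1 p.2 ≠ 0 :=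
  maxSq_ne_zero_of_le hp.1.1 hp.1.2 (mem_sphere_zero_iff_norm.1 hp.2)

lemma exists_split {t : ℝ} (ht : |t| ≤ 1) : ∃ a b : ℝ, 0 ≤ a ∧ 0 ≤ b ∧ a ≤ 1 ∧ b ≤ 1 ∧
    max a b = 1 ∧ a - b = t ∧ (1 - |t| ≠ 0 → 0 < a ∧ 0 < b) := by
  rw [abs_le] at ht
  rcases le_total 0 t with h | h
  · refine ⟨1, 1 - t, by norm_num, by linarith, le_rfl, by linarith, max_eq_left (by linarith),
      by ring, fun h1 => ⟨one_pos, ?_⟩⟩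
    rw [abs_of_nonneg h] at h1
    exact lt_of_le_of_ne (by linarith) h1.symm
  · refine ⟨1 + t, 1, by linarith, by norm_num, by linarith, le_rfl, max_eq_right (by linarith),
      by ring, fun h1 => ⟨?_, one_pos⟩⟩
    rw [abs_of_nonpos h, sub_neg_eq_add] at h1
    exact lt_of_le_of_ne (by linarith) h1.symm

lemma Folding.sign_eq {M t : ℝ} {σ σ' : SignType} (h : Folding M t σ) (h' : Folding M t σ')
    (hσ : (1 - |t|) * (1 - M) ≠ 0 → σ = σ') : σ = σ' := by
  by_cases h0 : (1 - |t|) * (1 - M) = 0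
  · rw [h.eq_zero_iff.2 h0, h'.eq_zero_iff.2 h0]
  · exact hσ h0

lemma mem_polar_of_norm_le {v : Plane} (hv0 : v ≠ 0) (hv : ‖v‖ ≤ 1 / 2) :
    (‖v‖, dir v) ∈ polar :=
  ⟨⟨norm_nonneg _, hv⟩, mem_sphere_zero_iff_norm.2 (norm_dir hv0)⟩

lemma wrap_norm_dir {v : Plane} (hv : v ≠ 0) : wrap ‖v‖ (dir v) = fold v := by
  rw [wrap_eq_fold (norm_ne_zero_iff.2 hv), norm_smul_dir]

lemma exists_wrap_eq {z : Plane} (hz : ‖z‖ ≤ 1) : ∃ p ∈ polar, wrap p.1 p.2 = z := by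
  obtain ⟨M, t, σ, hf, rfl⟩ := exists_folding_eq hz
  obtain ⟨a, b, ha, hb, ha1, hb1, hab, rfl, hpos⟩ := exists_split hf.abs_le_one
  obtain ⟨ε, hε, hεσ⟩ : ∃ ε : ℝ, ε ^ 2 = 1 ∧ (σ ≠ 0 → SignType.sign ε = σ) := by
    rcases σ.trichotomy with h | h | h
    · exact ⟨-1, by norm_num, fun _ => by rw [h]; simp⟩
    · exact ⟨1, by norm_num, fun h' => absurd h h'⟩
    · exact ⟨1, by norm_num, fun _ => by rw [h]; simp⟩
  have hε1 : |ε| = 1 := by rw [← sq_eq_sq₀ (abs_nonneg _) zero_le_one, sq_abs, hε, one_pow]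
  rcases hf.nonneg.eq_or_lt with rfl | hM
  · set u : Plane := (√a, ε * √b) with hu
    have hu1 : ‖u‖ = 1 := by
      rw [hu, Prod.norm_def, Real.norm_eq_abs, Real.norm_eq_abs, abs_mul, hε1, one_mul,
        abs_of_nonneg (Real.sqrt_nonneg _), abs_of_nonneg (Real.sqrt_nonneg _)]
      rcases max_cases a b with ⟨h1, h2⟩ | ⟨h1, h2⟩
      · have : a = 1 := by rw [← h1, hab]
        subst this
        simpa using hb1
      · have : b = 1 := by rw [← h1, hab]
        subst this
        simpa using ha1
    have hp : ((0 : ℝ), u) ∈ polar := ⟨⟨le_rfl, by norm_num⟩, mem_sphere_zero_iff_norm.2 hu1⟩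
    have hfw := folding_wrap (maxSq_ne_zero_of_mem_polar hp)
    have h1 : amp 0 u.1 ^ 2 = Real.pi ^ 2 * a := by
      rw [amp_zero, mul_pow, hu, Real.sq_sqrt ha]
    have h2 : amp 0 u.2 ^ 2 = Real.pi ^ 2 * b := by
      rw [amp_zero, mul_pow, hu, mul_pow, hε, one_mul, Real.sq_sqrt hb]
    have h3 : maxSq 0 u = Real.pi ^ 2 := by
      rw [maxSq, h1, h2, ← mul_max_of_nonneg _ _ (sq_nonneg _), hab, mul_one]
    have h4 : slope 0 u = a - b := by
      have := Real.pi_ne_zero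
      rw [slope, h3, h1, h2]
      field_simp
    refine ⟨_, hp, ?_⟩
    simp only [h3, h4, zero_pow two_ne_zero, zero_mul] at hfw
    rw [wrap, h3, h4, zero_pow two_ne_zero, zero_mul, hfw.sign_eq hf fun h0 => ?_]
    obtain ⟨ha0, hb0⟩ := hpos (left_ne_zero_of_mul h0)
    have hσ : σ ≠ 0 := fun h => h0 (hf.eq_zero_iff.1 h)
    rw [orient, amp_zero, amp_zero, hu, ← hεσ hσ]
    have hπ := Real.pi_pos
    have : Real.pi * √a * (Real.pi * (ε * √b)) * (Real.cos (Real.pi * 0 * √a) *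
        Real.cos (Real.pi * 0 * (ε * √b))) = ε * (Real.pi * √a * (Real.pi * √b)) := by
      simp; ring
    rw [this, sign_mul, sign_pos (show 0 < Real.pi * √a * (Real.pi * √b) by positivity), mul_one]
  · have hM1 := hf.le_one
    have hs0 : 0 ≤ M * a := by positivity
    have ht0 : 0 ≤ M * b := by positivity
    have hs1 : M * a ≤ 1 := by nlinarith
    have ht1 : M * b ≤ 1 := by nlinarith
    set x := Real.arcsin √(M * a) with hx
    set y := Real.arcsin √(M * b) with hy
    have hsx : Real.sin x = √(M * a) := Real.sin_arcsin (by linarith [Real.sqrt_nonneg (M * a)])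
      (Real.sqrt_le_one.2 hs1)
    have hsy : Real.sin y = √(M * b) := Real.sin_arcsin (by linarith [Real.sqrt_nonneg (M * b)])
      (Real.sqrt_le_one.2 ht1)
    have hcx : Real.cos x = √(1 - M * a) := by rw [hx, Real.cos_arcsin, Real.sq_sqrt hs0]
    have hcy : Real.cos y = √(1 - M * b) := by rw [hy, Real.cos_arcsin, Real.sq_sqrt ht0]
    have hx0 : 0 ≤ x := Real.arcsin_nonneg.2 (Real.sqrt_nonneg _)
    have hy0 : 0 ≤ y := Real.arcsin_nonneg.2 (Real.sqrt_nonneg _)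
    have hπ := Real.pi_pos
    set v : Plane := (x / Real.pi, ε * (y / Real.pi)) with hv
    have hεt : ∀ θ, Real.sin (ε * θ) = ε * Real.sin θ := fun θ => by
      rcases sq_eq_one_iff.1 hε with rfl | rfl <;> simp
    have v1 : Real.pi * v.1 = x := mul_div_cancel₀ _ hπ.ne'
    have v2 : Real.pi * v.2 = ε * y := by
      rw [hv]
      field_simp
    have h1 : Real.sin (Real.pi * v.1) ^ 2 = M * a := by rw [v1, hsx, Real.sq_sqrt hs0]
    have h2 : Real.sin (Real.pi * v.2) ^ 2 = M * b := by
      rw [v2, hεt, hsy, mul_pow, hε, one_mul, Real.sq_sqrt ht0]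
    have h3 : maxSq 1 v = M := by
      rw [maxSq_one, h1, h2, ← mul_max_of_nonneg _ _ hM.le, hab, mul_one]
    have hv0 : v ≠ 0 := by
      intro h
      rw [h, maxSq_one] at h3
      simp at h3
      exact hM.ne h3
    have hvn : ‖v‖ ≤ 1 / 2 := by
      have e : ∀ s : ℝ, 0 ≤ s → s ≤ Real.pi / 2 → |s / Real.pi| ≤ 1 / 2 := fun s h1 h2 => by
        rw [abs_of_nonneg (by positivity), div_le_iff₀ hπ]
        linarith
      rw [Prod.norm_def, Real.norm_eq_abs, Real.norm_eq_abs, abs_mul, hε1, one_mul]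
      exact max_le (e x hx0 (Real.arcsin_le_pi_div_two _)) (e y hy0 (Real.arcsin_le_pi_div_two _))
    refine ⟨_, mem_polar_of_norm_le hv0 hvn, ?_⟩
    have hfw := folding_wrap (h3 ▸ hM.ne' : maxSq 1 v ≠ 0)
    have h4 : slope 1 v = a - b := by
      rw [slope, h3, amp_one, amp_one, h1, h2]
      field_simp
    rw [wrap_norm_dir hv0, fold, wrap, h3, h4, one_pow, one_mul]
    rw [h3, h4, one_pow, one_mul] at hfw
    rw [hfw.sign_eq hf fun h0 => ?_]
    obtain ⟨ha0, hb0⟩ := hpos (left_ne_zero_of_mul h0)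
    have hσ : σ ≠ 0 := fun h => h0 (hf.eq_zero_iff.1 h)
    have hM1' : M < 1 := lt_of_le_of_ne hM1 fun h => right_ne_zero_of_mul h0 (by linarith)
    have hc1 : 0 < 1 - M * a := by nlinarith
    have hc2 : 0 < 1 - M * b := by nlinarith
    have hcε : Real.cos (ε * y) = Real.cos y := by
      rcases sq_eq_one_iff.1 hε with rfl | rfl <;> simp
    rw [orient, amp_one, amp_one, mul_one, v1, v2, hεt, hcε, hsx, hsy, hcx, hcy, ← hεσ hσ]
    have : √(M * a) * (ε * √(M * b)) * (√(1 - M * a) * √(1 - M * b)) =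
      ε * (√(M * a) * √(M * b) * (√(1 - M * a) * √(1 - M * b))) := by ring
    rw [this, sign_mul, sign_pos (show 0 < √(M * a) * √(M * b) * (√(1 - M * a) * √(1 - M * b)) by
      positivity), mul_one]

lemma eq_and_eq_of_max_eq_of_sub_eq {a b a' b' : ℝ} (h1 : max a b = max a' b')
    (h2 : a - b = a' - b') : a = a' ∧ b = b' := by
  rcases max_cases a b with ⟨h3, h4⟩ | ⟨h3, h4⟩ <;> rcases max_cases a' b' with ⟨h5, h6⟩ | ⟨h5, h6⟩ <;>
    constructor <;> linarith

lemma wrap_injective {r r' : ℝ} {u u' : Plane} (h : maxSq r u ≠ 0) (h' : maxSq r' u' ≠ 0)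
    (hEq : wrap r u = wrap r' u') : r ^ 2 * maxSq r u = r' ^ 2 * maxSq r' u' ∧
      slope r u = slope r' u' ∧ SignType.sign (orient r u) = SignType.sign (orient r' u') :=
  (folding_wrap h).pillow_injective (folding_wrap h') hEq

lemma exists_int_of_sin_sq_eq {x x' : ℝ}
    (h : Real.sin (Real.pi * x) ^ 2 = Real.sin (Real.pi * x') ^ 2) :
    ∃ k : ℤ, x' = k + x ∨ x' = k - x := by
  rw [sin_sq_pi_mul, sin_sq_pi_mul] at h
  have h1 : Real.cos (2 * Real.pi * x) = Real.cos (2 * Real.pi * x') := by linarith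
  obtain ⟨k, hk⟩ := Real.cos_eq_cos_iff.1 h1
  have hπ : 2 * Real.pi ≠ 0 := by positivity
  refine ⟨k, hk.imp (fun hk => ?_) fun hk => ?_⟩ <;>
  · apply mul_left_cancel₀ hπ
    rw [hk]
    ring

lemma exists_int_of_sin_eq_zero {x : ℝ} (h : Real.sin (2 * Real.pi * x) = 0) :
    ∃ k : ℤ, 2 * x = k := by
  obtain ⟨k, hk⟩ := Real.sin_eq_zero_iff.1 h
  exact ⟨k, mul_left_cancel₀ Real.pi_ne_zero (by rw [mul_comm _ (k : ℝ), hk]; ring)⟩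

lemma sin_two_pi_add (k : ℤ) (x : ℝ) :
    Real.sin (2 * Real.pi * (k + x)) = Real.sin (2 * Real.pi * x) := by
  rw [show 2 * Real.pi * (k + x) = 2 * Real.pi * x + k * (2 * Real.pi) by ring,
    Real.sin_add_int_mul_two_pi]

lemma sin_two_pi_sub (k : ℤ) (x : ℝ) :
    Real.sin (2 * Real.pi * (k - x)) = -Real.sin (2 * Real.pi * x) := by
  rw [show 2 * Real.pi * (k - x) = k * (2 * Real.pi) - 2 * Real.pi * x by ring,
    Real.sin_int_mul_two_pi_sub]

lemma eq_zero_of_sign_eq_sign_neg {x : ℝ} (h : SignType.sign x = SignType.sign (-x)) : x = 0 := by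
  rw [Left.sign_neg] at h
  rw [← sign_eq_zero_iff]
  rcases (SignType.sign x).trichotomy with h' | h' | h' <;> rw [h'] at h ⊢ <;> simp at h

lemma fold_fibre {v v' : Plane} (h : maxSq 1 v ≠ 0) (h' : maxSq 1 v' ≠ 0)
    (hEq : fold v = fold v') :
    ∃ k l : ℤ, v' = v + ((k : ℝ), (l : ℝ)) ∨ v' = -v + ((k : ℝ), (l : ℝ)) := by
  obtain ⟨h1, h2, h3⟩ := wrap_injective h h' hEq
  rw [one_pow, one_mul, one_mul] at h1
  rw [slope, slope, ← h1, div_left_inj' h, amp_one, amp_one, amp_one, amp_one] at h2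
  rw [maxSq_one, maxSq_one] at h1
  obtain ⟨hx, hy⟩ := eq_and_eq_of_max_eq_of_sub_eq h1 h2
  have h4 : ∀ x : ℝ, SignType.sign (x / 4) = SignType.sign x := fun x => by
    rw [div_eq_mul_inv, sign_mul, sign_pos (by norm_num : (0 : ℝ) < 4⁻¹), mul_one]
  rw [orient_one, orient_one, h4, h4] at h3
  obtain ⟨k, hk⟩ := exists_int_of_sin_sq_eq hx
  obtain ⟨l, hl⟩ := exists_int_of_sin_sq_eq hy
  have hzero : Real.sin (2 * Real.pi * v'.1) * Real.sin (2 * Real.pi * v'.2) =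
      -(Real.sin (2 * Real.pi * v.1) * Real.sin (2 * Real.pi * v.2)) →
      (∃ m : ℤ, 2 * v.1 = m) ∨ ∃ m : ℤ, 2 * v.2 = m := by
    intro h5
    rw [h5] at h3
    rcases mul_eq_zero.1 (eq_zero_of_sign_eq_sign_neg h3) with h6 | h6
    · exact Or.inl (exists_int_of_sin_eq_zero h6)
    · exact Or.inr (exists_int_of_sin_eq_zero h6)
  rcases hk with hk | hk <;> rcases hl with hl | hl
  · exact ⟨k, l, Or.inl (Prod.ext (by simp [hk, add_comm]) (by simp [hl, add_comm]))⟩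
  · rcases hzero (by rw [hk, hl, sin_two_pi_add, sin_two_pi_sub]; ring) with ⟨m, hm⟩ | ⟨m, hm⟩
    · refine ⟨k + m, l, Or.inr (Prod.ext ?_ ?_)⟩ <;> simp <;> linarith
    · refine ⟨k, l - m, Or.inl (Prod.ext ?_ ?_)⟩ <;> simp <;> linarith
  · rcases hzero (by rw [hk, hl, sin_two_pi_add, sin_two_pi_sub]; ring) with ⟨m, hm⟩ | ⟨m, hm⟩
    · refine ⟨k - m, l, Or.inl (Prod.ext ?_ ?_)⟩ <;> simp <;> linarith
    · refine ⟨k, l + m, Or.inr (Prod.ext ?_ ?_)⟩ <;> simp <;> linarith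
  · exact ⟨k, l, Or.inr (Prod.ext (by simp [hk]; ring) (by simp [hl]; ring))⟩

lemma wrap_zero_fibre_of_norm_eq_one {u u' : Plane} (hu : ‖u‖ = 1) (hu' : ‖u'‖ = 1)
    (hEq : wrap 0 u = wrap 0 u') : u' = u ∨ u' = -u := by
  have hm := maxSq_ne_zero_of_le le_rfl (by norm_num) hu
  have hm' := maxSq_ne_zero_of_le le_rfl (by norm_num) hu'
  obtain ⟨-, h2, h3⟩ := wrap_injective hm hm' hEq
  have hmax : ∀ {u : Plane}, ‖u‖ = 1 → max (u.1 ^ 2) (u.2 ^ 2) = 1 := by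
    intro u hu
    rw [Prod.norm_def, Real.norm_eq_abs, Real.norm_eq_abs] at hu
    rw [← sq_abs, ← sq_abs u.2]
    rcases max_cases |u.1| |u.2| with ⟨h, h'⟩ | ⟨h, h'⟩
    · rw [max_eq_left (pow_le_pow_left₀ (abs_nonneg _) h' 2), ← h, hu, one_pow]
    · rw [max_eq_right (pow_le_pow_left₀ (abs_nonneg _) h'.le 2), ← h, hu, one_pow]
  have hsl : ∀ {u : Plane}, ‖u‖ = 1 → slope 0 u = u.1 ^ 2 - u.2 ^ 2 := by
    intro u hu
    rw [slope, maxSq, amp_zero, amp_zero, mul_pow, mul_pow,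
      ← mul_max_of_nonneg _ _ (sq_nonneg Real.pi), hmax hu]
    have := Real.pi_ne_zero
    field_simp
  rw [hsl hu, hsl hu'] at h2
  obtain ⟨hx, hy⟩ := eq_and_eq_of_max_eq_of_sub_eq ((hmax hu).trans (hmax hu').symm) h2
  have hor : ∀ u : Plane, SignType.sign (orient 0 u) = SignType.sign (u.1 * u.2) := by
    intro u
    have : orient 0 u = Real.pi ^ 2 * (u.1 * u.2) := by
      simp only [orient, amp_zero, mul_zero, zero_mul, Real.cos_zero]; ring
    have hπ := Real.pi_pos
    rw [this, sign_mul, sign_pos (by positivity : 0 < Real.pi ^ 2), one_mul]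
  rw [hor, hor] at h3
  have hzero : u'.1 * u'.2 = -(u.1 * u.2) → u.1 = 0 ∨ u.2 = 0 := by
    intro h5
    rw [h5] at h3
    exact mul_eq_zero.1 (eq_zero_of_sign_eq_sign_neg h3)
  rcases sq_eq_sq_iff_eq_or_eq_neg.1 hx.symm with hk | hk <;>
    rcases sq_eq_sq_iff_eq_or_eq_neg.1 hy.symm with hl | hl
  · exact Or.inl (Prod.ext hk hl)
  · rcases hzero (by rw [hk, hl]; ring) with h | h
    · exact Or.inr (Prod.ext (by simp [hk, h]) hl)
    · exact Or.inl (Prod.ext hk (by simp [hl, h]))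
  · rcases hzero (by rw [hk, hl]; ring) with h | h
    · exact Or.inl (Prod.ext (by simp [hk, h]) hl)
    · exact Or.inr (Prod.ext hk (by simp [hl, h]))
  · exact Or.inr (Prod.ext hk hl)

lemma wrap_zero_smul {c : ℝ} (hc : c ≠ 0) (u : Plane) : wrap 0 (c • u) = wrap 0 u := by
  rw [wrap_smul 0 hc, zero_mul]

lemma wrap_zero_dir {u : Plane} (hu : u ≠ 0) : wrap 0 (dir u) = wrap 0 u :=
  wrap_zero_smul (inv_ne_zero (norm_ne_zero_iff.2 hu)) u

/-- A linear map preserving the integer lattice descends to the folding. -/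
lemma wrap_map_eq (B : Plane →ₗ[ℝ] Plane)
    (hB : ∀ k l : ℤ, ∃ k' l' : ℤ, B ((k : ℝ), (l : ℝ)) = ((k' : ℝ), (l' : ℝ)))
    {r r' : ℝ} {u u' : Plane} (h : maxSq r u ≠ 0) (h' : maxSq r' u' ≠ 0)
    (hEq : wrap r u = wrap r' u') : wrap r (B u) = wrap r' (B u') := by
  have hr : r = 0 ↔ r' = 0 := by
    rw [← norm_wrap_eq_one_iff h, ← norm_wrap_eq_one_iff h', hEq]
  by_cases h0 : r = 0
  · have h0' := hr.1 h0
    subst h0 h0'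
    have hu : u ≠ 0 := fun hu => h (maxSq_zero_eq_zero_iff.2 hu)
    have hu' : u' ≠ 0 := fun hu => h' (maxSq_zero_eq_zero_iff.2 hu)
    rw [← wrap_zero_dir hu, ← wrap_zero_dir hu'] at hEq
    have key : ∀ {w : Plane}, w ≠ 0 → wrap 0 (B w) = wrap 0 (B (dir w)) := fun {w} hw => by
      rw [dir, map_smul, wrap_zero_smul (inv_ne_zero (norm_ne_zero_iff.2 hw))]
    rw [key hu, key hu']
    rcases wrap_zero_fibre_of_norm_eq_one (norm_dir hu) (norm_dir hu') hEq with h | h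
    · rw [h]
    · rw [h, map_neg, ← neg_one_smul ℝ, wrap_zero_smul (by norm_num)]
  · have h0' : r' ≠ 0 := fun h => h0 (hr.2 h)
    rw [wrap_eq_fold h0, wrap_eq_fold h0'] at hEq ⊢
    rw [Ne, maxSq_eq_zero_iff_smul h0] at h
    rw [Ne, maxSq_eq_zero_iff_smul h0'] at h'
    obtain ⟨k, l, hkl⟩ := fold_fibre h h' hEq
    obtain ⟨k', l', hB'⟩ := hB k l
    rw [← map_smul, ← map_smul]
    rcases hkl with hkl | hkl
    · rw [hkl, map_add, hB', fold_add_int]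
    · rw [hkl, map_add, hB', fold_add_int, map_neg, fold_neg]

/-! ### The disc homeomorphism induced by a hyperbolic toral automorphism -/

/-- The linear map with matrix `[[2, 1], [1, 1]]`. -/
noncomputable def cat : Plane ≃L[ℝ] Plane :=
  LinearEquiv.toContinuousLinearEquiv
    { toFun := fun v => (2 * v.1 + v.2, v.1 + v.2)
      invFun := fun v => (v.1 - v.2, 2 * v.2 - v.1)
      map_add' := fun v w => by ext <;> simp <;> ring
      map_smul' := fun c v => by ext <;> simp <;> ring
      left_inv := fun v => by ext <;> simp <;> ring
      right_inv := fun v => by ext <;> simp <;> ring }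

lemma cat_apply (v : Plane) : cat v = (2 * v.1 + v.2, v.1 + v.2) := rfl

lemma cat_symm_apply (v : Plane) : cat.symm v = (v.1 - v.2, 2 * v.2 - v.1) := rfl

lemma cat_int (k l : ℤ) : ∃ k' l' : ℤ, cat ((k : ℝ), (l : ℝ)) = ((k' : ℝ), (l' : ℝ)) :=
  ⟨2 * k + l, k + l, by rw [cat_apply]; push_cast; rfl⟩

lemma cat_symm_int (k l : ℤ) :
    ∃ k' l' : ℤ, cat.symm ((k : ℝ), (l : ℝ)) = ((k' : ℝ), (l' : ℝ)) :=
  ⟨k - l, 2 * l - k, by rw [cat_symm_apply]; push_cast; rfl⟩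

lemma maxSq_map_eq_zero {r : ℝ} {u : Plane} (h : maxSq r u = 0) (B : Plane →L[ℝ] Plane)
    (hB : ∀ k l : ℤ, ∃ k' l' : ℤ, B ((k : ℝ), (l : ℝ)) = ((k' : ℝ), (l' : ℝ))) :
    maxSq r (B u) = 0 := by
  by_cases hr : r = 0
  · subst hr
    rw [maxSq_zero_eq_zero_iff] at h ⊢
    rw [h, map_zero]
  · rw [maxSq_eq_zero_iff_smul hr, maxSq_one_eq_zero_iff] at h ⊢
    obtain ⟨k, l, h⟩ := h
    rw [← map_smul, h]
    exact hB k l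

lemma maxSq_cat_ne_zero {r : ℝ} {u : Plane} (h : maxSq r u ≠ 0) : maxSq r (cat u) ≠ 0 :=
  fun h' => h (by
    have := maxSq_map_eq_zero h' cat.symm.toContinuousLinearMap cat_symm_int
    simpa using this)

lemma maxSq_cat_symm_ne_zero {r : ℝ} {u : Plane} (h : maxSq r u ≠ 0) :
    maxSq r (cat.symm u) ≠ 0 :=
  fun h' => h (by
    have := maxSq_map_eq_zero h' cat.toContinuousLinearMap cat_int
    simpa using this)

/-- The map of the disc covered by `cat`. -/
noncomputable def toral (z : Plane) : Plane :=
  wrap (Classical.epsilon fun p : ℝ × Plane => p ∈ polar ∧ wrap p.1 p.2 = z).1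
    (cat (Classical.epsilon fun p : ℝ × Plane => p ∈ polar ∧ wrap p.1 p.2 = z).2)

lemma toral_wrap {r : ℝ} {u : Plane} (h : maxSq r u ≠ 0) :
    toral (wrap r u) = wrap r (cat u) := by
  have hp := Classical.epsilon_spec
    (p := fun p : ℝ × Plane => p ∈ polar ∧ wrap p.1 p.2 = wrap r u)
    (exists_wrap_eq (norm_wrap_le h))
  exact wrap_map_eq cat.toLinearEquiv.toLinearMap cat_int (maxSq_ne_zero_of_mem_polar hp.1) h hp.2

lemma toral_fold {v : Plane} (h : maxSq 1 v ≠ 0) : toral (fold v) = fold (cat v) := toral_wrap h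

lemma mapsTo_toral : MapsTo toral (closedBall 0 1) (closedBall 0 1) := by
  intro z hz
  obtain ⟨p, hp, rfl⟩ := exists_wrap_eq (mem_closedBall_zero_iff.1 hz)
  have h := maxSq_ne_zero_of_mem_polar hp
  rw [toral_wrap h, mem_closedBall_zero_iff]
  exact norm_wrap_le (maxSq_cat_ne_zero h)

lemma bijOn_toral : BijOn toral (closedBall 0 1) (closedBall 0 1) := by
  refine ⟨mapsTo_toral, fun z hz z' hz' h => ?_, fun z hz => ?_⟩
  · obtain ⟨p, hp, rfl⟩ := exists_wrap_eq (mem_closedBall_zero_iff.1 hz)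
    obtain ⟨p', hp', rfl⟩ := exists_wrap_eq (mem_closedBall_zero_iff.1 hz')
    have hm := maxSq_ne_zero_of_mem_polar hp
    have hm' := maxSq_ne_zero_of_mem_polar hp'
    rw [toral_wrap hm, toral_wrap hm'] at h
    have := wrap_map_eq cat.symm.toLinearEquiv.toLinearMap cat_symm_int (maxSq_cat_ne_zero hm)
      (maxSq_cat_ne_zero hm') h
    simpa using this
  · obtain ⟨p, hp, rfl⟩ := exists_wrap_eq (mem_closedBall_zero_iff.1 hz)
    have hm := maxSq_cat_symm_ne_zero (maxSq_ne_zero_of_mem_polar hp)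
    exact ⟨wrap p.1 (cat.symm p.2), mem_closedBall_zero_iff.2 (norm_wrap_le hm), by
      rw [toral_wrap hm, ContinuousLinearEquiv.apply_symm_apply]⟩

lemma continuousOn_wrap_polar : ContinuousOn (fun p : ℝ × Plane => wrap p.1 p.2) polar :=
  fun _ hp => (continuousAt_wrap (maxSq_ne_zero_of_mem_polar hp)).continuousWithinAt

lemma continuousOn_toral : ContinuousOn toral (closedBall 0 1) := by
  rw [continuousOn_iff_isClosed]
  intro t ht
  have hg : ContinuousOn (fun p : ℝ × Plane => wrap p.1 (cat p.2)) polar := by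
    intro p hp
    have h := maxSq_cat_ne_zero (maxSq_ne_zero_of_mem_polar hp)
    exact (ContinuousAt.comp (f := fun p : ℝ × Plane => (p.1, cat p.2))
      (g := fun p : ℝ × Plane => wrap p.1 p.2) (continuousAt_wrap h)
      (by fun_prop)).continuousWithinAt
  set C := polar ∩ (fun p : ℝ × Plane => wrap p.1 (cat p.2)) ⁻¹' t
  have hC : IsCompact C := isCompact_polar.of_isClosed_subset
    (hg.preimage_isClosed_of_isClosed isCompact_polar.isClosed ht) inter_subset_left
  refine ⟨(fun p : ℝ × Plane => wrap p.1 p.2) '' C,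
    (hC.image_of_continuousOn (continuousOn_wrap_polar.mono inter_subset_left)).isClosed, ?_⟩
  ext z
  constructor
  · rintro ⟨hz1, hz2⟩
    obtain ⟨p, hp, rfl⟩ := exists_wrap_eq (mem_closedBall_zero_iff.1 hz2)
    rw [mem_preimage, toral_wrap (maxSq_ne_zero_of_mem_polar hp)] at hz1
    exact ⟨⟨p, ⟨hp, hz1⟩, rfl⟩, hz2⟩
  · rintro ⟨⟨p, ⟨hp, hpt⟩, rfl⟩, hz2⟩
    refine ⟨?_, hz2⟩
    rw [mem_preimage, toral_wrap (maxSq_ne_zero_of_mem_polar hp)]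
    exact hpt

/-! ### Mixing and periodic points -/

lemma maxSq_iterate_cat_ne_zero {v : Plane} (h : maxSq 1 v ≠ 0) (n : ℕ) :
    maxSq 1 (cat^[n] v) ≠ 0 := by
  induction n with
  | zero => exact h
  | succ n ih => rw [Function.iterate_succ_apply']; exact maxSq_cat_ne_zero ih

lemma iterate_toral_fold {v : Plane} (h : maxSq 1 v ≠ 0) (n : ℕ) :
    toral^[n] (fold v) = fold (cat^[n] v) := by
  induction n with
  | zero => rfl
  | succ n ih =>
    rw [Function.iterate_succ_apply', ih, toral_fold (maxSq_iterate_cat_ne_zero h n),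
      Function.iterate_succ_apply']

lemma norm_fold_lt {v : Plane} (h : maxSq 1 v ≠ 0) : ‖fold v‖ < 1 :=
  lt_of_le_of_ne (norm_wrap_le h) fun h' => one_ne_zero ((norm_wrap_eq_one_iff h).1 h')

lemma exists_fold_eq {z : Plane} (hz : ‖z‖ < 1) : ∃ v, maxSq 1 v ≠ 0 ∧ fold v = z := by
  obtain ⟨p, hp, rfl⟩ := exists_wrap_eq hz.le
  have h := maxSq_ne_zero_of_mem_polar hp
  have hr : p.1 ≠ 0 := fun hr => hz.ne ((norm_wrap_eq_one_iff h).2 hr)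
  exact ⟨p.1 • p.2, fun h' => h ((maxSq_eq_zero_iff_smul hr).2 h'), (wrap_eq_fold hr _).symm⟩

lemma continuousAt_fold {v : Plane} (h : maxSq 1 v ≠ 0) : ContinuousAt fold v :=
  ContinuousAt.comp (f := fun v : Plane => ((1 : ℝ), v))
    (g := fun p : ℝ × Plane => wrap p.1 p.2) (continuousAt_wrap h) (by fun_prop)

lemma continuous_maxSq_one : Continuous (maxSq 1) := by
  have : maxSq 1 = fun v : Plane =>
      max (Real.sin (Real.pi * v.1) ^ 2) (Real.sin (Real.pi * v.2) ^ 2) := funext maxSq_one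
  rw [this]
  fun_prop

lemma exists_ball_fold_mem {U : Set Plane} (hU : IsOpen U)
    (hne : (U ∩ closedBall 0 1).Nonempty) :
    ∃ v : Plane, ∃ δ > 0, ∀ w ∈ ball v δ, maxSq 1 w ≠ 0 ∧ fold w ∈ U := by
  obtain ⟨z, hz, hz1⟩ := hne
  rw [← closure_ball (0 : Plane) one_ne_zero] at hz1
  obtain ⟨y, hyU, hy⟩ := mem_closure_iff.1 hz1 U hU hz
  obtain ⟨v, hv, rfl⟩ := exists_fold_eq (mem_ball_zero_iff.1 hy)
  have h1 : ∀ᶠ w in 𝓝 v, maxSq 1 w ≠ 0 := continuous_maxSq_one.continuousAt.eventually_ne hv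
  have h2 : ∀ᶠ w in 𝓝 v, fold w ∈ U := continuousAt_fold hv (hU.mem_nhds hyU)
  obtain ⟨δ, hδ, h⟩ := Metric.eventually_nhds_iff_ball.1 (h1.and h2)
  exact ⟨v, δ, hδ, h⟩

lemma exists_int_mul_near {ξ : ℝ} (hξ : Irrational ξ) {ε : ℝ} (hε : 0 < ε) :
    ∃ J : ℝ, ∀ x : ℝ, ∃ j k : ℤ, |(j : ℝ)| ≤ J ∧ |x + j * ξ - k| < ε := by
  obtain ⟨n, hn⟩ := exists_nat_one_div_lt hε
  obtain ⟨k₀, j₀, hj₀, -, hjk⟩ := Real.exists_int_int_abs_mul_sub_le ξ (Nat.succ_pos n)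
  have hθε : |j₀ * ξ - k₀| < ε := by
    refine (hjk.trans ?_).trans_lt hn
    push_cast
    gcongr
    linarith
  have hθ0 : (j₀ : ℝ) * ξ - k₀ ≠ 0 := fun h =>
    (hξ.intCast_mul hj₀.ne').ne_int k₀ (sub_eq_zero.1 h)
  obtain ⟨j₁, k₁, h0, hlt⟩ : ∃ j k : ℤ, 0 < (j : ℝ) * ξ - k ∧ (j : ℝ) * ξ - k < ε := by
    rcases lt_or_gt_of_ne hθ0 with h | h
    · exact ⟨-j₀, -k₀, by push_cast; linarith, by push_cast; linarith [(abs_lt.1 hθε).1]⟩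
    · exact ⟨j₀, k₀, h, (abs_lt.1 hθε).2⟩
  set θ := (j₁ : ℝ) * ξ - k₁
  refine ⟨|(j₁ : ℝ)| * (1 / θ), fun x => ?_⟩
  have hf0 := Int.fract_nonneg x
  have hf1 := Int.fract_lt_one x
  set i := ⌊(1 - Int.fract x) / θ⌋ with hi
  have hi0 : 0 ≤ i := Int.floor_nonneg.2 (div_nonneg (by linarith) h0.le)
  have hi1 : (i : ℝ) ≤ (1 - Int.fract x) / θ := Int.floor_le _
  have hi2 : (1 - Int.fract x) / θ < i + 1 := Int.lt_floor_add_one _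
  refine ⟨i * j₁, i * k₁ + (⌊x⌋ + 1), ?_, ?_⟩
  · push_cast
    have : (0 : ℝ) ≤ i := by exact_mod_cast hi0
    rw [abs_mul, abs_of_nonneg this, mul_comm]
    refine mul_le_mul_of_nonneg_left (hi1.trans ?_) (abs_nonneg _)
    gcongr
    linarith
  · rw [le_div_iff₀ h0] at hi1
    rw [div_lt_iff₀ h0] at hi2
    have hx := Int.floor_add_fract x
    have : x + ((i * j₁ : ℤ) : ℝ) * ξ - ((i * k₁ + (⌊x⌋ + 1) : ℤ) : ℝ) =
        i * θ - (1 - Int.fract x) := by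
      push_cast
      simp only [θ]
      linear_combination -hx
    rw [this, abs_lt]
    constructor <;> linarith

open Real in
lemma cat_golden :
    cat ((goldenRatio, 1) : Plane) = (goldenRatio ^ 2) • ((goldenRatio, 1) : Plane) := by
  have h := goldenRatio_sq
  rw [cat_apply]
  refine Prod.ext ?_ ?_ <;> simp only [Prod.smul_mk, smul_eq_mul, h]
  · linear_combination -h
  · ring

/-- The lines in the expanding direction are uniformly dense modulo the lattice. -/
lemma exists_expanding_near {ε : ℝ} (hε : 0 < ε) : ∃ C : ℝ, ∀ y : Plane, ∃ t : ℝ, |t| ≤ C ∧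
    ∃ k l : ℤ, ‖y + t • ((Real.goldenRatio, 1) : Plane) - ((k : ℝ), (l : ℝ))‖ < ε := by
  obtain ⟨J, hJ⟩ := exists_int_mul_near Real.goldenRatio_irrational hε
  refine ⟨J + 1, fun y => ?_⟩
  obtain ⟨j, k, hj, hjk⟩ := hJ (y.1 - Int.fract y.2 * Real.goldenRatio)
  have hf0 := Int.fract_nonneg y.2
  have hf1 := Int.fract_lt_one y.2
  refine ⟨j - Int.fract y.2, ?_, k, ⌊y.2⌋ + j, ?_⟩
  · refine (abs_sub _ _).trans (add_le_add hj ?_)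
    rw [abs_of_nonneg hf0]
    exact hf1.le
  · have h2 : y.2 + (j - Int.fract y.2) * 1 - ((⌊y.2⌋ + j : ℤ) : ℝ) = 0 := by
      push_cast
      linear_combination -Int.floor_add_fract y.2
    have h1 : y.1 + (j - Int.fract y.2) * Real.goldenRatio - k =
        y.1 - Int.fract y.2 * Real.goldenRatio + j * Real.goldenRatio - k := by ring
    simp only [Prod.norm_def, Prod.fst_sub, Prod.snd_sub, Prod.fst_add, Prod.snd_add,
      Prod.smul_fst, Prod.smul_snd, smul_eq_mul, h1, h2, norm_zero, Real.norm_eq_abs]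
    exact max_lt hjk hε

lemma iterate_cat_add (n : ℕ) (v : Plane) (t : ℝ) :
    cat^[n] (v + t • ((Real.goldenRatio, 1) : Plane)) =
      cat^[n] v + (t * (Real.goldenRatio ^ 2) ^ n) • ((Real.goldenRatio, 1) : Plane) := by
  induction n with
  | zero => simp
  | succ n ih =>
    rw [Function.iterate_succ_apply', ih, map_add, map_smul, cat_golden,
      Function.iterate_succ_apply', smul_smul, pow_succ _ n, mul_assoc]

lemma toral_mixing {U V : Set Plane} (hU : IsOpen U) (hV : IsOpen V)
    (hU' : (U ∩ closedBall 0 1).Nonempty) (hV' : (V ∩ closedBall 0 1).Nonempty) :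
    ∃ N, ∀ n ≥ N, ∃ x ∈ U ∩ closedBall 0 1, toral^[n] x ∈ V := by
  obtain ⟨v, δ, hδ, hv⟩ := exists_ball_fold_mem hU hU'
  obtain ⟨w, ε, hε, hw⟩ := exists_ball_fold_mem hV hV'
  obtain ⟨C, hC⟩ := exists_expanding_near hε
  set e : Plane := (Real.goldenRatio, 1) with he
  have he0 : 0 < ‖e‖ := norm_pos_iff.2 fun h => one_ne_zero (congrArg Prod.snd h)
  set c := Real.goldenRatio ^ 2 with hc
  have hc1 : 1 < c := by
    rw [hc, Real.goldenRatio_sq]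
    linarith [Real.goldenRatio_pos]
  obtain ⟨N, hN⟩ := (tendsto_pow_atTop_atTop_of_one_lt hc1).eventually_gt_atTop (C * ‖e‖ / δ)
    |>.exists_forall_of_atTop
  refine ⟨N, fun n hn => ?_⟩
  obtain ⟨t, ht, k, l, hkl⟩ := hC (cat^[n] v - w)
  have hcn : 0 < c ^ n := pow_pos (by linarith) n
  set v' := v + (t / c ^ n) • e with hv'
  have hv'mem : v' ∈ ball v δ := by
    rw [mem_ball_iff_norm, hv', add_sub_cancel_left, norm_smul, norm_div, Real.norm_of_nonneg hcn.le,
      Real.norm_eq_abs, div_mul_eq_mul_div, div_lt_iff₀ hcn]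
    have h1 := hN n hn
    rw [div_lt_iff₀ hδ] at h1
    nlinarith
  obtain ⟨h1, h2⟩ := hv v' hv'mem
  refine ⟨fold v', ⟨h2, mem_closedBall_zero_iff.2 (norm_fold_lt h1).le⟩, ?_⟩
  rw [iterate_toral_fold h1, hv', iterate_cat_add, div_mul_cancel₀ _ hcn.ne']
  rw [← sub_add_cancel (cat^[n] v + t • e) ((k : ℝ), (l : ℝ)), fold_add_int]
  refine (hw _ ?_).2
  rw [mem_ball_iff_norm]
  convert hkl using 1
  congr 1
  abel

lemma exists_isPeriodic_of_finite {X : Type*} {f : X → X} {s t : Set X} (ht : t.Finite)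
    (hf : InjOn f s) (hs : MapsTo f s s) {x : X} (hx : x ∈ s) (h : ∀ n, f^[n] x ∈ t) :
    ∃ n ≥ 1, f^[n] x = x := by
  obtain ⟨i, j, hij, hEq⟩ : ∃ i j : ℕ, i < j ∧ f^[i] x = f^[j] x := by
    have hni : ¬ Function.Injective fun n : ℕ => f^[n] x := fun hi =>
      infinite_univ ((ht.preimage hi.injOn).subset fun n _ => h n)
    simp only [Function.Injective, not_forall] at hni
    obtain ⟨i, j, h1, h2⟩ := hni
    rcases lt_or_gt_of_ne h2 with h3 | h3
    · exact ⟨i, j, h3, h1⟩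
    · exact ⟨j, i, h3, h1.symm⟩
  refine ⟨j - i, by omega, ?_⟩
  have hinj : InjOn f^[i] s := hf.iterate hs i
  refine hinj (hs.iterate _ hx) hx ?_
  rw [← Function.iterate_add_apply, show i + (j - i) = j by omega, hEq]

lemma exists_periodic_fold_rat (a b q : ℤ) (hq : 0 < q)
    (h : maxSq 1 ((a / q, b / q) : Plane) ≠ 0) :
    ∃ n ≥ 1, toral^[n] (fold ((a / q, b / q) : Plane)) = fold ((a / q, b / q) : Plane) := by
  have hq' : (q : ℝ) ≠ 0 := by exact_mod_cast hq.ne'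
  set t : Set Plane := (fun p : ℤ × ℤ => fold ((p.1 / q, p.2 / q) : Plane)) ''
    (Ico 0 q ×ˢ Ico 0 q) with ht
  have hall : ∀ a b : ℤ, fold ((a / q, b / q) : Plane) ∈ t := by
    intro a b
    refine ⟨(a % q, b % q), ⟨⟨Int.emod_nonneg _ hq.ne', Int.emod_lt_of_pos _ hq⟩,
      Int.emod_nonneg _ hq.ne', Int.emod_lt_of_pos _ hq⟩, ?_⟩
    have key : ∀ a : ℤ, (a : ℝ) / q = ((a % q : ℤ) : ℝ) / q + ((a / q : ℤ) : ℝ) := fun a => by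
      have : (a : ℝ) = ((a % q : ℤ) : ℝ) + q * ((a / q : ℤ) : ℝ) := by
        exact_mod_cast (Int.emod_add_mul_ediv a q).symm
      conv_lhs => rw [this]
      field_simp
    rw [key a, key b]
    exact (fold_add_int ((((a % q : ℤ) : ℝ) / q, ((b % q : ℤ) : ℝ) / q) : Plane) _ _).symm
  refine exists_isPeriodic_of_finite (t := t)
    (((finite_Ico 0 q).prod (finite_Ico 0 q)).image _) bijOn_toral.injOn mapsTo_toral
    (mem_closedBall_zero_iff.2 (norm_fold_lt h).le) fun n => ?_
  rw [iterate_toral_fold h]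
  have hit : ∀ n : ℕ, ∃ a' b' : ℤ, cat^[n] ((a / q, b / q) : Plane) =
      ((a' / q, b' / q) : Plane) := by
    intro n
    induction n with
    | zero => exact ⟨a, b, rfl⟩
    | succ n ih =>
      obtain ⟨a', b', ih⟩ := ih
      refine ⟨2 * a' + b', a' + b', ?_⟩
      rw [Function.iterate_succ_apply', ih, cat_apply]
      push_cast
      refine Prod.ext ?_ ?_ <;> simp only <;> ring
  obtain ⟨a', b', h'⟩ := hit n
  rw [h']
  exact hall a' b'

lemma exists_rat_near (x : ℝ) {δ : ℝ} (hδ : 0 < δ) : ∃ q : ℚ, |(q : ℝ) - x| < δ := by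
  obtain ⟨q, h1, h2⟩ := exists_rat_btwn (show x - δ < x + δ by linarith)
  exact ⟨q, abs_lt.2 ⟨by linarith, by linarith⟩⟩

lemma exists_periodic_mem {U : Set Plane} (hU : IsOpen U) (hne : (U ∩ closedBall 0 1).Nonempty) :
    ∃ q₁ q₂ : ℚ, maxSq 1 ((q₁, q₂) : Plane) ≠ 0 ∧ fold ((q₁, q₂) : Plane) ∈ U ∧
      ∃ n ≥ 1, toral^[n] (fold ((q₁, q₂) : Plane)) = fold ((q₁, q₂) : Plane) := by
  obtain ⟨v, δ, hδ, hv⟩ := exists_ball_fold_mem hU hne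
  obtain ⟨q₁, h1⟩ := exists_rat_near v.1 hδ
  obtain ⟨q₂, h2⟩ := exists_rat_near v.2 hδ
  obtain ⟨h3, h4⟩ := hv (q₁, q₂) (by
    rw [mem_ball_iff_norm, Prod.norm_def]
    exact max_lt h1 h2)
  refine ⟨q₁, q₂, h3, h4, ?_⟩
  have e1 : (q₁ : ℝ) = ((q₁.num * q₂.den : ℤ) : ℝ) / ((q₁.den * q₂.den : ℤ) : ℝ) := by
    have : (q₂.den : ℝ) ≠ 0 := by exact_mod_cast q₂.den_ne_zero
    push_cast
    rw [mul_div_mul_right _ _ this, Rat.cast_def]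
  have e2 : (q₂ : ℝ) = ((q₁.den * q₂.num : ℤ) : ℝ) / ((q₁.den * q₂.den : ℤ) : ℝ) := by
    have : (q₁.den : ℝ) ≠ 0 := by exact_mod_cast q₁.den_ne_zero
    push_cast
    rw [mul_div_mul_left _ _ this, Rat.cast_def]
  rw [e1, e2] at h3 ⊢
  exact exists_periodic_fold_rat _ _ _
    (by exact_mod_cast Nat.mul_pos q₁.den_pos q₂.den_pos) h3

/-! ### A boundary fixed point with small local unstable set -/

/-- A vector in the contracting direction of `cat`. -/
noncomputable def contracting : Plane := (1, -Real.goldenRatio)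

lemma cat_symm_contracting : cat.symm contracting = (Real.goldenRatio ^ 2) • contracting := by
  have h := Real.goldenRatio_sq
  rw [cat_symm_apply, contracting]
  refine Prod.ext ?_ ?_ <;> simp only [Prod.smul_mk, smul_eq_mul, h]
  · ring
  · linear_combination h

lemma contracting_ne_zero : contracting ≠ 0 := fun h => one_ne_zero (congrArg Prod.fst h)

lemma norm_cat_symm_le (v : Plane) : ‖cat.symm v‖ ≤ 3 * ‖v‖ := by
  have h1 : |v.1| ≤ ‖v‖ := norm_fst_le v
  have h2 : |v.2| ≤ ‖v‖ := norm_snd_le v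
  rw [abs_le] at h1 h2
  rw [cat_symm_apply, Prod.norm_def]
  refine max_le ?_ ?_ <;> rw [Real.norm_eq_abs, abs_le] <;> constructor <;> linarith

lemma norm_wrap_zero {u : Plane} (hu : u ≠ 0) : ‖wrap 0 u‖ = 1 :=
  (norm_wrap_eq_one_iff (fun h => hu (maxSq_zero_eq_zero_iff.1 h))).2 rfl

lemma toral_boundary_fixed : toral (wrap 0 contracting) = wrap 0 contracting := by
  have hc := contracting_ne_zero
  have hφ : Real.goldenRatio ^ 2 ≠ 0 := pow_ne_zero _ Real.goldenRatio_pos.ne'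
  have h1 : cat contracting = (Real.goldenRatio ^ 2)⁻¹ • contracting := by
    rw [eq_inv_smul_iff₀ hφ, ← map_smul, ← cat_symm_contracting,
      ContinuousLinearEquiv.apply_symm_apply]
  rw [toral_wrap fun h => hc (maxSq_zero_eq_zero_iff.1 h), h1, wrap_zero_smul (inv_ne_zero hφ)]

lemma two_lt_norm_cat_symm_dir_contracting : 2 < ‖cat.symm (dir contracting)‖ := by
  have hc := contracting_ne_zero
  rw [dir, map_smul, cat_symm_contracting, smul_comm, norm_smul, ← dir, norm_dir hc, mul_one,
    Real.goldenRatio_sq, Real.norm_of_nonneg (by linarith [Real.one_lt_goldenRatio])]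
  linarith [Real.one_lt_goldenRatio]

lemma exists_backward_trap : ∃ W : Set Plane, IsOpen W ∧ wrap 0 contracting ∈ W ∧
    ∀ x : ℕ → Plane, (∀ n, x n ∈ closedBall 0 1 ∩ W) → (∀ n, toral (x (n + 1)) = x n) →
      x 0 ∈ sphere 0 1 := by
  set C : Set (ℝ × Plane) := polar ∩ {p | 1 / 8 ≤ p.1 ∨ ‖cat.symm p.2‖ ≤ 2} with hC
  have hCc : IsCompact C := isCompact_polar.inter_right
    ((isClosed_le continuous_const continuous_fst).union
      (isClosed_le (f := fun p : ℝ × Plane => ‖cat.symm p.2‖) (by fun_prop) continuous_const))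
  have hcl : IsClosed ((fun p : ℝ × Plane => wrap p.1 p.2) '' C) :=
    (hCc.image_of_continuousOn (continuousOn_wrap_polar.mono inter_subset_left)).isClosed
  refine ⟨_, hcl.isOpen_compl, ?_, fun x hx hxf => ?_⟩
  · rintro ⟨p, ⟨hp, hp'⟩, hEq⟩
    have hc := contracting_ne_zero
    have h0 : p.1 = 0 := by
      rw [← norm_wrap_eq_one_iff (maxSq_ne_zero_of_mem_polar hp)]
      exact (congrArg norm hEq).trans (norm_wrap_zero hc)
    have hu := mem_sphere_zero_iff_norm.1 hp.2
    rcases hp' with h | h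
    · rw [h0] at h
      norm_num at h
    · simp only [h0] at hEq
      rw [← wrap_zero_dir hc] at hEq
      refine absurd h (not_le.2 ?_)
      rcases wrap_zero_fibre_of_norm_eq_one hu (norm_dir hc) hEq with h | h
      · rw [← h]
        exact two_lt_norm_cat_symm_dir_contracting
      · rw [← norm_neg, ← map_neg, ← h]
        exact two_lt_norm_cat_symm_dir_contracting
  · by_contra hx0
    have hlt : ‖x 0‖ < 1 := lt_of_le_of_ne (mem_closedBall_zero_iff.1 (hx 0).1)
      fun h => hx0 (mem_sphere_zero_iff_norm.2 h)
    have step : ∀ n v, v ≠ 0 → ‖v‖ ≤ 1 / 2 → x n = fold v →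
        ‖v‖ < 1 / 8 ∧ 2 * ‖v‖ < ‖cat.symm v‖ := by
      intro n v hv0 hv hxn
      have h1 := (hx n).2
      rw [hxn, ← wrap_norm_dir hv0] at h1
      have h2 : ¬ (1 / 8 ≤ ‖v‖ ∨ ‖cat.symm (dir v)‖ ≤ 2) := fun h =>
        h1 ⟨_, ⟨mem_polar_of_norm_le hv0 hv, h⟩, rfl⟩
      push Not at h2
      refine ⟨h2.1, ?_⟩
      have h3 := h2.2
      rw [dir, map_smul, norm_smul, norm_inv, norm_norm, inv_mul_eq_div,
        lt_div_iff₀ (norm_pos_iff.2 hv0)] at h3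
      exact h3
    obtain ⟨p, hp, hpx⟩ := exists_wrap_eq hlt.le
    have hr : p.1 ≠ 0 := fun h => hlt.ne
      (hpx ▸ (norm_wrap_eq_one_iff (maxSq_ne_zero_of_mem_polar hp)).2 h)
    have hr0 : 0 < p.1 := lt_of_le_of_ne hp.1.1 hr.symm
    have hnorm : ‖p.1 • p.2‖ = p.1 := by
      rw [norm_smul, mem_sphere_zero_iff_norm.1 hp.2, mul_one, Real.norm_of_nonneg hr0.le]
    have main : ∀ n : ℕ, ∃ v, 2 ^ n * p.1 ≤ ‖v‖ ∧ ‖v‖ ≤ 1 / 2 ∧ x n = fold v := by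
      intro n
      induction n with
      | zero =>
        exact ⟨p.1 • p.2, by rw [hnorm]; simp, by rw [hnorm]; exact hp.1.2,
          by rw [← hpx, wrap_eq_fold hr]⟩
      | succ n ih =>
        obtain ⟨v, h1, h2, h3⟩ := ih
        have hvpos : 0 < ‖v‖ := lt_of_lt_of_le (by positivity) h1
        obtain ⟨h4, h5⟩ := step n v (norm_pos_iff.1 hvpos) h2 h3
        have h6 := norm_cat_symm_le v
        have h7 : ‖cat.symm v‖ ≤ 1 / 2 := by linarith
        have hne : cat.symm v ≠ 0 := norm_pos_iff.1 (by linarith)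
        have hm : maxSq 1 (cat.symm v) ≠ 0 := by
          have := maxSq_ne_zero_of_mem_polar (mem_polar_of_norm_le hne h7)
          rwa [Ne, maxSq_eq_zero_iff_smul (norm_ne_zero_iff.2 hne), norm_smul_dir] at this
        refine ⟨cat.symm v, by rw [pow_succ]; linarith, h7, ?_⟩
        refine bijOn_toral.injOn (hx (n + 1)).1
          (mem_closedBall_zero_iff.2 (norm_fold_lt hm).le) ?_
        rw [hxf, h3, toral_fold hm, ContinuousLinearEquiv.apply_symm_apply]
    obtain ⟨n, hn⟩ := pow_unbounded_of_one_lt (1 / p.1) (one_lt_two (α := ℝ))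
    obtain ⟨v, h1, h2, -⟩ := main n
    rw [div_lt_iff₀ hr0] at hn
    linarith

/-! ### An invariant countable dense set of irrational points -/

/-- Points with algebraic coordinates satisfying no integral affine relation. -/
def irrat : Set Plane := {v | IsAlgebraic ℚ v.1 ∧ IsAlgebraic ℚ v.2 ∧
  ∀ m n k : ℤ, (m : ℝ) * v.1 + n * v.2 = k → m = 0 ∧ n = 0}

lemma countable_irrat : irrat.Countable := by
  have h : {x : ℝ | IsAlgebraic ℚ x}.Countable := Algebraic.countable ℚ ℝ
  exact (h.prod h).mono fun v hv => mem_prod.2 ⟨hv.1, hv.2.1⟩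

lemma maxSq_ne_zero_of_mem_irrat {v : Plane} (hv : v ∈ irrat) : maxSq 1 v ≠ 0 := by
  rw [Ne, maxSq_one_eq_zero_iff]
  rintro ⟨k, l, rfl⟩
  exact one_ne_zero (hv.2.2 1 0 k (by simp)).1

lemma cat_mem_irrat {v : Plane} (hv : v ∈ irrat) : cat v ∈ irrat := by
  obtain ⟨h1, h2, h3⟩ := hv
  rw [cat_apply]
  refine ⟨((isAlgebraic_natCast 2).mul h1).add h2, h1.add h2, fun m n k h => ?_⟩
  have := h3 (2 * m + n) (m + n) k (by push_cast; simp only at h; linarith)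
  omega

lemma cat_symm_mem_irrat {v : Plane} (hv : v ∈ irrat) : cat.symm v ∈ irrat := by
  obtain ⟨h1, h2, h3⟩ := hv
  rw [cat_symm_apply]
  refine ⟨h1.sub h2, ((isAlgebraic_natCast 2).mul h2).sub h1, fun m n k h => ?_⟩
  have := h3 (m - n) (2 * n - m) k (by push_cast; simp only at h; linarith)
  omega

lemma irrational_sqrt_six : Irrational √6 := by
  rw [show (6 : ℝ) = ((6 : ℕ) : ℝ) by norm_num, irrational_sqrt_natCast_iff]
  rintro ⟨k, hk⟩
  have : k < 3 := by nlinarith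
  interval_cases k <;> omega

lemma irrational_sqrt_three : Irrational √3 := by
  simpa using Nat.prime_three.irrational_sqrt

lemma sqrt_mem_irrat : ((√2, √3) : Plane) ∈ irrat := by
  have halg : ∀ n : ℕ, IsAlgebraic ℚ √(n : ℝ) := fun n => by
    refine IsAlgebraic.of_pow two_pos ?_
    rw [Real.sq_sqrt (Nat.cast_nonneg n)]
    exact isAlgebraic_natCast n
  refine ⟨by simpa using halg 2, by simpa using halg 3, fun m n k h => ?_⟩
  simp only at h
  have h2 : √2 ^ 2 = (2 : ℝ) := Real.sq_sqrt (by norm_num)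
  have h3 : √3 ^ 2 = (3 : ℝ) := Real.sq_sqrt (by norm_num)
  have h6 : √2 * √3 = (√6 : ℝ) := by
    rw [← Real.sqrt_mul (by norm_num)]; norm_num
  have hsq : ((2 * m * n : ℤ) : ℝ) * √6 = ((k ^ 2 - 2 * m ^ 2 - 3 * n ^ 2 : ℤ) : ℝ) := by
    push_cast
    rw [← h6, ← h]
    linear_combination -(m : ℝ) ^ 2 * h2 - (n : ℝ) ^ 2 * h3
  have hmn : 2 * m * n = 0 := by
    by_contra hne
    exact (irrational_sqrt_six.intCast_mul hne).ne_int _ hsq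
  have key : ∀ {ξ : ℝ} {m : ℤ}, Irrational ξ → (m : ℝ) * ξ = k → m = 0 := fun hξ he => by
    by_contra hne
    exact (hξ.intCast_mul hne).ne_int _ he
  rcases mul_eq_zero.1 hmn with hm | hn
  · have hm : m = 0 := by omega
    subst hm
    exact ⟨rfl, key irrational_sqrt_three (by simpa using h)⟩
  · subst hn
    exact ⟨key irrational_sqrt_two (by simpa using h), rfl⟩

lemma add_rat_mem_irrat {v : Plane} (hv : v ∈ irrat) (q₁ q₂ : ℚ) :
    v + ((q₁ : ℝ), (q₂ : ℝ)) ∈ irrat := by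
  obtain ⟨h1, h2, h3⟩ := hv
  have hq : ∀ q : ℚ, IsAlgebraic ℚ (q : ℝ) := fun q => isAlgebraic_algebraMap q
  refine ⟨h1.add (hq _), h2.add (hq _), fun m n k h => ?_⟩
  have hd1 : (q₁.den : ℝ) ≠ 0 := by exact_mod_cast q₁.den_ne_zero
  have hd2 : (q₂.den : ℝ) ≠ 0 := by exact_mod_cast q₂.den_ne_zero
  have e1 : (q₁ : ℝ) * q₁.den = q₁.num := by
    rw [Rat.cast_def, div_mul_cancel₀ _ hd1]
  have e2 : (q₂ : ℝ) * q₂.den = q₂.num := by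
    rw [Rat.cast_def, div_mul_cancel₀ _ hd2]
  simp only [Prod.fst_add, Prod.snd_add] at h
  obtain ⟨h4, h5⟩ := h3 (m * q₁.den * q₂.den) (n * q₁.den * q₂.den)
    (k * q₁.den * q₂.den - m * q₁.num * q₂.den - n * q₂.num * q₁.den) (by
      push_cast
      linear_combination (q₁.den * q₂.den : ℝ) * h - (m * q₂.den : ℝ) * e1
        - (n * q₁.den : ℝ) * e2)
  have hz1 : (q₁.den : ℤ) ≠ 0 := by exact_mod_cast q₁.den_ne_zero
  have hz2 : (q₂.den : ℤ) ≠ 0 := by exact_mod_cast q₂.den_ne_zero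
  simp only [mul_eq_zero, hz1, hz2, or_false] at h4 h5
  exact ⟨h4, h5⟩

lemma exists_irrat_mem_ball (v : Plane) {δ : ℝ} (hδ : 0 < δ) : ∃ w ∈ irrat, w ∈ ball v δ := by
  obtain ⟨q₁, h1⟩ := exists_rat_near (v.1 - √2) hδ
  obtain ⟨q₂, h2⟩ := exists_rat_near (v.2 - √3) hδ
  refine ⟨_, add_rat_mem_irrat sqrt_mem_irrat q₁ q₂, ?_⟩
  rw [mem_ball_iff_norm, Prod.norm_def]
  refine max_lt ?_ ?_
  · rwa [Real.norm_eq_abs, show (((√2, √3) : Plane) + ((q₁ : ℝ), (q₂ : ℝ)) - v).1 =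
      q₁ - (v.1 - √2) by simp; ring]
  · rwa [Real.norm_eq_abs, show (((√2, √3) : Plane) + ((q₁ : ℝ), (q₂ : ℝ)) - v).2 =
      q₂ - (v.2 - √3) by simp; ring]

lemma fold_image_irrat_subset : fold '' irrat ⊆ ball 0 1 := by
  rintro _ ⟨v, hv, rfl⟩
  exact mem_ball_zero_iff.2 (norm_fold_lt (maxSq_ne_zero_of_mem_irrat hv))

lemma ball_subset_closure_fold_irrat : ball 0 1 ⊆ closure (fold '' irrat) := by
  intro z hz
  rw [_root_.mem_closure_iff]
  intro U hU hzU
  obtain ⟨v, δ, hδ, hv⟩ := exists_ball_fold_mem hU ⟨z, hzU, ball_subset_closedBall hz⟩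
  obtain ⟨w, hw, hwv⟩ := exists_irrat_mem_ball v hδ
  exact ⟨fold w, (hv w hwv).2, w, hw, rfl⟩

lemma toral_image_fold_irrat : toral '' (fold '' irrat) = fold '' irrat := by
  ext z
  constructor
  · rintro ⟨_, ⟨v, hv, rfl⟩, rfl⟩
    exact ⟨cat v, cat_mem_irrat hv, (toral_fold (maxSq_ne_zero_of_mem_irrat hv)).symm⟩
  · rintro ⟨v, hv, rfl⟩
    have h := cat_symm_mem_irrat hv
    exact ⟨_, ⟨_, h, rfl⟩, by
      rw [toral_fold (maxSq_ne_zero_of_mem_irrat h), ContinuousLinearEquiv.apply_symm_apply]⟩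

lemma fold_rat_notMem {q₁ q₂ : ℚ} (h : maxSq 1 ((q₁, q₂) : Plane) ≠ 0) :
    fold ((q₁, q₂) : Plane) ∉ fold '' irrat := by
  rintro ⟨v, hv, hEq⟩
  have hne : ∀ q : ℚ, v.1 ≠ q := fun q hq => by
    have := hv.2.2 q.den 0 q.num (by
      have hd : (q.den : ℝ) ≠ 0 := by exact_mod_cast q.den_ne_zero
      rw [hq]
      push_cast
      rw [Rat.cast_def, mul_div_cancel₀ _ hd]
      ring)
    exact q.den_ne_zero (by exact_mod_cast this.1)
  obtain ⟨k, l, h' | h'⟩ := fold_fibre h (maxSq_ne_zero_of_mem_irrat hv) hEq.symm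
  · exact hne (q₁ + k) (by rw [h']; simp)
  · exact hne (-q₁ + k) (by rw [h']; simp)

/-! ### Differentiability of the disc homeomorphism at the irrational points -/

lemma swap_mem_irrat {v : Plane} (hv : v ∈ irrat) : v.swap ∈ irrat :=
  ⟨hv.2.1, hv.1, fun m n k h => (hv.2.2 n m k (by rw [← h, add_comm]; rfl)).symm⟩

lemma pillow_neg_slope (M t : ℝ) (σ : SignType) :
    pillow M (-t) σ = -(pillow M t σ).swap := by
  simp only [pillow, abs_neg, Prod.swap_prod_mk, Prod.neg_mk]
  refine Prod.ext ?_ ?_ <;> simp only <;> ring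

lemma fold_swap (v : Plane) : fold v = -(fold v.swap).swap := by
  rw [fold_eq v.swap, ← pillow_neg_slope, fold_eq]
  simp only [Prod.fst_swap, Prod.snd_swap]
  rw [max_comm, mul_comm (Real.sin (2 * Real.pi * v.1)), ← neg_div, neg_sub]

lemma sin_two_mul_ne_zero_of_mem_irrat {v : Plane} (hv : v ∈ irrat) :
    Real.sin (2 * Real.pi * v.1) ≠ 0 := by
  intro h
  obtain ⟨k, hk⟩ := exists_int_of_sin_eq_zero h
  exact two_ne_zero (hv.2.2 2 0 k (by push_cast; linarith)).1

lemma sin_two_mul_snd_ne_zero_of_mem_irrat {v : Plane} (hv : v ∈ irrat) :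
    Real.sin (2 * Real.pi * v.2) ≠ 0 := by
  intro h
  obtain ⟨k, hk⟩ := exists_int_of_sin_eq_zero h
  exact two_ne_zero (hv.2.2 0 2 k (by push_cast; linarith)).2

lemma sin_sq_ne_of_mem_irrat {v : Plane} (hv : v ∈ irrat) :
    Real.sin (Real.pi * v.1) ^ 2 ≠ Real.sin (Real.pi * v.2) ^ 2 := by
  intro h
  obtain ⟨k, hk | hk⟩ := exists_int_of_sin_sq_eq h
  · exact one_ne_zero (hv.2.2 (-1) 1 k (by push_cast; linarith)).2
  · exact one_ne_zero (hv.2.2 1 1 k (by push_cast; linarith)).2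

lemma hasStrictDerivAt_sin_sq (x : ℝ) : HasStrictDerivAt (fun x => Real.sin (Real.pi * x) ^ 2)
    (Real.pi * Real.sin (2 * Real.pi * x)) x := by
  have h1 : HasStrictDerivAt (fun x => Real.pi * x) Real.pi x := by
    simpa using (hasStrictDerivAt_id x).const_mul Real.pi
  have h2 := ((Real.hasStrictDerivAt_sin (Real.pi * x)).comp x h1).pow 2
  have h3 : ((2 : ℕ) : ℝ) * (Real.sin ∘ fun x => Real.pi * x) x ^ (2 - 1) *
      (Real.cos (Real.pi * x) * Real.pi) = Real.pi * Real.sin (2 * Real.pi * x) := by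
    rw [mul_assoc 2, Real.sin_two_mul]
    simp
    ring
  rw [← h3]
  exact h2

/-- The folding in the coordinates `(s, q)`, where `s` is the larger squared sine and `q` the
quotient of the squared sines. -/
noncomputable def quotientChart (σ : ℝ) (p : Plane) : Plane :=
  ((1 - p.2) * (1 - p.1 / 2) + σ * (p.2 * (1 - p.1)),
    (1 - p.2) * (1 - p.1 / 2) - σ * (p.2 * (1 - p.1)))

open ContinuousLinearMap in
lemma exists_hasStrictFDerivAt_quotientChart {σ : ℝ} (hσ : σ ≠ 0) {p : Plane}
    (hs0 : 0 < p.1) (hs1 : p.1 < 1) (hq0 : 0 < p.2) (hq1 : p.2 < 1) :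
    ∃ L : Plane →L[ℝ] Plane, HasStrictFDerivAt (quotientChart σ) L p ∧ Function.Injective L := by
  have d1 : HasStrictFDerivAt (fun p : Plane => p.1) (fst ℝ ℝ ℝ) p := hasStrictFDerivAt_fst
  have d2 : HasStrictFDerivAt (fun p : Plane => p.2) (snd ℝ ℝ ℝ) p := hasStrictFDerivAt_snd
  obtain ⟨X', hX, hX'⟩ : ∃ X' : Plane →L[ℝ] ℝ,
      HasStrictFDerivAt (fun p : Plane => (1 - p.2) * (1 - p.1 / 2)) X' p ∧
      ∀ w : Plane, X' w = -((1 - p.1 / 2) * w.2) - (1 - p.2) / 2 * w.1 := by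
    refine ⟨_, (d2.const_sub 1).mul ((d1.mul_const (1 / 2)).const_sub 1) |>.congr_of_eventuallyEq
      (Eventually.of_forall fun w => by simp [div_eq_mul_inv]), fun w => ?_⟩
    simp
    ring
  obtain ⟨Y', hY, hY'⟩ : ∃ Y' : Plane →L[ℝ] ℝ,
      HasStrictFDerivAt (fun p : Plane => σ * (p.2 * (1 - p.1))) Y' p ∧
      ∀ w : Plane, Y' w = σ * ((1 - p.1) * w.2 - p.2 * w.1) := by
    refine ⟨_, (d2.mul (d1.const_sub 1)).const_mul σ, fun w => ?_⟩
    simp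
    ring
  refine ⟨_, (hX.add hY).prodMk (hX.sub hY), ?_⟩
  rw [injective_iff_map_eq_zero]
  intro w hw
  have e1 : X' w + Y' w = 0 := congrArg Prod.fst hw
  have e2 : X' w - Y' w = 0 := congrArg Prod.snd hw
  have e3 : X' w = 0 := by linarith
  have e4 : Y' w = 0 := by linarith
  rw [hX'] at e3
  rw [hY', mul_eq_zero, or_iff_right hσ] at e4
  have e5 : ((1 - p.2) / 2 * (1 - p.1) + p.2 * (1 - p.1 / 2)) * w.1 = 0 := by
    linear_combination -(1 - p.1) * e3 - (1 - p.1 / 2) * e4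
  have hdet : (1 - p.2) / 2 * (1 - p.1) + p.2 * (1 - p.1 / 2) ≠ 0 := by
    have h1 : 0 < 1 - p.2 := by linarith
    have h2 : 0 < 1 - p.1 := by linarith
    have h3 : 0 < 1 - p.1 / 2 := by linarith
    positivity
  have e6 : w.1 = 0 := (mul_eq_zero.1 e5).resolve_left hdet
  rw [e6, mul_zero, sub_zero, mul_eq_zero] at e4
  exact Prod.ext e6 (e4.resolve_left (by linarith))

open ContinuousLinearMap in
lemma exists_hasStrictFDerivAt_quotient {S R : ℝ → ℝ} {a b : ℝ} {v : Plane}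
    (hS : HasStrictDerivAt S a v.1) (hR : HasStrictDerivAt R b v.2) (hS0 : S v.1 ≠ 0)
    (ha : a ≠ 0) (hb : b ≠ 0) :
    ∃ L : Plane →L[ℝ] Plane, HasStrictFDerivAt (fun w : Plane => (S w.1, R w.2 / S w.1)) L v ∧
      Function.Injective L := by
  have d1 : HasStrictFDerivAt (fun w : Plane => S w.1) (a • fst ℝ ℝ ℝ) v :=
    hS.comp_hasStrictFDerivAt v hasStrictFDerivAt_fst
  have d2 : HasStrictFDerivAt (fun w : Plane => R w.2) (b • snd ℝ ℝ ℝ) v :=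
    hR.comp_hasStrictFDerivAt v hasStrictFDerivAt_snd
  have d3 := d2.mul ((hasStrictDerivAt_inv hS0).comp_hasStrictFDerivAt v d1)
  refine ⟨_, d1.prodMk (d3.congr_of_eventuallyEq (Eventually.of_forall fun w => ?_)), ?_⟩
  · simp [div_eq_mul_inv]
  rw [injective_iff_map_eq_zero]
  intro w hw
  have e1 : a * w.1 = 0 := congrArg Prod.fst hw
  have e2 := congrArg Prod.snd hw
  have e3 : w.1 = 0 := (mul_eq_zero.1 e1).resolve_left ha
  refine Prod.ext e3 ?_
  simpa [e3, hS0, hb] using e2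

/-- The square of `sin (π x)`. -/
noncomputable def sinSq (x : ℝ) : ℝ := Real.sin (Real.pi * x) ^ 2

lemma continuous_sinSq : Continuous sinSq := by unfold sinSq; fun_prop

lemma hasStrictDerivAt_sinSq (x : ℝ) :
    HasStrictDerivAt sinSq (Real.pi * Real.sin (2 * Real.pi * x)) x :=
  hasStrictDerivAt_sin_sq x

lemma sinSq_pos {x : ℝ} (hx : Real.sin (2 * Real.pi * x) ≠ 0) : 0 < sinSq x := by
  refine lt_of_le_of_ne (sq_nonneg _) fun h => hx ?_
  rw [mul_assoc, Real.sin_two_mul, pow_eq_zero_iff two_ne_zero |>.1 h.symm]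
  ring

lemma sinSq_lt_one {x : ℝ} (hx : Real.sin (2 * Real.pi * x) ≠ 0) : sinSq x < 1 := by
  refine lt_of_le_of_ne (Real.sin_sq_le_one _) fun h => hx ?_
  have hc : Real.cos (Real.pi * x) ^ 2 = 0 := by
    rw [Real.cos_sq']
    exact sub_eq_zero.2 h.symm
  rw [mul_assoc, Real.sin_two_mul, pow_eq_zero_iff two_ne_zero |>.1 hc]
  ring

lemma fold_eventuallyEq_quotientChart {v : Plane} (hlt : sinSq v.2 < sinSq v.1)
    (h0 : Real.sin (2 * Real.pi * v.1) * Real.sin (2 * Real.pi * v.2) ≠ 0) :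
    fold =ᶠ[𝓝 v] quotientChart (SignType.sign (Real.sin (2 * Real.pi * v.1) *
      Real.sin (2 * Real.pi * v.2))) ∘ fun w : Plane => (sinSq w.1, sinSq w.2 / sinSq w.1) := by
  have h1 : ∀ᶠ w : Plane in 𝓝 v, sinSq w.2 < sinSq w.1 :=
    (continuous_sinSq.comp continuous_snd).continuousAt.eventually_lt
      (continuous_sinSq.comp continuous_fst).continuousAt hlt
  have hξc : Continuous fun w : Plane =>
    Real.sin (2 * Real.pi * w.1) * Real.sin (2 * Real.pi * w.2) := by fun_prop
  have h2 : ∀ᶠ w : Plane in 𝓝 v,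
      SignType.sign (Real.sin (2 * Real.pi * w.1) * Real.sin (2 * Real.pi * w.2)) =
        SignType.sign (Real.sin (2 * Real.pi * v.1) * Real.sin (2 * Real.pi * v.2)) :=
    tendsto_pure.1 (by
      simpa only [nhds_discrete, ContinuousAt, Function.comp_def] using
        ContinuousAt.comp_of_eq (continuousAt_sign_of_ne_zero h0) hξc.continuousAt rfl)
  filter_upwards [h1, h2] with w h1 h2
  have hS0 : 0 < sinSq w.1 := (sq_nonneg _).trans_lt h1
  have hq1 : sinSq w.2 / sinSq w.1 < 1 := (div_lt_one hS0).2 h1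
  have h3 : (sinSq w.1 - sinSq w.2) / sinSq w.1 = 1 - sinSq w.2 / sinSq w.1 := by field_simp
  have h4 : fold w = pillow (max (sinSq w.1) (sinSq w.2))
    ((sinSq w.1 - sinSq w.2) / max (sinSq w.1) (sinSq w.2)) (SignType.sign _) := fold_eq w
  rw [h4, max_eq_left h1.le, h2, h3, pillow, abs_of_pos (by linarith), sub_sub_cancel]
  rfl

lemma coe_sign_ne_zero {x : ℝ} (hx : x ≠ 0) : (SignType.sign x : ℝ) ≠ 0 := by
  rcases lt_or_gt_of_ne hx with h | h
  · rw [sign_neg h]; simp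
  · rw [sign_pos h]; simp

lemma exists_hasStrictFDerivAt_fold_of_sinSq_lt {v : Plane}
    (ha : Real.sin (2 * Real.pi * v.1) ≠ 0) (hb : Real.sin (2 * Real.pi * v.2) ≠ 0)
    (hlt : sinSq v.2 < sinSq v.1) :
    ∃ L : Plane →L[ℝ] Plane, HasStrictFDerivAt fold L v ∧ Function.Injective L := by
  have hS : 0 < sinSq v.1 := sinSq_pos ha
  have hq : 0 < sinSq v.2 / sinSq v.1 := div_pos (sinSq_pos hb) hS
  have hq' : sinSq v.2 / sinSq v.1 < 1 := (div_lt_one hS).2 hlt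
  obtain ⟨L, hL, hLi⟩ := exists_hasStrictFDerivAt_quotient (v := v) (S := sinSq) (R := sinSq)
    (hasStrictDerivAt_sinSq v.1) (hasStrictDerivAt_sinSq v.2)
    hS.ne' (mul_ne_zero Real.pi_ne_zero ha) (mul_ne_zero Real.pi_ne_zero hb)
  have he := fold_eventuallyEq_quotientChart hlt (mul_ne_zero ha hb)
  have hσ := coe_sign_ne_zero (mul_ne_zero ha hb)
  generalize ((SignType.sign (Real.sin (2 * Real.pi * v.1) * Real.sin (2 * Real.pi * v.2)) :
    SignType) : ℝ) = σ at he hσ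
  obtain ⟨L', hL', hLi'⟩ := exists_hasStrictFDerivAt_quotientChart hσ
    (p := (sinSq v.1, sinSq v.2 / sinSq v.1)) hS (sinSq_lt_one ha) hq hq'
  refine ⟨L' ∘L L, ?_, hLi'.comp hLi⟩
  have h := HasStrictFDerivAt.comp v (g := quotientChart σ) hL' hL
  exact h.congr_of_eventuallyEq he.symm

lemma exists_hasStrictFDerivAt_fold_of_lt {v : Plane} (hv : v ∈ irrat)
    (hlt : sinSq v.2 < sinSq v.1) :
    ∃ L : Plane →L[ℝ] Plane, HasStrictFDerivAt fold L v ∧ Function.Injective L :=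
  exists_hasStrictFDerivAt_fold_of_sinSq_lt (sin_two_mul_ne_zero_of_mem_irrat hv)
    (sin_two_mul_snd_ne_zero_of_mem_irrat hv) hlt

lemma exists_hasStrictFDerivAt_fold {v : Plane} (hv : v ∈ irrat) :
    ∃ L : Plane →L[ℝ] Plane, HasStrictFDerivAt fold L v ∧ Function.Injective L := by
  rcases lt_or_gt_of_ne (sin_sq_ne_of_mem_irrat hv) with h | h
  · obtain ⟨L, hL, hLi⟩ := exists_hasStrictFDerivAt_fold_of_lt (swap_mem_irrat hv) h
    let sw : Plane ≃L[ℝ] Plane := ContinuousLinearEquiv.prodComm ℝ ℝ ℝ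
    have hsw : ∀ w : Plane, sw w = w.swap := fun w => rfl
    have h1 : HasStrictFDerivAt (fun w : Plane => -sw (fold (sw w)))
        (-(sw.toContinuousLinearMap ∘L (L ∘L sw.toContinuousLinearMap))) v :=
      (sw.hasStrictFDerivAt.comp v (HasStrictFDerivAt.comp v hL sw.hasStrictFDerivAt)).neg
    refine ⟨_, h1.congr_of_eventuallyEq (Eventually.of_forall fun w => ?_), ?_⟩
    · simp only [hsw]
      exact (fold_swap w).symm
    · intro w w' hw
      have : sw (L (sw w)) = sw (L (sw w')) := neg_injective hw
      exact sw.injective (hLi (sw.injective this))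
  · exact exists_hasStrictFDerivAt_fold_of_lt hv h

lemma exists_dirAt_toral {d : Plane} (hd : d ∈ fold '' irrat) : ∃ ω, DirAt toral d ω := by
  obtain ⟨v, hv, rfl⟩ := hd
  obtain ⟨L, hL, hLi⟩ := exists_hasStrictFDerivAt_fold hv
  obtain ⟨L', hL', hLi'⟩ := exists_hasStrictFDerivAt_fold (cat_mem_irrat hv)
  let e : Plane ≃L[ℝ] Plane :=
    (LinearEquiv.ofInjectiveEndo L.toLinearMap hLi).toContinuousLinearEquiv
  have he : HasStrictFDerivAt fold (e : Plane →L[ℝ] Plane) v := by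
    have : (e : Plane →L[ℝ] Plane) = L := ContinuousLinearMap.ext fun w => rfl
    rwa [this]
  have hg := he.to_localInverse
  have hgv : he.localInverse fold e v (fold v) = v := he.localInverse_apply_image
  have hloc : toral =ᶠ[𝓝 (fold v)] fun y => fold (cat (he.localInverse fold e v y)) := by
    have h1 : ∀ᶠ y in 𝓝 (fold v), maxSq 1 (he.localInverse fold e v y) ≠ 0 :=
      he.localInverse_tendsto.eventually
        (continuous_maxSq_one.continuousAt.eventually_ne (maxSq_ne_zero_of_mem_irrat hv))
    filter_upwards [h1, he.eventually_right_inverse] with y h1 h2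
    conv_lhs => rw [← h2]
    exact toral_fold h1
  have hd : HasStrictFDerivAt (fun y => fold (cat (he.localInverse fold e v y)))
      (L' ∘L (cat.toContinuousLinearMap ∘L e.symm.toContinuousLinearMap)) (fold v) := by
    refine HasStrictFDerivAt.comp (fold v) ?_
      (HasStrictFDerivAt.comp (fold v) cat.hasStrictFDerivAt hg)
    rw [hgv]
    exact hL'
  exact ⟨_, DirAt.of_hasFDerivAt (hd.hasFDerivAt.congr_of_eventuallyEq hloc)
    (hLi'.comp (cat.injective.comp e.symm.injective))⟩

/-! ### Transferring the dynamics to an almost one-to-one extension -/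

/-- Specification fails if a fixed point has a neighbourhood in which backward orbits can only
stay when they start in a proper closed forward invariant set. -/
lemma not_bowenSpecification {X : Type*} [MetricSpace X] [CompactSpace X] (H : X ≃ₜ X) {q : X}
    (hq : H q = q) {W C : Set X} (hW : IsOpen W) (hqW : q ∈ W) (hC : IsClosed C)
    (hHC : MapsTo H C C) {w : X} (hw : w ∉ C)
    (htrap : ∀ x : ℕ → X, (∀ n, x n ∈ W) → (∀ n, H (x (n + 1)) = x n) → x 0 ∈ C) :
    ¬ BowenSpecification H := by
  intro hs
  obtain ⟨ε₁, hε₁, hb₁⟩ := nhds_basis_closedBall.mem_iff.1 (hW.mem_nhds hqW)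
  obtain ⟨ε₂, hε₂, hb₂⟩ := nhds_basis_closedBall.mem_iff.1 (hC.isOpen_compl.mem_nhds hw)
  obtain ⟨N, hN, hs⟩ := hs (min ε₁ ε₂) (lt_min hε₁ hε₂)
  have hinv : ∀ m : ℕ, Function.LeftInverse H^[m] H.symm^[m] := fun m =>
    Function.LeftInverse.iterate H.apply_symm_apply m
  have hinv' : ∀ m : ℕ, Function.LeftInverse H.symm^[m] H^[m] := fun m =>
    Function.LeftInverse.iterate H.symm_apply_apply m
  let K : ℕ → Set X := fun n =>
    {z | (∀ i ≤ n, H.symm^[i] z ∈ closedBall q ε₁) ∧ H^[N] z ∈ closedBall w ε₂}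
  have hKc : ∀ n, IsClosed (K n) := fun n => by
    have : K n = (⋂ i, ⋂ (_ : i ≤ n), H.symm^[i] ⁻¹' closedBall q ε₁) ∩
        H^[N] ⁻¹' closedBall w ε₂ := by ext; simp [K]
    rw [this]
    exact (isClosed_iInter fun i => isClosed_iInter fun _ =>
      isClosed_closedBall.preimage (H.symm.continuous.iterate i)).inter
        (isClosed_closedBall.preimage (H.continuous.iterate N))
  have hKne : ∀ n, (K n).Nonempty := by
    intro n
    obtain ⟨x, hx⟩ := hs 2 le_rfl (fun m => if m = 0 then q else H.symm^[n + N] w)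
      (fun m => if m = 0 then 0 else n + N) (fun m => if m = 0 then n else n + N) rfl
      (fun m _ => by split_ifs <;> omega)
      (fun m hm => by
        obtain rfl : m = 0 := by omega
        simp [hN])
    refine ⟨H^[n] x, fun i hi => ?_, ?_⟩
    · have h := hx 0 two_pos (n - i) (Nat.zero_le _) (Nat.sub_le _ _)
      have e : H^[n] x = H^[i] (H^[n - i] x) := by
        rw [← Function.iterate_add_apply, Nat.add_sub_cancel' hi]
      rw [e, hinv' i, mem_closedBall]
      simp only [if_true, Function.iterate_fixed hq] at h
      exact (h.trans_le (min_le_left _ _)).le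
    · have h := hx 1 one_lt_two (n + N) le_rfl le_rfl
      simp only [one_ne_zero, if_false, hinv (n + N) w] at h
      rw [← Function.iterate_add_apply, Nat.add_comm N n]
      exact (h.trans_le (min_le_right _ _)).le
  obtain ⟨z, hz⟩ := IsCompact.nonempty_iInter_of_sequence_nonempty_isCompact_isClosed K
    (fun n z hz => ⟨fun i hi => hz.1 i (hi.trans n.le_succ), hz.2⟩) hKne (hKc 0).isCompact hKc
  rw [mem_iInter] at hz
  have hzC : z ∈ C := htrap (fun n => H.symm^[n] z) (fun n => hb₁ ((hz n).1 n le_rfl)) fun n => by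
    rw [Function.iterate_succ_apply', H.apply_symm_apply]
  exact hb₂ (hz 0).2 (hHC.iterate N hzC)

section Extension

variable {X Y : Type*} [TopologicalSpace X] [CompactSpace X] [TopologicalSpace Y] [T2Space Y]

/-- A nonempty open set contains the preimage of an open set meeting the range, if the points with
singleton fibre are dense. -/
lemma exists_preimage_subset {p : X → Y} (hp : Continuous p)
    (hreg : Dense {x | ∀ y, p y = p x → y = x}) {O : Set X} (hO : IsOpen O) (hne : O.Nonempty) :
    ∃ V, IsOpen V ∧ p ⁻¹' V ⊆ O ∧ (V ∩ range p).Nonempty := by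
  obtain ⟨x, hxO, hx⟩ := hreg.exists_mem_open hO hne
  refine ⟨(p '' Oᶜ)ᶜ, (hO.isClosed_compl.isCompact.image hp).isClosed.isOpen_compl, ?_, p x, ?_,
    mem_range_self x⟩
  · intro y hy
    by_contra hyO
    exact hy ⟨y, hyO, rfl⟩
  · rintro ⟨y, hy, hyx⟩
    exact hy (hxO y hyx ▸ hx)

end Extension

/-- The boundary circle is invariant. -/
lemma toral_mem_sphere {z : Plane} (hz : z ∈ sphere (0 : Plane) 1) : toral z ∈ sphere 0 1 := by
  rw [mem_sphere_zero_iff_norm] at hz ⊢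
  obtain ⟨p, hp, rfl⟩ := exists_wrap_eq hz.le
  have h := maxSq_ne_zero_of_mem_polar hp
  rw [toral_wrap h]
  exact (norm_wrap_eq_one_iff (maxSq_cat_ne_zero h)).2 ((norm_wrap_eq_one_iff h).1 hz)

theorem dynamics_of_extension {X : Type*} [MetricSpace X] [CompactSpace X] (H : X ≃ₜ X)
    {p : X → Plane} (hp : Continuous p) (hpM : ∀ x, p x ∈ closedBall 0 1)
    (hpH : ∀ x, p (H x) = toral (p x))
    (hsurj : ∀ z ∈ closedBall (0 : Plane) 1, z ∉ fold '' irrat → ∃ x, p x = z)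
    (hinj : ∀ x y, p x = p y → p x ∉ fold '' irrat → x = y)
    (hreg : Dense {x | p x ∉ fold '' irrat}) :
    TopologicallyMixing H ∧ Dense {x | ∃ n : ℕ, 1 ≤ n ∧ H^[n] x = x} ∧
      ¬ BowenSpecification H := by
  have hpHn : ∀ n x, p (H^[n] x) = toral^[n] (p x) := fun n x =>
    (show Function.Semiconj p H toral from hpH).iterate_right n x
  have hfib : Dense {x | ∀ y, p y = p x → y = x} :=
    hreg.mono fun x hx y hxy => (hinj x y hxy.symm hx).symm
  have hopen : ∀ O : Set X, IsOpen O → O.Nonempty →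
      ∃ V, IsOpen V ∧ p ⁻¹' V ⊆ O ∧ (V ∩ closedBall 0 1).Nonempty := by
    intro O hO hne
    obtain ⟨V, hV, hVO, _, hz, x, rfl⟩ := exists_preimage_subset hp hfib hO hne
    exact ⟨V, hV, hVO, p x, hz, hpM x⟩
  have hsurj' : ∀ z ∈ closedBall (0 : Plane) 1, ∃ x, p x = z := by
    intro z hz
    have hd : Dense (fold '' irrat)ᶜ := (countable_irrat.image fold).dense_compl ℝ
    have hcl : closedBall (0 : Plane) 1 ⊆ closure (ball 0 1 ∩ (fold '' irrat)ᶜ) := by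
      rw [← closure_ball (0 : Plane) one_ne_zero]
      exact closure_minimal (hd.open_subset_closure_inter isOpen_ball) isClosed_closure
    have hr : ball (0 : Plane) 1 ∩ (fold '' irrat)ᶜ ⊆ range p := fun z hz =>
      hsurj z (ball_subset_closedBall hz.1) hz.2
    exact closure_minimal hr (isCompact_range hp).isClosed (hcl hz)
  refine ⟨fun U V hU hV hUne hVne => ?_, ?_, ?_⟩
  · obtain ⟨U', hU', hUU', hU'ne⟩ := hopen U hU hUne
    obtain ⟨V', hV', hVV', hV'ne⟩ := hopen V hV hVne
    obtain ⟨N, hN⟩ := toral_mixing hU' hV' hU'ne hV'ne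
    refine ⟨N, fun n hn => ?_⟩
    obtain ⟨z, ⟨hzU, hzM⟩, hzV⟩ := hN n hn
    obtain ⟨x, rfl⟩ := hsurj' z hzM
    exact ⟨H^[n] x, mem_image_of_mem _ (hUU' hzU), hVV' (by rwa [mem_preimage, hpHn])⟩
  · rw [dense_iff_inter_open]
    intro U hU hUne
    obtain ⟨U', hU', hUU', hU'ne⟩ := hopen U hU hUne
    obtain ⟨q₁, q₂, hq, hqU, n, hn, hper⟩ := exists_periodic_mem hU' hU'ne
    obtain ⟨x, hx⟩ := hsurj' _ (mem_closedBall_zero_iff.2 (norm_fold_lt hq).le)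
    refine ⟨x, hUU' (by rwa [mem_preimage, hx]), n, hn, (hinj _ _ ?_ ?_).symm⟩
    · rw [hpHn, hx, hper]
    · rw [hx]
      exact fold_rat_notMem hq
  · obtain ⟨W, hW, hbW, htrap⟩ := exists_backward_trap
    have hb := norm_wrap_zero contracting_ne_zero
    obtain ⟨q, hq⟩ := hsurj' (wrap 0 contracting) (mem_closedBall_zero_iff.2 hb.le)
    obtain ⟨w, hw⟩ := hsurj' 0 (mem_closedBall_self zero_le_one)
    refine not_bowenSpecification H (q := q) (w := w) (hinj _ _ ?_ ?_).symm (hW.preimage hp)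
      (by rwa [mem_preimage, hq]) (isClosed_sphere.preimage hp)
      (fun x hx => by rw [mem_preimage, hpH]; exact toral_mem_sphere hx) ?_ ?_
    · rw [hpH, hq, toral_boundary_fixed]
    · intro h
      have := mem_ball_zero_iff.1 (fold_image_irrat_subset h)
      rw [hq, hb] at this
      exact lt_irrefl _ this
    · rw [mem_preimage, hw, mem_sphere_zero_iff_norm, norm_zero]
      exact zero_ne_one
    · intro x hx hxx
      exact htrap (fun n => p (x n)) (fun n => ⟨hpM _, hx n⟩) fun n => by rw [← hpH, hxx]

end CarpetDynamics

open CarpetDynamics Metric in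
/-- The Sierpiński carpet admits a topologically mixing homeomorphism with a dense set of
periodic points and without Bowen's specification property. -/
theorem sierpinskiCarpet_mixing_dense_periodic_no_specification :
    ∃ H : ↥sierpinskiCarpet ≃ₜ ↥sierpinskiCarpet,
      TopologicallyMixing (⇑H) ∧
      Dense {x : ↥sierpinskiCarpet | ∃ n : ℕ, 1 ≤ n ∧ (⇑H)^[n] x = x} ∧
      ¬ BowenSpecification (⇑H) := by
  have hM : IsCompact (closedBall (0 : Plane) 1) := isCompact_closedBall 0 1
  have hinter : interior (closedBall (0 : Plane) 1) = ball 0 1 := interior_closedBall 0 one_ne_zero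
  have hcball : Set.range center ⊆ ball 0 1 := by
    rintro _ ⟨n, rfl⟩
    exact mem_ball_zero_iff.2 (norm_center_lt n)
  have hDc : (fold '' irrat).Countable := countable_irrat.image fold
  have hDint : fold '' irrat ⊆ interior (closedBall 0 1) := hinter ▸ fold_image_irrat_subset
  obtain ⟨Φ, hΦc, hΦb, hΦD, hΦd⟩ := exists_diffeo_image_eq (Set.countable_range center) hDc hcball
    fold_image_irrat_subset (ball_subset_closedBall.trans closedBall_subset_closure_center)
    ball_subset_closure_fold_irrat
  obtain ⟨E₁⟩ := nonempty_carpet_homeomorph_blowUp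
  obtain ⟨E₂, -⟩ := exists_homeomorph_blowUp hM hDc (hcball.trans ball_subset_closedBall) hDint
    hΦc.continuousOn hΦb hΦD fun d _ =>
      let ⟨_, hL, hLi⟩ := hΦd d
      ⟨_, DirAt.of_hasFDerivAt hL hLi⟩
  obtain ⟨G, hG⟩ := exists_homeomorph_blowUp hM hDc (hDint.trans interior_subset) hDint
    continuousOn_toral bijOn_toral toral_image_fold_irrat fun _ => exists_dirAt_toral
  let E := E₁.trans E₂
  have : CompactSpace (BlowUp (closedBall 0 1) (fold '' irrat)) :=
    isCompact_iff_compactSpace.1 (isCompact_blowUp hM _)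
  have : CompactSpace sierpinskiCarpet := E.symm.compactSpace
  refine ⟨(E.trans G).trans E.symm, dynamics_of_extension _ (p := fun x => (E x).1.1)
    (continuous_fst.comp (continuous_subtype_val.comp E.continuous)) (fun x => (E x).2.1)
    (fun x => ?_) (fun z hz hD => ?_) (fun x y h hD => ?_) ?_⟩
  · change (E (E.symm (G (E x)))).1.1 = _
    rw [E.apply_symm_apply, hG]
  · obtain ⟨q, hq⟩ := exists_blowUp hz hD
    exact ⟨E.symm q, by rw [E.apply_symm_apply, hq]⟩
  · exact E.injective (BlowUp.eq_of_fst_eq_of_notMem h hD)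
  · exact (dense_regular hDc hDint).preimage E.isOpenMap
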